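/- (Exotic CHM configurations, several alternating orbits) Let n₁ ≥ 3 be an odd integer and n₂ ≥ 1 an integer. Suppose either k = 2 and ε₀ ∈ {−1, 0}, or k = 4 and ε₀ = 1. Let φ = e^{2πi/k}. Then there exist real numbers 0 < p_{11} < … < p_{1n₁} and 0 < p_{21} < … < p_{2n₂} such that the configuration whose points are p_{1j}·φ^m with charge +1 if j is odd and −1 if j is even (j = 1, …, n₁, m = 0, …, k−1), and p_{2j}·e^{iπ/k}·φ^m with charge −1 (j = 1, …, n₂, m = 0, …, k−1), together with the origin with charge ε₀ when ε₀ ≠ 0, is balanced. -/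

import Mathlib

/-- The force at a point of a configuration: `F j = conj (p j) + ∑_{k ≠ j} ε k / (p j - p k)`. -/
noncomputable def force {ι : Type*} [Fintype ι] [DecidableEq ι]
    (p ε : ι → ℂ) (j : ι) : ℂ :=
  (starRingEnd ℂ) (p j) + ∑ k ∈ Finset.univ.erase j, ε k / (p j - p k)

section

open Filter Topology Set

theorem exists_continuousOn_argmax {X Y : Type*} [MetricSpace X] [LocallyCompactSpace X]
    [MetricSpace Y] [Nonempty Y] {P : Set X} (hP : IsOpen P) {O : Set (X × Y)} (hO : IsOpen O)
    {f : X × Y → ℝ} (hf : ContinuousOn f O)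
    (hne : ∀ x ∈ P, ∃ y, (x, y) ∈ O)
    (hcomp : ∀ K ⊆ P, IsCompact K → ∀ C, IsCompact {p | p ∈ O ∧ p.1 ∈ K ∧ C ≤ f p})
    (huniq : ∀ x ∈ P, ∀ y y', (x, y) ∈ O → (x, y') ∈ O →
      (∀ w, (x, w) ∈ O → f (x, w) ≤ f (x, y)) →
      (∀ w, (x, w) ∈ O → f (x, w) ≤ f (x, y')) → y = y') :
    ∃ g : X → Y, ContinuousOn g P ∧
      ∀ x ∈ P, (x, g x) ∈ O ∧ ∀ y, (x, y) ∈ O → f (x, y) ≤ f (x, g x) := by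
  have hex : ∀ x ∈ P, ∃ y, (x, y) ∈ O ∧ ∀ w, (x, w) ∈ O → f (x, w) ≤ f (x, y) := by
    intro x hx
    obtain ⟨y₀, hy₀⟩ := hne x hx
    have hK := hcomp {x} (by simpa using hx) isCompact_singleton (f (x, y₀))
    obtain ⟨⟨x', y⟩, ⟨hpO, hpx, hpf⟩, hmax⟩ := hK.exists_isMaxOn ⟨(x, y₀), hy₀, rfl, le_rfl⟩
      (hf.mono fun p hp => hp.1)
    obtain rfl : x' = x := hpx
    refine ⟨y, hpO, fun w hw => ?_⟩
    rcases le_total (f (x', y₀)) (f (x', w)) with h | h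
    · exact hmax ⟨hw, rfl, h⟩
    · exact h.trans hpf
  classical
  choose! g hgO hgmax using hex
  refine ⟨g, fun x₀ hx₀ => ContinuousAt.continuousWithinAt ?_, fun x hx => ⟨hgO x hx, hgmax x hx⟩⟩
  obtain ⟨K, hKx, hKP, hK⟩ := local_compact_nhds (hP.mem_nhds hx₀)
  have hS := hcomp K hKP hK (f (x₀, g x₀) - 1)
  have hcont : ∀ x y, (x, y) ∈ O → ContinuousAt f (x, y) := fun x y h =>
    hf.continuousAt (hO.mem_nhds h)
  have hslice : ∀ y, (x₀, y) ∈ O → ∀ M < f (x₀, y), ∀ᶠ x in 𝓝 x₀, (x, y) ∈ O ∧ M < f (x, y) := by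
    intro y hy M hM
    have h1 : Tendsto (fun x => (x, y)) (𝓝 x₀) (𝓝 (x₀, y)) :=
      (Continuous.prodMk_left y).continuousAt
    exact (h1.eventually (hO.mem_nhds hy)).and
      (h1.eventually ((hcont _ _ hy).eventually (lt_mem_nhds hM)))
  have hev : ∀ᶠ x in 𝓝 x₀, (x, g x) ∈ {p | p ∈ O ∧ p.1 ∈ K ∧ f (x₀, g x₀) - 1 ≤ f p} := by
    filter_upwards [hKx, hslice _ (hgO x₀ hx₀) (f (x₀, g x₀) - 1) (by linarith)] with x hxK hx
    exact ⟨hgO x (hKP hxK), hxK, hx.2.le.trans (hgmax x (hKP hxK) _ hx.1)⟩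
  have key : Tendsto (fun x => (x, g x)) (𝓝 x₀) (𝓝 (x₀, g x₀)) := by
    refine hS.tendsto_nhds_of_unique_mapClusterPt hev ?_
    rintro ⟨x₁, y₁⟩ ⟨hpO, -, -⟩ hcl
    have hx₁ : x₁ = x₀ := by
      have h1 : MapClusterPt x₁ (𝓝 x₀) (fun x : X => x) :=
        hcl.tendsto_comp (continuous_fst.tendsto (x₁, y₁))
      have : ClusterPt x₁ (𝓝 x₀) := by simpa [MapClusterPt] using h1
      exact eq_of_nhds_neBot this
    subst hx₁
    rw [huniq x₁ hx₀ y₁ (g x₁) hpO (hgO _ hx₀) ?_ (hgmax _ hx₀)]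
    intro w hw
    by_contra! hlt
    obtain ⟨M, hM1, hM2⟩ := exists_between hlt
    have h1 := hcl.frequently ((hcont _ _ hpO).eventually (gt_mem_nhds hM1))
    obtain ⟨x, hx1, hx2, hx3⟩ := (h1.and_eventually ((hslice w hw M hM2).and
      (hP.mem_nhds hx₀))).exists
    exact absurd (hgmax x hx3 w hx2.1) (by linarith [hx2.2])
  exact (continuous_snd.tendsto _).comp key

end

section

open Filter Topology Set

/-- If `D (x, g x) (V x) < 0` on a compact set, where `D p v` is the directional derivative of `f`
in its first argument and `g x` maximises `f (x, ·)`, then moving along `V` decreases the maximum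
`f (x, g x)` at a uniform rate. -/
theorem IsCompact.exists_uniform_descent {E Y : Type*} [NormedAddCommGroup E] [NormedSpace ℝ E]
    [MetricSpace Y] {P K : Set E} (hP : IsOpen P) (hKP : K ⊆ P) (hK : IsCompact K)
    {O : Set (E × Y)} (hO : IsOpen O) {f : E × Y → ℝ} {g : E → Y} (hg : ContinuousOn g P)
    (hgO : ∀ x ∈ P, (x, g x) ∈ O) (hgmax : ∀ x ∈ P, ∀ y, (x, y) ∈ O → f (x, y) ≤ f (x, g x))
    {D : E × Y → E → ℝ} (hD : ContinuousOn (fun q : (E × Y) × E => D q.1 q.2) (O ×ˢ univ))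
    (hder : ∀ x y, (x, y) ∈ O → ∀ v, HasDerivAt (fun t : ℝ => f (x + t • v, y)) (D (x, y) v) 0)
    {V : E → E} (hV : ContinuousOn V P) (hneg : ∀ x ∈ K, D (x, g x) (V x) < 0) :
    ∃ t₀ > 0, ∃ δ > 0, ∀ x ∈ K, ∀ t : ℝ, 0 < t → t ≤ t₀ →
      f (x + t • V x, g (x + t • V x)) ≤ f (x, g x) - t * δ := by
  refine hK.induction_on (p := fun S => ∃ t₀ > 0, ∃ δ > 0, ∀ x ∈ S, ∀ t : ℝ, 0 < t → t ≤ t₀ →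
      f (x + t • V x, g (x + t • V x)) ≤ f (x, g x) - t * δ) ⟨1, one_pos, 1, one_pos, by simp⟩
    ?_ ?_ ?_
  · rintro s t hst ⟨t₀, ht₀, δ, hδ, h⟩
    exact ⟨t₀, ht₀, δ, hδ, fun x hx => h x (hst hx)⟩
  · rintro s t ⟨t₁, ht₁, δ₁, hδ₁, h₁⟩ ⟨t₂, ht₂, δ₂, hδ₂, h₂⟩
    refine ⟨min t₁ t₂, lt_min ht₁ ht₂, min δ₁ δ₂, lt_min hδ₁ hδ₂, fun x hx t ht htt => ?_⟩
    rcases hx with hx | hx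
    · have := h₁ x hx t ht (htt.trans (min_le_left _ _))
      nlinarith [min_le_left δ₁ δ₂]
    · have := h₂ x hx t ht (htt.trans (min_le_right _ _))
      nlinarith [min_le_right δ₁ δ₂]
  intro x₀ hx₀
  have hx₀P := hKP hx₀
  have hp₀ := hgO x₀ hx₀P
  obtain ⟨M, hM, hM0⟩ := exists_between (hneg x₀ hx₀)
  have hDc : ContinuousAt (fun q : (E × Y) × E => D q.1 q.2) ((x₀, g x₀), V x₀) :=
    hD.continuousAt ((hO.prod isOpen_univ).mem_nhds ⟨hp₀, mem_univ _⟩)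
  have hloc : ∀ᶠ q : (E × Y) × E in 𝓝 ((x₀, g x₀), V x₀), q.1 ∈ O ∧ D q.1 q.2 ≤ M :=
    (continuous_fst.continuousAt.eventually (hO.mem_nhds hp₀)).and
      ((hDc.eventually (gt_mem_nhds hM)).mono fun _ h => le_of_lt h)
  obtain ⟨r, hr, hball⟩ := Metric.eventually_nhds_iff_ball.1 hloc
  have hVc : ContinuousAt V x₀ := hV.continuousAt (hP.mem_nhds hx₀P)
  have hgc : ContinuousAt g x₀ := hg.continuousAt (hP.mem_nhds hx₀P)
  have hmove : Tendsto (fun q : E × ℝ => q.1 + q.2 • V q.1) (𝓝 (x₀, 0)) (𝓝 x₀) := by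
    have h1 : ContinuousAt (fun q : E × ℝ => q.1 + q.2 • V q.1) (x₀, 0) :=
      continuousAt_fst.add (continuousAt_snd.smul (ContinuousAt.comp (f := Prod.fst) hVc
        continuousAt_fst))
    simpa [ContinuousAt] using h1
  have hev : ∀ᶠ q : E × ℝ in 𝓝 (x₀, 0), dist (V q.1) (V x₀) < r ∧
      dist (q.1 + q.2 • V q.1) x₀ < r ∧ q.1 + q.2 • V q.1 ∈ P ∧
      dist (g (q.1 + q.2 • V q.1)) (g x₀) < r ∧ q.1 ∈ P := by
    have hfst : Tendsto (fun q : E × ℝ => q.1) (𝓝 (x₀, 0)) (𝓝 x₀) := continuousAt_fst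
    filter_upwards [(hVc.tendsto.comp hfst).eventually (Metric.ball_mem_nhds _ hr),
      hmove.eventually (Metric.ball_mem_nhds _ hr), hmove.eventually (hP.mem_nhds hx₀P),
      (hgc.tendsto.comp hmove).eventually (Metric.ball_mem_nhds _ hr),
      hfst.eventually (hP.mem_nhds hx₀P)] with q h1 h2 h3 h4 h5
    exact ⟨h1, h2, h3, h4, h5⟩
  obtain ⟨t₁, ht₁, hev'⟩ := Metric.eventually_nhds_iff_ball.1 hev
  refine ⟨Metric.ball x₀ t₁ ∩ K, inter_comm K _ ▸
    inter_mem_nhdsWithin K (Metric.ball_mem_nhds _ ht₁), t₁ / 2, by positivity, -M,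
    by linarith, ?_⟩
  rintro x ⟨hx, hxK⟩ t ht htt
  have hq : ∀ θ ∈ Icc 0 t, (x, θ) ∈ Metric.ball (x₀, (0 : ℝ)) t₁ := by
    intro θ hθ
    rw [← ball_prod_same]
    refine ⟨hx, ?_⟩
    simp only [Metric.mem_ball, dist_zero_right, Real.norm_eq_abs, abs_of_nonneg hθ.1]
    linarith [hθ.2]
  set y := g (x + t • V x) with hy
  obtain ⟨-, -, hxtP, hyr, hxP⟩ := hev' _ (hq t ⟨ht.le, le_rfl⟩)
  have hin : ∀ θ ∈ Icc 0 t, (x + θ • V x, y) ∈ O ∧ D (x + θ • V x, y) (V x) ≤ M := by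
    intro θ hθ
    obtain ⟨h1, h2, -⟩ := hev' _ (hq θ hθ)
    refine hball ((x + θ • V x, y), V x) ?_
    rw [← ball_prod_same, ← ball_prod_same]
    exact ⟨⟨h2, hyr⟩, h1⟩
  have hderiv : ∀ θ ∈ Icc 0 t,
      HasDerivAt (fun t : ℝ => f (x + t • V x, y)) (D (x + θ • V x, y) (V x)) θ := by
    intro θ hθ
    have h := hder _ _ (hin θ hθ).1 (V x)
    have h2 := HasDerivAt.comp_sub_const θ θ (by simpa using h)
    refine h2.congr_of_eventuallyEq (Eventually.of_forall fun u => ?_)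
    beta_reduce
    congr 2
    module
  have hmv := Convex.image_sub_le_mul_sub_of_deriv_le (convex_Icc 0 t)
    (f := fun t : ℝ => f (x + t • V x, y)) (C := M)
    (fun θ hθ => (hderiv θ hθ).continuousAt.continuousWithinAt)
    (fun θ hθ => (hderiv θ (interior_subset hθ)).differentiableAt.differentiableWithinAt)
    (fun θ hθ => by
      rw [(hderiv θ (interior_subset hθ)).deriv]; exact (hin θ (interior_subset hθ)).2)
    0 ⟨le_rfl, ht.le⟩ t ⟨ht.le, le_rfl⟩ ht.le
  have hx0 := hgmax x hxP y (by simpa using (hin 0 ⟨le_rfl, ht.le⟩).1)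
  simp only [zero_smul, add_zero, sub_zero] at hmv
  linarith

end

section

open Filter Topology Set

/-- A saddle point theorem: `f ((a, s), y)` has a unique maximum in `y`, and that maximum is
coercive in `a` for `s` in a compact interval. If the critical points of the maximum with respect
to `a` repel from both ends of the interval, there is a critical point. -/
theorem exists_critical_of_argmax {ι Y : Type*} [Fintype ι] [MetricSpace Y] [Nonempty Y]
    {U : Set (ι → ℝ)} (hU : IsOpen U) (hUc : Uᶜ.Nonempty) (hUne : U.Nonempty)
    {O : Set (((ι → ℝ) × ℝ) × Y)} (hO : IsOpen O) {f : ((ι → ℝ) × ℝ) × Y → ℝ}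
    {GA : ((ι → ℝ) × ℝ) × Y → ι → ℝ} {GS : ((ι → ℝ) × ℝ) × Y → ℝ}
    (hf : ContinuousOn f O) (hGA : ContinuousOn GA O) (hGS : ContinuousOn GS O)
    (hne : ∀ a ∈ U, ∀ s, ∃ y, ((a, s), y) ∈ O)
    (hcomp : ∀ K ⊆ U ×ˢ univ, IsCompact K → ∀ C, IsCompact {p | p ∈ O ∧ p.1 ∈ K ∧ C ≤ f p})
    (huniq : ∀ x ∈ U ×ˢ univ, ∀ y y', (x, y) ∈ O → (x, y') ∈ O →
      (∀ w, (x, w) ∈ O → f (x, w) ≤ f (x, y)) →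
      (∀ w, (x, w) ∈ O → f (x, w) ≤ f (x, y')) → y = y')
    (hder : ∀ x y, (x, y) ∈ O → ∀ v, HasDerivAt (fun t : ℝ => f (x + t • v, y))
      (∑ j, GA (x, y) j * v.1 j + GS (x, y) * v.2) 0)
    {s₁ s₂ : ℝ} (hs : s₁ < s₂)
    (hcoer : ∀ C, ∃ K ⊆ U ×ˢ univ, IsCompact K ∧ ∀ a ∈ U, ∀ s ∈ Icc s₁ s₂,
      (∀ y, ((a, s), y) ∈ O → f ((a, s), y) ≤ C) → (a, s) ∈ K)
    (hlow : ∀ a ∈ U, ∀ y, ((a, s₁), y) ∈ O →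
      (∀ w, ((a, s₁), w) ∈ O → f ((a, s₁), w) ≤ f ((a, s₁), y)) →
      GA ((a, s₁), y) = 0 → 0 < GS ((a, s₁), y))
    (hhigh : ∀ a ∈ U, ∀ y, ((a, s₂), y) ∈ O →
      (∀ w, ((a, s₂), w) ∈ O → f ((a, s₂), w) ≤ f ((a, s₂), y)) →
      GA ((a, s₂), y) = 0 → GS ((a, s₂), y) < 0) :
    ∃ a ∈ U, ∃ s y, ((a, s), y) ∈ O ∧ (∀ w, ((a, s), w) ∈ O → f ((a, s), w) ≤ f ((a, s), y)) ∧
      GA ((a, s), y) = 0 ∧ GS ((a, s), y) = 0 := by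
  have hP : IsOpen (U ×ˢ univ : Set ((ι → ℝ) × ℝ)) := hU.prod isOpen_univ
  obtain ⟨g, hg, hgO⟩ := exists_continuousOn_argmax hP hO hf (fun x hx => hne x.1 hx.1 x.2)
    hcomp huniq
  by_contra hno
  set P : Set ((ι → ℝ) × ℝ) := U ×ˢ univ with hPdef
  have hgc : ContinuousOn (fun x => (x, g x)) P := continuousOn_id.prodMk hg
  have hgm : MapsTo (fun x => (x, g x)) P O := fun x hx => (hgO x hx).1
  set Ψ : (ι → ℝ) × ℝ → ℝ := fun x => f (x, g x) with hΨ
  have hΨc : ContinuousOn Ψ P := hf.comp hgc hgm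
  have hGAc : ContinuousOn (fun x => GA (x, g x)) P := hGA.comp hgc hgm
  have hGSc : ContinuousOn (fun x => GS (x, g x)) P := hGS.comp hgc hgm
  -- the descending field, evaluated at the nearest point of the strip
  set c : (ι → ℝ) × ℝ → (ι → ℝ) × ℝ := fun x => (x.1, max s₁ (min s₂ x.2)) with hc
  have hcc : Continuous c := by fun_prop
  have hcP : MapsTo c P P := fun x hx => ⟨hx.1, mem_univ _⟩
  set VS : (ι → ℝ) × ℝ → ℝ := fun x =>
    (x.2 - s₁) * max (-GS (x, g x)) 0 - (s₂ - x.2) * max (GS (x, g x)) 0 with hVS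
  set ρ : (ι → ℝ) × ℝ → ℝ := fun x => Metric.infDist x.1 Uᶜ / (2 * (1 + ‖GA (x, g x)‖)) with hρ
  have hρpos : ∀ x ∈ P, 0 < ρ x := by
    intro x hx
    have : 0 < Metric.infDist x.1 Uᶜ :=
      (hU.isClosed_compl.notMem_iff_infDist_pos hUc).1 (by simpa using hx.1)
    positivity
  set V₀ : (ι → ℝ) × ℝ → (ι → ℝ) × ℝ := fun x => ρ x • (-GA (x, g x), VS x) with hV₀
  have hV₀c : ContinuousOn V₀ P := by
    have hρc : ContinuousOn ρ P := by
      refine ContinuousOn.div ?_ (by fun_prop) fun x _ => by positivity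
      exact ((Metric.continuous_infDist_pt _).comp continuous_fst).continuousOn
    refine hρc.smul (hGAc.neg.prodMk ?_)
    fun_prop
  set V : (ι → ℝ) × ℝ → (ι → ℝ) × ℝ := fun x => V₀ (c x) with hV
  have hVc : ContinuousOn V P := hV₀c.comp hcc.continuousOn hcP
  have hstrip : ∀ x : (ι → ℝ) × ℝ, x.2 ∈ Icc s₁ s₂ → c x = x := by
    rintro ⟨a, s⟩ ⟨h1, h2⟩
    simp only [hc, Prod.mk.injEq, true_and] at h1 h2 ⊢
    rw [min_eq_right h2, max_eq_right h1]
  have hmoveP : ∀ x ∈ P, ∀ t : ℝ, 0 < t → t ≤ 1 → x + t • V x ∈ P := by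
    intro x hx t ht ht1
    refine ⟨?_, mem_univ _⟩
    by_contra hnot
    have hle : Metric.infDist x.1 Uᶜ ≤ dist x.1 (x + t • V x).1 :=
      Metric.infDist_le_dist_of_mem hnot
    have hpos : 0 < Metric.infDist x.1 Uᶜ :=
      (hU.isClosed_compl.notMem_iff_infDist_pos hUc).1 (by simpa using hx.1)
    have hρx := hρpos _ (hcP hx)
    set N := ‖GA (c x, g (c x))‖ with hN
    have hN0 : 0 ≤ N := norm_nonneg _
    have hd : dist x.1 (x + t • V x).1 = t * (ρ (c x) * N) := by
      simp only [hV, hV₀, dist_eq_norm, Prod.fst_add, Prod.smul_fst, sub_add_cancel_left,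
        norm_neg, norm_smul, Real.norm_eq_abs, abs_of_pos ht, abs_of_pos hρx, hN]
    have hρN : ρ (c x) * N ≤ Metric.infDist x.1 Uᶜ / 2 := by
      have : ρ (c x) * (1 + N) = Metric.infDist x.1 Uᶜ / 2 := by
        simp only [hρ, hN, hc]
        field_simp
      nlinarith
    nlinarith [mul_nonneg hρx.le hN0]
  have hneg : ∀ x ∈ P, x.2 ∈ Icc s₁ s₂ →
      ∑ j, GA (x, g x) j * (V x).1 j + GS (x, g x) * (V x).2 < 0 := by
    intro x hx hxs
    have hρx := hρpos x hx
    have hexp : ∑ j, GA (x, g x) j * (V x).1 j + GS (x, g x) * (V x).2 =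
        ρ x * (-∑ j, GA (x, g x) j ^ 2 + GS (x, g x) * VS x) := by
      simp only [hV, hstrip x hxs, hV₀, Prod.smul_fst, Prod.smul_snd, smul_eq_mul, Pi.smul_apply,
        Pi.neg_apply, mul_add, mul_neg, Finset.mul_sum, ← Finset.sum_neg_distrib]
      congr 1
      · exact Finset.sum_congr rfl fun j _ => by ring
      · ring
    rw [hexp]
    refine mul_neg_of_pos_of_neg hρx ?_
    have hsum : 0 ≤ ∑ j, GA (x, g x) j ^ 2 := Finset.sum_nonneg fun j _ => sq_nonneg _
    have h1 : 0 ≤ x.2 - s₁ := sub_nonneg.2 hxs.1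
    have h2 : 0 ≤ s₂ - x.2 := sub_nonneg.2 hxs.2
    have hGV : GS (x, g x) * VS x ≤ 0 := by
      simp only [hVS]
      rcases le_total 0 (GS (x, g x)) with h | h
      · rw [max_eq_right (by linarith : -GS (x, g x) ≤ 0), max_eq_left h]
        nlinarith [mul_nonneg h2 (mul_nonneg h h)]
      · rw [max_eq_left (by linarith : 0 ≤ -GS (x, g x)), max_eq_right h]
        nlinarith [mul_nonneg h1 (mul_nonneg_of_nonpos_of_nonpos h h)]
    by_contra! hge
    have hsum0 : ∑ j, GA (x, g x) j ^ 2 = 0 := by linarith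
    have hGV0 : GS (x, g x) * VS x = 0 := by linarith
    have hGA0 : GA (x, g x) = 0 := by
      funext j
      have := (Finset.sum_eq_zero_iff_of_nonneg fun j _ => sq_nonneg (GA (x, g x) j)).1 hsum0 j
        (Finset.mem_univ j)
      simpa using this
    obtain ⟨a, s⟩ := x
    obtain ⟨hO1, hmax1⟩ := hgO (a, s) hx
    have hGS0 : GS ((a, s), g (a, s)) ≠ 0 := fun h0 =>
      hno ⟨a, hx.1, s, g (a, s), hO1, hmax1, hGA0, h0⟩
    have hVS0 : VS (a, s) = 0 := by simpa [hGS0] using hGV0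
    simp only [hVS] at hVS0
    rcases lt_or_gt_of_ne hGS0 with h | h
    · rw [max_eq_left (by linarith : 0 ≤ -GS ((a, s), g (a, s))), max_eq_right h.le] at hVS0
      have : s = s₁ := by
        have : (s - s₁) * -GS ((a, s), g (a, s)) = 0 := by linarith
        rcases mul_eq_zero.1 this with h' | h' <;> linarith
      subst this
      linarith [hlow a hx.1 _ hO1 hmax1 hGA0]
    · rw [max_eq_right (by linarith : -GS ((a, s), g (a, s)) ≤ 0), max_eq_left h.le] at hVS0
      have : s = s₂ := by
        have : (s₂ - s) * GS ((a, s), g (a, s)) = 0 := by linarith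
        rcases mul_eq_zero.1 this with h' | h' <;> linarith
      subst this
      linarith [hhigh a hx.1 _ hO1 hmax1 hGA0]
  have hsub : ∀ C, IsCompact {x | x ∈ P ∧ x.2 ∈ Icc s₁ s₂ ∧ Ψ x ≤ C} := by
    intro C
    obtain ⟨K, hKP, hK, hKC⟩ := hcoer C
    have hcl : IsClosed (K ∩ (Ψ ⁻¹' Iic C)) :=
      (hΨc.mono hKP).preimage_isClosed_of_isClosed hK.isClosed isClosed_Iic
    have hcl2 : IsClosed ((K ∩ (Ψ ⁻¹' Iic C)) ∩ (Prod.snd ⁻¹' Icc s₁ s₂)) :=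
      hcl.inter (isClosed_Icc.preimage continuous_snd)
    convert hK.of_isClosed_subset hcl2 fun x hx => hx.1.1 using 1
    ext x
    constructor
    · rintro ⟨h1, h2, h3⟩
      exact ⟨⟨hKC x.1 h1.1 x.2 h2 fun y hy => ((hgO x h1).2 y hy).trans h3, h3⟩, h2⟩
    · rintro ⟨⟨h1, h2⟩, h3⟩
      exact ⟨hKP h1, h3, h2⟩
  -- levels of connected sets crossing the strip
  set S : Set ℝ := {C | ∃ K ⊆ P, IsPreconnected K ∧ (∃ x ∈ K, x.2 ≤ s₁) ∧ (∃ x ∈ K, s₂ ≤ x.2) ∧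
    ∀ x ∈ K, x.2 ∈ Icc s₁ s₂ → Ψ x ≤ C} with hS
  have hSne : S.Nonempty := by
    obtain ⟨a, ha⟩ := hUne
    have hK : IsCompact (({a} : Set (ι → ℝ)) ×ˢ Icc s₁ s₂) := isCompact_singleton.prod isCompact_Icc
    obtain ⟨C, hC⟩ := hK.bddAbove_image (f := Ψ) (hΨc.mono fun x hx => ⟨by
      rw [mem_singleton_iff.1 hx.1]; exact ha, mem_univ _⟩)
    refine ⟨C, {a} ×ˢ univ, fun x hx => ⟨by rw [mem_singleton_iff.1 hx.1]; exact ha, mem_univ _⟩,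
      isPreconnected_singleton.prod isPreconnected_univ, ⟨(a, s₁), by simp⟩, ⟨(a, s₂), by simp⟩,
      fun x hx hxs => hC ⟨x, ⟨hx.1, hxs⟩, rfl⟩⟩
  have hSbdd : BddBelow S := by
    obtain ⟨C₀, hC₀⟩ := hSne
    obtain ⟨B, hB⟩ := (hsub C₀).bddBelow_image (f := Ψ) (hΨc.mono fun x hx => hx.1)
    refine ⟨min B C₀, fun C hC => ?_⟩
    rcases le_total C₀ C with h | h
    · exact (min_le_right _ _).trans h
    obtain ⟨K, hKP, hKc, ⟨x, hx, hxs⟩, ⟨y, hy, hys⟩, hKC⟩ := hC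
    obtain ⟨z, hz, hzs⟩ := (hKc.image Prod.snd continuous_snd.continuousOn).ordConnected.out
      (mem_image_of_mem _ hx) (mem_image_of_mem _ hy) ⟨hxs, hs.le.trans hys⟩
    have hz2 : z.2 ∈ Icc s₁ s₂ := by rw [hzs]; exact ⟨le_rfl, hs.le⟩
    have h1 := hKC z hz hz2
    exact (min_le_left _ _).trans ((hB ⟨z, ⟨hKP hz, hz2, h1.trans h⟩, rfl⟩).trans h1)
  obtain ⟨t₀, ht₀, δ, hδ, hdesc⟩ := (hsub (sInf S + 1)).exists_uniform_descent hP
    (fun x hx => hx.1) hO hg (fun x hx => (hgO x hx).1) (fun x hx => (hgO x hx).2)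
    (D := fun p v => ∑ j, GA p j * v.1 j + GS p * v.2) (by
      have h1 : ContinuousOn (fun q : (((ι → ℝ) × ℝ) × Y) × ((ι → ℝ) × ℝ) => GA q.1) (O ×ˢ univ) :=
        hGA.comp continuousOn_fst fun q hq => hq.1
      have h2 : ContinuousOn (fun q : (((ι → ℝ) × ℝ) × Y) × ((ι → ℝ) × ℝ) => GS q.1) (O ×ˢ univ) :=
        hGS.comp continuousOn_fst fun q hq => hq.1
      refine ContinuousOn.add (continuousOn_finsetSum _ fun j _ => ?_)
        (h2.mul (by fun_prop))
      exact (continuousOn_pi.1 h1 j).mul (by fun_prop)) hder hVc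
    (fun x hx => hneg x hx.1 hx.2.1)
  set t := min t₀ 1 with ht
  have htpos : 0 < t := lt_min ht₀ one_pos
  obtain ⟨C, hCS, hC⟩ := exists_lt_of_csInf_lt hSne
    (show sInf S < sInf S + min 1 (t * δ) from lt_add_of_pos_right _ (by positivity))
  have hC1 : C ≤ sInf S + 1 := hC.le.trans (by gcongr; exact min_le_left _ _)
  have hC2 : C - t * δ < sInf S := by linarith [min_le_right 1 (t * δ)]
  refine absurd (csInf_le hSbdd (a := C - t * δ) ?_) (not_le.2 hC2)
  obtain ⟨K, hKP, hKc, ⟨x, hx, hxs⟩, ⟨y, hy, hys⟩, hKC⟩ := hCS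
  have hlowmove : ∀ x ∈ P, x.2 ≤ s₁ → (x + t • V x).2 ≤ x.2 := by
    intro x hxP hx
    have h2 : (c x).2 = s₁ := by
      simp only [hc]
      rw [min_eq_right (hx.trans hs.le), max_eq_left hx]
    have hρx := hρpos _ (hcP hxP)
    have h3 : VS (c x) ≤ 0 := by
      simp only [hVS, h2, sub_self, zero_mul, zero_sub]
      exact neg_nonpos.2 (mul_nonneg (by linarith) (le_max_right _ _))
    have : (x + t • V x).2 = x.2 + t * (ρ (c x) * VS (c x)) := by simp [hV, hV₀]
    rw [this]
    nlinarith [mul_nonneg htpos.le (mul_nonneg hρx.le (neg_nonneg.2 h3))]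
  have hhighmove : ∀ x ∈ P, s₂ ≤ x.2 → x.2 ≤ (x + t • V x).2 := by
    intro x hxP hx
    have h2 : (c x).2 = s₂ := by
      simp only [hc]
      rw [min_eq_left hx, max_eq_right hs.le]
    have hρx := hρpos _ (hcP hxP)
    have h3 : 0 ≤ VS (c x) := by
      simp only [hVS, h2, sub_self, zero_mul, sub_zero]
      exact mul_nonneg (by linarith) (le_max_right _ _)
    have : (x + t • V x).2 = x.2 + t * (ρ (c x) * VS (c x)) := by simp [hV, hV₀]
    rw [this]
    nlinarith [mul_nonneg htpos.le (mul_nonneg hρx.le h3)]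
  refine ⟨(fun x => x + t • V x) '' K, ?_, hKc.image _ ?_,
    ⟨_, mem_image_of_mem _ hx, (hlowmove x (hKP hx) hxs).trans hxs⟩,
    ⟨_, mem_image_of_mem _ hy, hys.trans (hhighmove y (hKP hy) hys)⟩, ?_⟩
  · rintro _ ⟨z, hz, rfl⟩
    exact hmoveP z (hKP hz) t htpos (min_le_right _ _)
  · exact continuousOn_id.add ((hVc.mono hKP).const_smul t)
  · rintro _ ⟨z, hz, rfl⟩ hzs
    have hzs' : z.2 ∈ Icc s₁ s₂ := by
      constructor
      · by_contra! h
        linarith [hlowmove z (hKP hz) h.le, hzs.1]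
      · by_contra! h
        linarith [hhighmove z (hKP hz) h.le, hzs.2]
    have h1 := hKC z hz hzs'
    have := hdesc z ⟨hKP hz, hzs', h1.trans hC1⟩ t htpos (min_le_left _ _)
    simp only [hΨ] at h1 ⊢
    linarith

end

section

open Finset

/-- A strictly monotone tuple extends to a strictly monotone sequence. -/
theorem StrictMono.exists_extend_nat {n : ℕ} {a : Fin (n + 1) → ℝ} (ha : StrictMono a) :
    ∃ A : ℕ → ℝ, StrictMono A ∧ ∀ j : Fin (n + 1), A j = a j := by
  refine ⟨fun j => if h : j < n + 1 then a ⟨j, h⟩ else a (Fin.last n) + j, ?_,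
    fun j => dif_pos j.2⟩
  intro i j hij
  by_cases hj : j < n + 1
  · have hi : i < n + 1 := hij.trans hj
    simpa [hi, hj] using ha (show (⟨i, hi⟩ : Fin (n + 1)) < ⟨j, hj⟩ from hij)
  · have hj0 : (0 : ℝ) < j := by exact_mod_cast (by omega : 0 < j)
    by_cases hi : i < n + 1
    · have : a ⟨i, hi⟩ ≤ a (Fin.last n) := ha.monotone (Fin.le_last _)
      simp only [hi, hj, dite_true, dite_false]
      linarith
    · have : (i : ℝ) < j := by exact_mod_cast hij
      simpa [hi, hj] using this

namespace AltSum

theorem succ_succ (f : ℕ → ℝ) (N : ℕ) :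
    ∑ j ∈ range (2 * (N + 1) + 1), (-1) ^ j * f j =
      ∑ j ∈ range (2 * N + 1), (-1) ^ j * f j - f (2 * N + 1) + f (2 * N + 2) := by
  rw [show 2 * (N + 1) + 1 = 2 * N + 1 + 1 + 1 by ring, sum_range_succ, sum_range_succ]
  have h : ((-1 : ℝ)) ^ (2 * N) = 1 := by simp [pow_mul]
  simp only [pow_succ, h]
  ring_nf

theorem last_le_of_antitone {f : ℕ → ℝ} (hf : Antitone f) (N : ℕ) :
    f (2 * N) ≤ ∑ j ∈ range (2 * N + 1), (-1) ^ j * f j := by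
  induction N with
  | zero => simp
  | succ N ih =>
    rw [succ_succ]
    have := hf (show 2 * N ≤ 2 * N + 1 by omega)
    rw [show 2 * (N + 1) = 2 * N + 2 by ring]
    linarith

theorem le_first_of_antitone {f : ℕ → ℝ} (hf : Antitone f) (N : ℕ) :
    ∑ j ∈ range (2 * N + 1), (-1) ^ j * f j ≤ f 0 := by
  induction N with
  | zero => simp
  | succ N ih =>
    rw [succ_succ]
    have := hf (show 2 * N + 1 ≤ 2 * N + 2 by omega)
    linarith

theorem first_le_of_monotone {f : ℕ → ℝ} (hf : Monotone f) (N : ℕ) :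
    f 0 ≤ ∑ j ∈ range (2 * N + 1), (-1) ^ j * f j := by
  have := le_first_of_antitone (f := fun j => -f j) (fun i j h => neg_le_neg (hf h)) N
  simp only [mul_neg, sum_neg_distrib] at this
  linarith

/-- An even alternating sum pairs up. -/
theorem even_eq (f : ℕ → ℝ) (N : ℕ) :
    ∑ j ∈ range (2 * N), (-1) ^ j * f j = ∑ i ∈ range N, (f (2 * i) - f (2 * i + 1)) := by
  induction N with
  | zero => simp
  | succ N ih =>
    rw [show 2 * (N + 1) = 2 * N + 1 + 1 by ring, sum_range_succ, sum_range_succ, ih,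
      sum_range_succ]
    have h : ((-1 : ℝ)) ^ (2 * N) = 1 := by simp [pow_mul]
    simp only [pow_succ, h]
    ring

/-- An alternating sum splits into pairs below an even index, that index, and pairs above. -/
theorem eq_pairs (f : ℕ → ℝ) (M : ℕ) (L : ℕ) :
    ∑ j ∈ range (2 * (M + L) + 1), (-1) ^ j * f j =
      ∑ i ∈ range M, (f (2 * i) - f (2 * i + 1)) + f (2 * M) +
        ∑ i ∈ range L, (f (2 * (M + i) + 2) - f (2 * (M + i) + 1)) := by
  induction L with
  | zero =>
    have h : ((-1 : ℝ)) ^ (2 * M) = 1 := by simp [pow_mul]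
    simp [sum_range_succ, even_eq, h]
  | succ L ih =>
    rw [← add_assoc, succ_succ, ih, sum_range_succ _ L]
    ring

/-- Unsigned analogue of `eq_pairs`. -/
theorem sum_eq_pairs (f : ℕ → ℝ) (M : ℕ) (L : ℕ) :
    ∑ j ∈ range (2 * (M + L) + 1), f j =
      ∑ i ∈ range M, (f (2 * i) + f (2 * i + 1)) + f (2 * M) +
        ∑ i ∈ range L, (f (2 * (M + i) + 2) + f (2 * (M + i) + 1)) := by
  have h := eq_pairs (fun j => (-1) ^ j * f j) M L
  have hs : ∀ j : ℕ, (-1 : ℝ) ^ j * (-1) ^ j = 1 := fun j => by rw [← mul_pow]; simp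
  have he : ∀ j : ℕ, (-1 : ℝ) ^ (2 * j) = 1 := fun j => by simp [pow_mul]
  simpa only [← mul_assoc, hs, one_mul, pow_add, he, pow_one, neg_mul, sub_neg_eq_add,
    even_two.neg_one_pow] using h

/-- The energy of the alternating charges `(-1)^j` at the points `a j`, `j < n`. -/
noncomputable def pairEnergy (a : ℕ → ℝ) (n : ℕ) : ℝ :=
  ∑ l ∈ range n, ∑ j ∈ range l, (-1) ^ j * (-1) ^ l * Real.log (a l - a j)

theorem pairEnergy_succ_succ (a : ℕ → ℝ) (n : ℕ) :
    pairEnergy a (n + 2) = pairEnergy a n +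
      (-1) ^ n * (∑ j ∈ range n, (-1) ^ j * Real.log (a n - a j) -
        ∑ j ∈ range n, (-1) ^ j * Real.log (a (n + 1) - a j)) -
      Real.log (a (n + 1) - a n) := by
  have h : ((-1 : ℝ)) ^ n * (-1) ^ n = 1 := by rw [← mul_pow]; simp
  simp only [pairEnergy, sum_range_succ, mul_sub, mul_sum, pow_succ]
  have e1 : ∀ x : ℝ, ∑ j ∈ range n, (-1 : ℝ) ^ n * ((-1) ^ j * Real.log (x - a j)) =
      ∑ j ∈ range n, (-1) ^ j * (-1) ^ n * Real.log (x - a j) :=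
    fun x => sum_congr rfl fun j _ => by ring
  have e2 : ∑ j ∈ range n, (-1 : ℝ) ^ j * ((-1) ^ n * -1) * Real.log (a (n + 1) - a j) =
      -∑ j ∈ range n, (-1) ^ j * (-1) ^ n * Real.log (a (n + 1) - a j) := by
    rw [← sum_neg_distrib]
    exact sum_congr rfl fun j _ => by ring
  rw [e1, e1, e2]
  linear_combination (-Real.log (a (n + 1) - a n)) * h

variable {a : ℕ → ℝ}

theorem sum_logRatio_nonneg (ha : StrictMono a) {p q : ℝ} (N : ℕ) (hp : a (2 * N) < p)
    (hpq : p ≤ q) :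
    ∑ j ∈ range (2 * N + 1), (-1) ^ j * Real.log (p - a j) ≤
      ∑ j ∈ range (2 * N + 1), (-1) ^ j * Real.log (q - a j) := by
  set f : ℕ → ℝ := fun j => Real.log (q - a (min j (2 * N))) - Real.log (p - a (min j (2 * N)))
  have hle : ∀ j, a (min j (2 * N)) ≤ a (2 * N) := fun j => ha.monotone (min_le_right _ _)
  have hf : Monotone f := by
    intro i j hij
    have h1 : a (min i (2 * N)) ≤ a (min j (2 * N)) := ha.monotone (by gcongr)
    have hi := hle i
    have hj := hle j
    simp only [f]
    rw [← Real.log_div (by linarith) (by linarith), ← Real.log_div (by linarith) (by linarith)]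
    apply Real.log_le_log (div_pos (by linarith) (by linarith))
    rw [div_le_div_iff₀ (by linarith) (by linarith)]
    nlinarith
  have h0 : 0 ≤ f 0 := by
    have := hle 0
    exact sub_nonneg.2 (Real.log_le_log (by linarith) (by linarith))
  have h := h0.trans (first_le_of_monotone hf N)
  have e : ∑ j ∈ range (2 * N + 1), (-1) ^ j * f j =
      ∑ j ∈ range (2 * N + 1), (-1) ^ j * Real.log (q - a j) -
        ∑ j ∈ range (2 * N + 1), (-1) ^ j * Real.log (p - a j) := by
    rw [← sum_sub_distrib]
    refine sum_congr rfl fun j hj => ?_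
    simp only [f, min_eq_left (show j ≤ 2 * N by simp at hj; omega)]
    ring
  linarith

theorem sum_logRatio_nonneg_even (ha : StrictMono a) {p q : ℝ} (N : ℕ) (hp : ∀ j < 2 * N, a j < p)
    (hpq : p ≤ q) :
    ∑ j ∈ range (2 * N), (-1) ^ j * Real.log (q - a j) ≤
      ∑ j ∈ range (2 * N), (-1) ^ j * Real.log (p - a j) := by
  rw [even_eq, even_eq]
  refine sum_le_sum fun i hi => ?_
  simp only [mem_range] at hi
  have h1 := hp (2 * i) (by omega)
  have h2 := hp (2 * i + 1) (by omega)
  have h3 := ha (show 2 * i < 2 * i + 1 by omega)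
  rw [← Real.log_div (by linarith) (by linarith), ← Real.log_div (by linarith) (by linarith)]
  apply Real.log_le_log (div_pos (by linarith) (by linarith))
  rw [div_le_div_iff₀ (by linarith) (by linarith)]
  nlinarith

/-- The energy of alternating charges is bounded below by that of a matching into adjacent dipoles
leaving one point of even index unmatched. -/
theorem matching_le_pairEnergy (ha : StrictMono a) (M L : ℕ) :
    -(∑ i ∈ range M, Real.log (a (2 * i + 1) - a (2 * i))) -
      ∑ i ∈ range L, Real.log (a (2 * (M + i) + 2) - a (2 * (M + i) + 1)) ≤
      pairEnergy a (2 * (M + L) + 1) := by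
  have hM : -(∑ i ∈ range M, Real.log (a (2 * i + 1) - a (2 * i))) ≤ pairEnergy a (2 * M) := by
    induction M with
    | zero => simp [pairEnergy]
    | succ M ih =>
      rw [show 2 * (M + 1) = 2 * M + 2 by ring, pairEnergy_succ_succ, sum_range_succ]
      have h := sum_logRatio_nonneg_even ha M (p := a (2 * M)) (q := a (2 * M + 1))
        (fun j hj => ha hj) (ha.monotone (by omega))
      have hs : ((-1 : ℝ)) ^ (2 * M) = 1 := by simp [pow_mul]
      rw [hs]
      linarith
  induction L with
  | zero =>
    simp only [range_zero, sum_empty, sub_zero, add_zero]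
    refine hM.trans ?_
    rw [pairEnergy, pairEnergy, sum_range_succ]
    have hs : ((-1 : ℝ)) ^ (2 * M) = 1 := by simp [pow_mul]
    simp only [hs, mul_one, le_add_iff_nonneg_right]
    rw [even_eq]
    refine sum_nonneg fun i hi => sub_nonneg.2 ?_
    simp only [mem_range] at hi
    have h1 := ha (show 2 * i + 1 < 2 * M by omega)
    have h2 := ha (show 2 * i < 2 * i + 1 by omega)
    exact Real.log_le_log (by linarith) (by linarith)
  | succ L ih =>
    rw [show 2 * (M + (L + 1)) + 1 = 2 * (M + L) + 1 + 2 by ring, pairEnergy_succ_succ,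
      sum_range_succ]
    have h := sum_logRatio_nonneg ha (M + L) (p := a (2 * (M + L) + 1))
      (q := a (2 * (M + L) + 2)) (ha (by omega)) (ha.monotone (by omega))
    have hs : ((-1 : ℝ)) ^ (2 * (M + L) + 1) = -1 := by simp [pow_succ, pow_mul]
    rw [hs, show 2 * (M + L) + 1 + 1 = 2 * (M + L) + 2 by ring]
    linarith

/-- A symmetric double sum with vanishing diagonal is twice the sum over ordered pairs. -/
theorem sum_sum_symm (f : ℕ → ℕ → ℝ) (hf : ∀ i j, f i j = f j i) (h0 : ∀ i, f i i = 0) (n : ℕ) :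
    ∑ i ∈ range n, ∑ j ∈ range n, f i j = 2 * ∑ l ∈ range n, ∑ j ∈ range l, f j l := by
  induction n with
  | zero => simp
  | succ n ih =>
    simp only [sum_range_succ, sum_add_distrib, h0, ih, hf n]
    ring

end AltSum

end

section

open Finset

namespace LogGas

variable {ι : Type*} [Fintype ι]

/-- The energy of charges `q i` whose orbits under rotation by `2π / (2 * ω)` have squared radius
`r i` and `ω`-th power coordinate `σ i * r i ^ ω`, with a charge `e` at the origin. -/
noncomputable def energy (q σ : ι → ℝ) (ω : ℕ) (e : ℝ) (r : ι → ℝ) : ℝ :=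
  ∑ i, (q i * r i + (q i * e + (ω - 1 / 2)) * Real.log (r i)) +
    ∑ i, ∑ l, q i * q l * Real.log (σ i * r i ^ ω - σ l * r l ^ ω)

/-- The position times the force at a point of the `i`-th orbit. -/
noncomputable def moment (q σ : ι → ℝ) (ω : ℕ) (e : ℝ) (r : ι → ℝ) (i : ι) : ℝ :=
  r i + e + q i * (ω - 1 / 2) +
    2 * ω * ∑ l, q l * (σ i * r i ^ ω / (σ i * r i ^ ω - σ l * r l ^ ω))

theorem sum_sum_antisymm (z w : ι → ℝ) (q : ι → ℝ) :
    ∑ i, ∑ l, q i * q l * ((w i - w l) / (z i - z l)) =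
      2 * ∑ i, q i * w i * ∑ l, q l / (z i - z l) := by
  have h1 : ∑ i, ∑ l, q i * q l * (w i / (z i - z l)) = ∑ i, q i * w i * ∑ l, q l / (z i - z l) := by
    simp only [mul_sum]
    exact sum_congr rfl fun i _ => sum_congr rfl fun l _ => by ring
  have h2 : ∑ i, ∑ l, q i * q l * (w l / (z i - z l)) =
      -∑ i, q i * w i * ∑ l, q l / (z i - z l) := by
    rw [sum_comm, ← h1, ← sum_neg_distrib]
    refine sum_congr rfl fun i _ => ?_
    rw [← sum_neg_distrib]
    refine sum_congr rfl fun l _ => ?_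
    rw [← neg_sub (z i) (z l), div_neg]
    ring
  simp only [sub_div, mul_sub, sum_sub_distrib, h1, h2]
  ring

theorem hasDerivAt_energy {q σ : ι → ℝ} {ω : ℕ} {e : ℝ} (hq : ∀ i, q i * q i = 1)
    {R : ℝ → ι → ℝ} {R' : ι → ℝ} {t : ℝ} (hR : ∀ i, HasDerivAt (fun t => R t i) (R' i) t)
    (hpos : ∀ i, 0 < R t i)
    (hz : ∀ i l, i ≠ l → σ i * R t i ^ ω ≠ σ l * R t l ^ ω) :
    HasDerivAt (fun t => energy q σ ω e (R t))
      (∑ i, q i * moment q σ ω e (R t) i * (R' i / R t i)) t := by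
  have hne : ∀ i, R t i ≠ 0 := fun i => (hpos i).ne'
  set w : ι → ℝ := fun i => σ i * (ω * R t i ^ ω * (R' i / R t i)) with hw
  have hzd : ∀ i, HasDerivAt (fun t => σ i * R t i ^ ω) (w i) t := by
    intro i
    refine (((hR i).pow ω).const_mul (σ i)).congr_deriv ?_
    rcases ω with _ | k
    · simp [hw]
    · simp only [hw, pow_succ]
      have := hne i
      field_simp
      rw [Nat.add_sub_cancel]
      ring
  have h1 : HasDerivAt
      (fun t => ∑ i, (q i * R t i + (q i * e + (ω - 1 / 2)) * Real.log (R t i)))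
      (∑ i, (q i * R' i + (q i * e + (ω - 1 / 2)) * (R' i / R t i))) t :=
    HasDerivAt.fun_sum fun i _ => ((hR i).const_mul _).add (((hR i).log (hne i)).const_mul _)
  have h2 : HasDerivAt
      (fun t => ∑ i, ∑ l, q i * q l * Real.log (σ i * R t i ^ ω - σ l * R t l ^ ω))
      (∑ i, ∑ l, q i * q l * ((w i - w l) / (σ i * R t i ^ ω - σ l * R t l ^ ω))) t := by
    refine HasDerivAt.fun_sum fun i _ => HasDerivAt.fun_sum fun l _ => ?_
    by_cases hil : i = l
    · subst hil
      simpa using hasDerivAt_const t (0 : ℝ)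
    · exact (((hzd i).sub (hzd l)).log (sub_ne_zero.2 (hz i l hil))).const_mul _
  refine (h1.add h2).congr_deriv ?_
  rw [sum_sum_antisymm (fun i => σ i * R t i ^ ω) w q, mul_sum, ← sum_add_distrib]
  refine sum_congr rfl fun i _ => ?_
  have e1 : ∑ l, q l * (σ i * R t i ^ ω / (σ i * R t i ^ ω - σ l * R t l ^ ω)) =
      σ i * R t i ^ ω * ∑ l, q l / (σ i * R t i ^ ω - σ l * R t l ^ ω) := by
    rw [mul_sum]
    exact sum_congr rfl fun l _ => by ring
  have e2 : R' i = R t i * (R' i / R t i) := by rw [mul_div_cancel₀ _ (hne i)]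
  simp only [moment, hw, e1]
  generalize ∑ l, q l / (σ i * R t i ^ ω - σ l * R t l ^ ω) = B at *
  generalize R' i / R t i = u at *
  rw [e2]
  linear_combination (-u * ((ω : ℝ) - 1 / 2)) * hq i

/-- Translation invariance of the interaction in the coordinates `σ i * r i ^ ω`. -/
theorem sum_moment_div {q σ : ι → ℝ} {ω : ℕ} {e : ℝ} {r : ι → ℝ}
    (hz : ∀ i, σ i * r i ^ ω ≠ 0) :
    ∑ i, q i * moment q σ ω e r i / (σ i * r i ^ ω) =
      ∑ i, q i * (r i + e + q i * (ω - 1 / 2)) / (σ i * r i ^ ω) := by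
  have h := sum_sum_antisymm (fun i => σ i * r i ^ ω) (fun _ => 1) q
  simp only [sub_self, zero_div, mul_zero, sum_const_zero, mul_one] at h
  have e1 : ∀ i, q i * moment q σ ω e r i / (σ i * r i ^ ω) =
      q i * (r i + e + q i * (ω - 1 / 2)) / (σ i * r i ^ ω) +
        2 * ω * (q i * ∑ l, q l / (σ i * r i ^ ω - σ l * r l ^ ω)) := by
    intro i
    have e1 : ∑ l, q l * (σ i * r i ^ ω / (σ i * r i ^ ω - σ l * r l ^ ω)) =
        σ i * r i ^ ω * ∑ l, q l / (σ i * r i ^ ω - σ l * r l ^ ω) := by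
      rw [mul_sum]
      exact sum_congr rfl fun l _ => by ring
    rw [moment, e1]
    have := hz i
    generalize ∑ l, q l / (σ i * r i ^ ω - σ l * r l ^ ω) = B at *
    generalize σ i * r i ^ ω = Z at *
    field_simp
  rw [sum_congr rfl fun i _ => e1 i, sum_add_distrib, ← mul_sum]
  have h0 : ∑ i, q i * ∑ l, q l / (σ i * r i ^ ω - σ l * r l ^ ω) = 0 := by linarith
  rw [h0, mul_zero, add_zero]

end LogGas

end

namespace LogGas
open Finset

/-- The signs of the charges: alternating on the first family of orbits, `-1` on the second. -/
noncomputable def chargeSign (n m : ℕ) : Fin n ⊕ Fin m → ℝ :=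
  Sum.elim (fun j => (-1) ^ (j : ℕ)) (fun _ => -1)

/-- The sign of the `k`-th power of the points of an orbit. -/
noncomputable def powSign (n m : ℕ) : Fin n ⊕ Fin m → ℝ := Sum.elim (fun _ => 1) (fun _ => -1)

theorem sum_orbit_ne {k : ℕ} {φ : ℂ} (hk : (k = 2 ∧ φ = -1) ∨ (k = 4 ∧ φ = Complex.I))
    {P p : ℂ} (h : P ^ k ≠ p ^ k) :
    ∑ m : Fin k, P / (P - p * φ ^ (m : ℕ)) = k * (P ^ k / (P ^ k - p ^ k)) := by
  have hI := Complex.I_sq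
  rcases hk with ⟨rfl, rfl⟩ | ⟨rfl, rfl⟩
  · have h1 : P ^ 2 - p ^ 2 ≠ 0 := sub_ne_zero.2 h
    have h2 : P ^ 2 - p ^ 2 = (P - p) * (P + p) := by ring
    rw [h2] at h1
    have h3 := left_ne_zero_of_mul h1
    have h4 := right_ne_zero_of_mul h1
    rw [h2]
    simp only [Fin.sum_univ_two, Fin.val_zero, Fin.val_one, pow_zero, pow_one, mul_one, mul_neg,
      sub_neg_eq_add]
    field_simp
    push_cast
    ring
  · have h1 : P ^ 4 - p ^ 4 ≠ 0 := sub_ne_zero.2 h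
    have h2 : P ^ 4 - p ^ 4 = (P - p) * (P + p) * ((P - p * Complex.I) * (P + p * Complex.I)) := by
      linear_combination p ^ 2 * (P ^ 2 - p ^ 2) * hI
    rw [h2] at h1
    have h5 := left_ne_zero_of_mul h1
    have h6 := right_ne_zero_of_mul h1
    have h3 := left_ne_zero_of_mul h5
    have h4 := right_ne_zero_of_mul h5
    have h7 := left_ne_zero_of_mul h6
    have h8 := right_ne_zero_of_mul h6
    rw [h2]
    have hI3 : Complex.I ^ 3 = -Complex.I := by linear_combination Complex.I * hI
    simp only [Fin.sum_univ_four, Fin.val_zero, Fin.val_one, pow_zero, pow_one, mul_one, mul_neg,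
      sub_neg_eq_add, Fin.val_two, hI, show ((3 : Fin 4) : ℕ) = 3 from rfl, hI3]
    field_simp
    push_cast
    linear_combination (-(2 * P ^ 2 * p ^ 2)) * hI

theorem sum_orbit_self {k : ℕ} {φ : ℂ} (hk : (k = 2 ∧ φ = -1) ∨ (k = 4 ∧ φ = Complex.I))
    {p : ℂ} (hp : p ≠ 0) (m₀ : Fin k) :
    ∑ m : Fin k, p * φ ^ (m₀ : ℕ) / (p * φ ^ (m₀ : ℕ) - p * φ ^ (m : ℕ)) = (k - 1) / 2 := by
  have hI := Complex.I_sq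
  rcases hk with ⟨rfl, rfl⟩ | ⟨rfl, rfl⟩
  · have e : ∀ m : Fin 2, p * (-1 : ℂ) ^ (m₀ : ℕ) / (p * (-1) ^ (m₀ : ℕ) - p * (-1) ^ (m : ℕ)) =
        (-1 : ℂ) ^ (m₀ : ℕ) / ((-1) ^ (m₀ : ℕ) - (-1) ^ (m : ℕ)) := fun m => by
      rw [← mul_sub, mul_div_mul_left _ _ hp]
    simp only [e]
    fin_cases m₀ <;> norm_num
  · have e : ∀ m : Fin 4, p * Complex.I ^ (m₀ : ℕ) /
          (p * Complex.I ^ (m₀ : ℕ) - p * Complex.I ^ (m : ℕ)) =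
        Complex.I ^ (m₀ : ℕ) / (Complex.I ^ (m₀ : ℕ) - Complex.I ^ (m : ℕ)) := fun m => by
      rw [← mul_sub, mul_div_mul_left _ _ hp]
    have hI3 : Complex.I ^ 3 = -Complex.I := by linear_combination Complex.I * hI
    simp only [e]
    fin_cases m₀ <;>
      simp [Fin.sum_univ_four, hI3, Complex.ext_iff, Complex.div_re, Complex.div_im,
        Complex.normSq_apply] <;> norm_num

theorem sum_orbit_inv {k : ℕ} {φ : ℂ} (hk : (k = 2 ∧ φ = -1) ∨ (k = 4 ∧ φ = Complex.I))
    (p : ℂ) : ∑ m : Fin k, 1 / (0 - p * φ ^ (m : ℕ)) = 0 := by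
  have hI := Complex.I_sq
  rcases hk with ⟨rfl, rfl⟩ | ⟨rfl, rfl⟩
  · simp
  · have hI3 : Complex.I ^ 3 = -Complex.I := by linear_combination Complex.I * hI
    simp [Fin.sum_univ_four, hI3]

/-- Base points of the orbits. -/
noncomputable def basePoint {n m : ℕ} (ζ : ℂ) (p₁ : Fin n → ℝ) (p₂ : Fin m → ℝ) :
    Fin n ⊕ Fin m → ℂ :=
  Sum.elim (fun j => (p₁ j : ℂ)) (fun l => (p₂ l : ℂ) * ζ)

theorem sum_orbits {k ω : ℕ} {φ ζ : ℂ} (hk : (k = 2 ∧ φ = -1) ∨ (k = 4 ∧ φ = Complex.I))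
    (hω : k = 2 * ω) (hφ : φ ^ k = 1) (hζ : ζ ^ k = -1) {n m : ℕ} {α : Fin n → ℝ} {τ : Fin m → ℝ}
    (hα : ∀ j, 0 < α j) (hτ : ∀ l, 0 < τ l) (hα' : StrictMono α) (hτ' : StrictMono τ)
    (q : Fin n ⊕ Fin m → ℝ) (i : Fin n ⊕ Fin m) (m₀ : Fin k) :
    let B := basePoint ζ (fun j => √(α j)) (fun l => √(τ l))
    let r := Sum.elim α τ
    let σ := powSign n m
    ∑ l, ∑ m : Fin k, (q l : ℂ) * (B i * φ ^ (m₀ : ℕ) / (B i * φ ^ (m₀ : ℕ) - B l * φ ^ (m : ℕ))) =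
      ((q i * (ω - 1 / 2) +
        2 * ω * ∑ l, q l * (σ i * r i ^ ω / (σ i * r i ^ ω - σ l * r l ^ ω)) : ℝ) : ℂ) := by
  intro B r σ
  have hζ0 : ζ ≠ 0 := by
    rintro rfl
    have : k ≠ 0 := by omega
    simp [this] at hζ
  have hBk : ∀ l, (B l) ^ k = ((σ l * r l ^ ω : ℝ) : ℂ) := by
    rintro (j | l)
    · simp only [B, basePoint, r, σ, powSign, Sum.elim_inl, hω, pow_mul, one_mul]
      rw [← Complex.ofReal_pow, Real.sq_sqrt (hα j).le]
      push_cast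
      rfl
    · simp only [B, basePoint, r, σ, powSign, Sum.elim_inr, mul_pow, hζ]
      rw [hω, pow_mul, ← Complex.ofReal_pow, Real.sq_sqrt (hτ l).le]
      push_cast
      ring
  have hB0 : ∀ l, B l ≠ 0 := by
    rintro (j | l)
    · simpa [B, basePoint] using (Real.sqrt_pos.2 (hα j)).ne'
    · simpa [B, basePoint, hζ0] using (Real.sqrt_pos.2 (hτ l)).ne'
  have hinj : ∀ i l, i ≠ l → σ i * r i ^ ω ≠ σ l * r l ^ ω := by
    have hω0 : ω ≠ 0 := by omega
    rintro (j | l) (j' | l') h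
    · simp only [σ, r, powSign, Sum.elim_inl, one_mul]
      rw [Ne, pow_left_inj₀ (hα j).le (hα j').le hω0, hα'.injective.eq_iff]
      exact fun e => h (by rw [e])
    · have h1 := pow_pos (hα j) ω
      have h2 := pow_pos (hτ l') ω
      simp only [σ, r, powSign, Sum.elim_inl, Sum.elim_inr]
      intro e
      linarith
    · have h1 := pow_pos (hα j') ω
      have h2 := pow_pos (hτ l) ω
      simp only [σ, r, powSign, Sum.elim_inl, Sum.elim_inr]
      intro e
      linarith
    · simp only [σ, r, powSign, Sum.elim_inr, neg_one_mul, Ne, neg_inj]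
      rw [pow_left_inj₀ (hτ l).le (hτ l').le hω0, hτ'.injective.eq_iff]
      exact fun e => h (by rw [e])
  have hPk : (B i * φ ^ (m₀ : ℕ)) ^ k = B i ^ k := by
    rw [mul_pow, ← pow_mul, mul_comm (m₀ : ℕ), pow_mul, hφ, one_pow, mul_one]
  simp only [← Finset.mul_sum]
  rw [← Finset.add_sum_erase _ _ (Finset.mem_univ i), sum_orbit_self hk (hB0 i)]
  rw [← Finset.add_sum_erase (Finset.univ : Finset (Fin n ⊕ Fin m))
    (fun l => q l * (σ i * r i ^ ω / (σ i * r i ^ ω - σ l * r l ^ ω))) (Finset.mem_univ i)]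
  have hk' : (k : ℂ) = 2 * ω := by rw [hω]; push_cast; ring
  have hrest : ∀ l ∈ Finset.univ.erase i,
      (q l : ℂ) * ∑ m : Fin k, B i * φ ^ (m₀ : ℕ) / (B i * φ ^ (m₀ : ℕ) - B l * φ ^ (m : ℕ)) =
      2 * ω * ((q l * (σ i * r i ^ ω / (σ i * r i ^ ω - σ l * r l ^ ω)) : ℝ) : ℂ) := by
    intro l hl
    rw [sum_orbit_ne hk, hPk, hBk, hBk, hk']
    · push_cast
      ring
    · rw [hPk, hBk, hBk]
      exact_mod_cast hinj i l (Finset.ne_of_mem_erase hl).symm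
  rw [Finset.sum_congr rfl hrest, ← Finset.mul_sum, sub_self, div_zero, mul_zero, zero_add, hk']
  push_cast
  ring

/-- A configuration of orbits is balanced when all its moments vanish. -/
theorem balanced_of_moment_eq_zero {k ω : ℕ} {φ ζ : ℂ}
    (hk : (k = 2 ∧ φ = -1) ∨ (k = 4 ∧ φ = Complex.I))
    (hω : k = 2 * ω) (hφ : φ ^ k = 1) (hζ : ζ ^ k = -1) {n m : ℕ}
    {α : Fin n → ℝ} {τ : Fin m → ℝ} (hα : ∀ j, 0 < α j) (hτ : ∀ l, 0 < τ l)
    (hα' : StrictMono α) (hτ' : StrictMono τ) {e : ℝ}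
    (h : ∀ i, moment (chargeSign n m) (powSign n m) ω e (Sum.elim α τ) i = 0)
    {p ε : ((Fin n × Fin k) ⊕ (Fin m × Fin k)) ⊕ Unit → ℂ}
    (hp₁ : ∀ j s, p (Sum.inl (Sum.inl (j, s))) = √(α j) * φ ^ (s : ℕ))
    (hp₂ : ∀ l s, p (Sum.inl (Sum.inr (l, s))) = √(τ l) * ζ * φ ^ (s : ℕ))
    (hp₀ : p (Sum.inr ()) = 0)
    (hε₁ : ∀ j s, ε (Sum.inl (Sum.inl (j, s))) = (-1) ^ (j : ℕ))
    (hε₂ : ∀ l s, ε (Sum.inl (Sum.inr (l, s))) = -1) (hε₀ : ε (Sum.inr ()) = e) (i) :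
    force p ε i = 0 := by
  have hforce : ∀ i, force p ε i = (starRingEnd ℂ) (p i) + ∑ k, ε k / (p i - p k) := by
    intro i
    rw [force, Finset.sum_erase _ (by simp)]
  set B := basePoint ζ (fun j => √(α j)) (fun l => √(τ l)) with hB
  have hsum : ∀ x : ℂ, ∑ k, ε k / (x - p k) =
      ∑ l, ∑ s : Fin k, (chargeSign n m l : ℂ) * (1 / (x - B l * φ ^ (s : ℕ))) + e / x := by
    intro x
    simp only [Fintype.sum_sum_type, Fintype.sum_prod_type, hp₁, hp₂, hp₀, hε₁, hε₂, hε₀,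
      Finset.univ_unique, PUnit.default_eq_unit, Finset.sum_singleton, chargeSign, hB, basePoint,
      Sum.elim_inl, Sum.elim_inr, sub_zero]
    congr 2
    · simp [div_eq_mul_inv]
    · simp [div_eq_mul_inv]
  have hω0 : ω ≠ 0 := by omega
  have hnφ : ‖φ‖ = 1 := by
    rcases hk with ⟨-, rfl⟩ | ⟨-, rfl⟩ <;> simp
  have hnζ : ‖ζ‖ = 1 := by
    have : ‖ζ‖ ^ k = 1 := by rw [← norm_pow, hζ]; simp
    exact (pow_eq_one_iff_of_nonneg (norm_nonneg _) (by omega)).1 this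
  have hφ0 : φ ≠ 0 := norm_ne_zero_iff.1 (by rw [hnφ]; exact one_ne_zero)
  have hζ0 : ζ ≠ 0 := norm_ne_zero_iff.1 (by rw [hnζ]; exact one_ne_zero)
  have hB0 : ∀ l, B l ≠ 0 := by
    rintro (j | l)
    · simpa [B, basePoint] using (Real.sqrt_pos.2 (hα j)).ne'
    · simpa [B, basePoint, hζ0] using (Real.sqrt_pos.2 (hτ l)).ne'
  have hnB : ∀ l, ‖B l‖ ^ 2 = Sum.elim α τ l := by
    rintro (j | l)
    · simp [B, basePoint, Real.sq_sqrt (hα j).le]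
    · simp [B, basePoint, hnζ, Real.sq_sqrt (hτ l).le]
  have hzero : ∀ (l) (s : Fin k), (starRingEnd ℂ) (B l * φ ^ (s : ℕ)) +
      ∑ k, ε k / (B l * φ ^ (s : ℕ) - p k) = 0 := by
    intro l s
    set P := B l * φ ^ (s : ℕ) with hP
    have hP0 : P ≠ 0 := mul_ne_zero (hB0 l) (pow_ne_zero _ hφ0)
    have h1 : P * ((starRingEnd ℂ) P + ∑ k, ε k / (P - p k)) =
        (moment (chargeSign n m) (powSign n m) ω e (Sum.elim α τ) l : ℂ) := by
      have h2 : P * (starRingEnd ℂ) P = ((Sum.elim α τ l : ℝ) : ℂ) := by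
        rw [Complex.mul_conj', ← hnB, hP, norm_mul, norm_pow, hnφ, one_pow, mul_one]
        push_cast
        rfl
      have h3 : P * ∑ l, ∑ s : Fin k, (chargeSign n m l : ℂ) * (1 / (P - B l * φ ^ (s : ℕ))) =
          ∑ l, ∑ s : Fin k, (chargeSign n m l : ℂ) * (P / (P - B l * φ ^ (s : ℕ))) := by
        simp only [Finset.mul_sum]
        exact Finset.sum_congr rfl fun l _ => Finset.sum_congr rfl fun s _ => by ring
      rw [mul_add, h2, hsum, mul_add, h3, mul_div_cancel₀ _ hP0,
        sum_orbits hk hω hφ hζ hα hτ hα' hτ', moment]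
      push_cast
      ring
    rw [h l, Complex.ofReal_zero] at h1
    exact (mul_eq_zero.1 h1).resolve_left hP0
  rw [hforce]
  rcases i with (⟨j, s⟩ | ⟨l, s⟩) | ⟨⟩
  · rw [hp₁]
    exact hzero (Sum.inl j) s
  · rw [hp₂]
    exact hzero (Sum.inr l) s
  · rw [hp₀, hsum, map_zero, zero_add, div_zero, add_zero]
    refine Finset.sum_eq_zero fun l _ => ?_
    rw [← Finset.mul_sum, sum_orbit_inv hk, mul_zero]

end LogGas

section

open Finset

theorem strictConcaveOn_Ioi_of_hasDerivAt {f f' f'' : ℝ → ℝ} {x₀ : ℝ}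
    (h1 : ∀ x ∈ Set.Ioi x₀, HasDerivAt f (f' x) x) (h2 : ∀ x ∈ Set.Ioi x₀, HasDerivAt f' (f'' x) x)
    (h3 : ∀ x ∈ Set.Ioi x₀, f'' x < 0) : StrictConcaveOn ℝ (Set.Ioi x₀) f := by
  have hanti : StrictAntiOn f' (Set.Ioi x₀) := by
    refine strictAntiOn_of_hasDerivWithinAt_neg (f' := f'') (convex_Ioi x₀)
      (fun x hx => (h2 x hx).continuousAt.continuousWithinAt) ?_ ?_ <;> rw [interior_Ioi]
    · exact fun x hx => (h2 x hx).hasDerivWithinAt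
    · exact h3
  refine StrictAntiOn.strictConcaveOn_of_deriv (convex_Ioi x₀)
    (fun x hx => (h1 x hx).continuousAt.continuousWithinAt) ?_
  rw [interior_Ioi]
  intro x hx y hy hxy
  rw [(h1 x hx).deriv, (h1 y hy).deriv]
  exact hanti hx hy hxy

namespace AltSum

theorem antitoneOn_envelope : AntitoneOn (fun u : ℝ => (1 - u) / (1 + u) ^ 2) (Set.Icc 0 3) := by
  rintro x ⟨hx0, hx3⟩ y ⟨hy0, hy3⟩ hxy
  simp only
  rw [div_le_div_iff₀ (by positivity) (by positivity)]
  nlinarith [mul_nonneg (sub_nonneg.2 hxy) (mul_nonneg hx0 hy0),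
    mul_nonneg (sub_nonneg.2 hxy) (sub_nonneg.2 hx3), mul_nonneg (sub_nonneg.2 hxy) (sub_nonneg.2 hy3),
    mul_nonneg (sub_nonneg.2 hxy) (mul_nonneg (sub_nonneg.2 hx3) (sub_nonneg.2 hy3)),
    mul_nonneg (sub_nonneg.2 hxy) (mul_nonneg (sub_nonneg.2 hx3) hy0),
    mul_nonneg (sub_nonneg.2 hxy) (mul_nonneg (sub_nonneg.2 hy3) hx0)]

theorem monotoneOn_envelope : MonotoneOn (fun u : ℝ => (1 - u) / (1 + u) ^ 2) (Set.Ici 3) := by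
  intro x hx y hy hxy
  rw [Set.mem_Ici] at hx hy
  simp only
  rw [div_le_div_iff₀ (by positivity) (by positivity)]
  obtain ⟨s, rfl⟩ : ∃ s, x = 3 + s := ⟨x - 3, by ring⟩
  obtain ⟨d, rfl⟩ : ∃ d, y = 3 + s + d := ⟨y - 3 - s, by ring⟩
  have hs : 0 ≤ s := by linarith
  have hd : 0 ≤ d := by linarith
  have h1 := mul_nonneg hs hd
  nlinarith [mul_nonneg h1 hs, mul_nonneg h1 hd, mul_nonneg hd hd]

theorem sum_envelope_lt {u : ℕ → ℝ} (hu : StrictMono u) (h0 : 0 < u 0) (N : ℕ) :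
    ∑ j ∈ range (2 * N + 1), (-1) ^ j * ((1 - u j) / (1 + u j) ^ 2) < 9 / 8 := by
  set v : ℝ → ℝ := fun u => (1 - u) / (1 + u) ^ 2 with hv
  set V : ℝ → ℝ := fun u => v (min u 3) with hV
  have hpos : ∀ j, 0 < u j := fun j => h0.trans_le (hu.monotone (Nat.zero_le j))
  have hVanti : Antitone fun j => V (u j) := fun i j hij =>
    antitoneOn_envelope ⟨le_min (hpos i).le (by norm_num), min_le_right _ _⟩
      ⟨le_min (hpos j).le (by norm_num), min_le_right _ _⟩ (min_le_min_right _ (hu.monotone hij))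
  have hdiff : ∀ x y, 0 < x → x ≤ y → v x - v y ≤ V x - V y := by
    intro x y hx hxy
    rcases le_total y 3 with hy | hy
    · simp [hV, hy, hxy.trans hy]
    rcases le_total x 3 with hx3 | hx3
    · have := monotoneOn_envelope (Set.mem_Ici.2 le_rfl) (Set.mem_Ici.2 hy) hy
      simp only [hV, min_eq_left hx3, min_eq_right hy]
      simp only [hv] at this ⊢
      linarith
    · have := monotoneOn_envelope (Set.mem_Ici.2 hx3) (Set.mem_Ici.2 hy) hxy
      simp only [hV, min_eq_right hx3, min_eq_right hy]
      simp only [hv] at this ⊢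
      linarith
  have hlast : ∀ x, 0 < x → v x ≤ V x + 1 / 8 := by
    intro x hx
    rcases le_total x 3 with hx3 | hx3
    · simp [hV, hx3]
    · have : v x ≤ 0 := div_nonpos_of_nonpos_of_nonneg (by linarith) (by positivity)
      have h3 : V x = -1 / 8 := by simp only [hV, hv, min_eq_right hx3]; norm_num
      linarith
  have e1 := eq_pairs (fun j => v (u j)) N 0
  have e2 := eq_pairs (fun j => V (u j)) N 0
  simp only [add_zero, range_zero, sum_empty] at e1 e2
  have hle := le_first_of_antitone hVanti N
  have hV0 : V (u 0) < 1 := by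
    have hm : 0 < min (u 0) 3 := lt_min h0 (by norm_num)
    simp only [hV, hv]
    rw [div_lt_one (by positivity)]
    nlinarith
  have hsum : ∑ i ∈ range N, (v (u (2 * i)) - v (u (2 * i + 1))) ≤
      ∑ i ∈ range N, (V (u (2 * i)) - V (u (2 * i + 1))) :=
    sum_le_sum fun i _ => hdiff _ _ (hpos _) (hu.monotone (by omega))
  have := hlast _ (hpos (2 * N))
  rw [e1]
  linarith

end AltSum

/-- Part of the energy depending on the squared radius `t` of one orbit of the second family. -/
noncomputable def orbitPotential (a : ℕ → ℝ) (n ω : ℕ) (c t₀ t : ℝ) : ℝ :=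
  -t + c * Real.log t - 2 * ∑ j ∈ range n, (-1) ^ j * Real.log (a j + t ^ ω) +
    2 * Real.log (t ^ ω - t₀ ^ ω)

theorem strictConcaveOn_orbitPotential {a : ℕ → ℝ} (ha : StrictMono a) (ha0 : 0 < a 0) (N : ℕ)
    {ω : ℕ} {c : ℝ} (hc : (ω = 1 ∧ 0 < c) ∨ (ω = 2 ∧ c = 1 / 2)) {t₀ : ℝ} (ht₀ : 0 < t₀) :
    StrictConcaveOn ℝ (Set.Ioi t₀) (orbitPotential a (2 * N + 1) ω c t₀) := by
  have hapos : ∀ j, 0 < a j := fun j => ha0.trans_le (ha.monotone (Nat.zero_le j))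
  rcases hc with ⟨rfl, hc⟩ | ⟨rfl, rfl⟩
  · refine strictConcaveOn_Ioi_of_hasDerivAt
      (f' := fun t => -1 + c * t⁻¹ - 2 * ∑ j ∈ range (2 * N + 1), (-1) ^ j * (a j + t)⁻¹ +
        2 * (t - t₀)⁻¹)
      (f'' := fun t => c * (-(t ^ 2)⁻¹) - 2 * ∑ j ∈ range (2 * N + 1),
        (-1) ^ j * (-1 / (a j + t) ^ 2) + 2 * (-1 / (t - t₀) ^ 2)) ?_ ?_ ?_
    · intro t ht
      have ht' : t₀ < t := ht
      have h0 : t ≠ 0 := by linarith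
      have h1 : t - t₀ ≠ 0 := by linarith
      unfold orbitPotential
      simp only [pow_one]
      refine (((hasDerivAt_id t).neg.add ((Real.hasDerivAt_log h0).const_mul c)).sub
        ((HasDerivAt.fun_sum fun j _ => ?_).const_mul 2)).add
        ((((hasDerivAt_id t).sub_const t₀).log h1).const_mul 2 |>.congr_deriv (by simp))
      have h2 : a j + t ≠ 0 := by have := hapos j; linarith
      exact (((hasDerivAt_id t).const_add (a j)).log h2).const_mul _ |>.congr_deriv (by simp)
    · intro t ht
      have ht' : t₀ < t := ht
      have h0 : t ≠ 0 := by linarith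
      have h1 : t - t₀ ≠ 0 := by linarith
      refine (((((hasDerivAt_inv h0).const_mul c).const_add (-1)).sub
        ((HasDerivAt.fun_sum fun j _ => ?_).const_mul 2))).add
        (((hasDerivAt_id t).sub_const t₀).inv h1 |>.const_mul 2)
      have h2 : a j + t ≠ 0 := by have := hapos j; linarith
      exact (((hasDerivAt_id t).const_add (a j)).inv h2).const_mul _
    · intro t ht
      have ht' : t₀ < t := ht
      have htp : 0 < t := ht₀.trans ht'
      have hA : ∑ j ∈ range (2 * N + 1), (-1) ^ j * (1 / (a j + t) ^ 2) ≤ 1 / (a 0 + t) ^ 2 :=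
        AltSum.le_first_of_antitone (f := fun j => 1 / (a j + t) ^ 2) (fun i j hij => by
          have := hapos i
          have := ha.monotone hij
          simp only
          gcongr) N
      have hB : 1 / (a 0 + t) ^ 2 ≤ 1 / (t - t₀) ^ 2 := by
        have : 0 < t - t₀ := by linarith
        gcongr
        linarith
      have hC : 0 < c * (t ^ 2)⁻¹ := by positivity
      simp only [neg_div, mul_neg, sum_neg_distrib]
      linarith
  · refine strictConcaveOn_Ioi_of_hasDerivAt
      (f' := fun t => -1 + 1 / 2 * t⁻¹ - 2 * ∑ j ∈ range (2 * N + 1),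
        (-1) ^ j * (2 * t / (a j + t ^ 2)) + 2 * (2 * t / (t ^ 2 - t₀ ^ 2)))
      (f'' := fun t => 1 / 2 * (-(t ^ 2)⁻¹) - 2 * ∑ j ∈ range (2 * N + 1),
        (-1) ^ j * ((2 * (a j + t ^ 2) - 2 * t * (2 * t)) / (a j + t ^ 2) ^ 2) +
        2 * ((2 * (t ^ 2 - t₀ ^ 2) - 2 * t * (2 * t)) / (t ^ 2 - t₀ ^ 2) ^ 2)) ?_ ?_ ?_
    · intro t ht
      have ht' : t₀ < t := ht
      have h0 : t ≠ 0 := by linarith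
      have h1 : t ^ 2 - t₀ ^ 2 ≠ 0 := by nlinarith
      have hsq : HasDerivAt (fun t : ℝ => t ^ 2) (2 * t) t := by simpa using hasDerivAt_pow 2 t
      unfold orbitPotential
      refine (((hasDerivAt_id t).neg.add ((Real.hasDerivAt_log h0).const_mul _)).sub
        ((HasDerivAt.fun_sum fun j _ => ?_).const_mul 2)).add
        (((hsq.sub_const _).log h1).const_mul 2)
      have h2 : a j + t ^ 2 ≠ 0 := by have := hapos j; positivity
      exact ((hsq.const_add (a j)).log h2).const_mul _
    · intro t ht
      have ht' : t₀ < t := ht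
      have h0 : t ≠ 0 := by linarith
      have h1 : t ^ 2 - t₀ ^ 2 ≠ 0 := by nlinarith
      have hsq : HasDerivAt (fun t : ℝ => t ^ 2) (2 * t) t := by simpa using hasDerivAt_pow 2 t
      have hl : HasDerivAt (fun t : ℝ => 2 * t) 2 t := by
        simpa using (hasDerivAt_id t).const_mul (2 : ℝ)
      refine (((((hasDerivAt_inv h0).const_mul _).const_add (-1)).sub
        ((HasDerivAt.fun_sum fun j _ => ?_).const_mul 2))).add
        ((hl.div (hsq.sub_const _) h1).const_mul 2)
      have h2 : a j + t ^ 2 ≠ 0 := by have := hapos j; positivity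
      exact (hl.div (hsq.const_add (a j)) h2).const_mul _
    · intro t ht
      have ht' : t₀ < t := ht
      have htp : 0 < t := ht₀.trans ht'
      have hA := AltSum.sum_envelope_lt (u := fun j => a j / t ^ 2)
        (fun i j hij => div_lt_div_of_pos_right (ha hij) (by positivity)) (by positivity) N
      have e : ∑ j ∈ range (2 * N + 1),
          (-1) ^ j * ((2 * (a j + t ^ 2) - 2 * t * (2 * t)) / (a j + t ^ 2) ^ 2) =
          -(2 * (t ^ 2)⁻¹) * ∑ j ∈ range (2 * N + 1),
            (-1) ^ j * ((1 - a j / t ^ 2) / (1 + a j / t ^ 2) ^ 2) := by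
        rw [mul_sum]
        refine sum_congr rfl fun j _ => ?_
        have := hapos j
        field_simp
        ring
      have hB : (2 * (t ^ 2 - t₀ ^ 2) - 2 * t * (2 * t)) / (t ^ 2 - t₀ ^ 2) ^ 2 ≤
          -2 * (t ^ 2)⁻¹ := by
        have h1 : 0 < t ^ 2 - t₀ ^ 2 := by nlinarith
        rw [div_le_iff₀ (by positivity), show -2 * (t ^ 2)⁻¹ * (t ^ 2 - t₀ ^ 2) ^ 2 =
          -2 * (t ^ 2 - t₀ ^ 2) ^ 2 / t ^ 2 by ring, le_div_iff₀ (by positivity)]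
        nlinarith [sq_nonneg (t₀ ^ 2), mul_pos (pow_pos htp 2) (pow_pos ht₀ 2),
          mul_pos h1 (pow_pos ht₀ 2)]
      have hC : 0 < (t ^ 2)⁻¹ := by positivity
      simp only [e]
      nlinarith [mul_lt_mul_of_pos_left hA hC]

end

namespace LogGas
open Finset

theorem energy_elim {n m ω : ℕ} {e c : ℝ} (hc : c = ω - 1 / 2 - e) {α : Fin n → ℝ} {A : ℕ → ℝ}
    (hA : ∀ j : Fin n, A j = α j ^ ω) (t : Fin m → ℝ) :
    energy (chargeSign n m) (powSign n m) ω e (Sum.elim α t) =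
    ∑ j : Fin n, ((-1) ^ (j : ℕ) * α j + ((-1) ^ (j : ℕ) * e + (ω - 1 / 2)) * Real.log (α j)) +
      2 * AltSum.pairEnergy A n +
      ∑ l, (-t l + c * Real.log (t l) -
        2 * ∑ j ∈ range n, (-1) ^ j * Real.log (A j + t l ^ ω)) +
      ∑ l, ∑ l', Real.log (t l ^ ω - t l' ^ ω) := by
  have hAA : ∑ i : Fin n, ∑ l : Fin n, (-1 : ℝ) ^ (i : ℕ) * (-1) ^ (l : ℕ) * Real.log (α i ^ ω - α l ^ ω) =
      2 * AltSum.pairEnergy A n := by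
    rw [AltSum.pairEnergy, ← AltSum.sum_sum_symm
      (fun j l => (-1) ^ j * (-1) ^ l * Real.log (A l - A j))
      (fun i j => by rw [← neg_sub (A j), Real.log_neg_eq_log]; ring) (fun i => by simp)]
    rw [← Fin.sum_univ_eq_sum_range (fun i => ∑ j ∈ range n,
      (-1 : ℝ) ^ i * (-1) ^ j * Real.log (A j - A i))]
    refine sum_congr rfl fun i _ => ?_
    rw [← Fin.sum_univ_eq_sum_range (fun j => (-1 : ℝ) ^ (i : ℕ) * (-1) ^ j * Real.log (A j - A i))]
    refine sum_congr rfl fun l _ => ?_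
    rw [hA, hA, ← neg_sub (α l ^ ω), Real.log_neg_eq_log]
  have hAB : ∀ t : ℝ, ∑ j ∈ range n, (-1) ^ j * Real.log (A j + t ^ ω) =
      ∑ j : Fin n, (-1 : ℝ) ^ (j : ℕ) * Real.log (α j ^ ω + t ^ ω) := by
    intro t
    rw [← Fin.sum_univ_eq_sum_range (fun j => (-1 : ℝ) ^ j * Real.log (A j + t ^ ω))]
    exact sum_congr rfl fun j _ => by rw [hA]
  have hlog : ∀ x y : ℝ, Real.log (-x - y) = Real.log (y + x) := fun x y => by
    rw [← Real.log_neg_eq_log]; ring_nf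
  have hsub : ∀ x y : ℝ, Real.log (-x + y) = Real.log (x - y) := fun x y => by
    rw [← Real.log_neg_eq_log]; ring_nf
  simp only [hAB]
  simp only [energy, Fintype.sum_sum_type, chargeSign, powSign, Sum.elim_inl, Sum.elim_inr,
    one_mul, neg_mul, mul_neg, sub_neg_eq_add, sum_add_distrib, hAA, hlog, hsub, mul_one,
    sum_neg_distrib, sum_sub_distrib, ← mul_sum]
  have h2 : ∑ x : Fin n, (-1 : ℝ) ^ (x : ℕ) * ∑ i : Fin m, Real.log (α x ^ ω + t i ^ ω) =
      ∑ i : Fin m, ∑ x : Fin n, (-1 : ℝ) ^ (x : ℕ) * Real.log (α x ^ ω + t i ^ ω) := by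
    simp only [mul_sum]
    exact sum_comm
  subst hc
  rw [h2]
  ring

theorem energy_cons {n m ω : ℕ} {e c : ℝ} (hc : c = ω - 1 / 2 - e) {α : Fin n → ℝ} {A : ℕ → ℝ}
    (hA : ∀ j : Fin n, A j = α j ^ ω) (τ₀ : ℝ) (y : Fin m → ℝ) :
    energy (chargeSign n (m + 1)) (powSign n (m + 1)) ω e
      (Sum.elim α (Fin.cons τ₀ y : Fin (m + 1) → ℝ)) =
    ∑ j : Fin n, ((-1) ^ (j : ℕ) * α j + ((-1) ^ (j : ℕ) * e + (ω - 1 / 2)) * Real.log (α j)) +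
      2 * AltSum.pairEnergy A n +
      (-τ₀ + c * Real.log τ₀ - 2 * ∑ j ∈ range n, (-1) ^ j * Real.log (A j + τ₀ ^ ω)) +
      ∑ l, orbitPotential A n ω c τ₀ (y l) +
      ∑ l, ∑ l', Real.log (y l ^ ω - y l' ^ ω) := by
  have h1 : ∑ i : Fin m, Real.log (y i ^ ω - τ₀ ^ ω) = ∑ i : Fin m, Real.log (τ₀ ^ ω - y i ^ ω) :=
    sum_congr rfl fun i _ => by
      rw [← Real.log_neg_eq_log, neg_sub]
  rw [energy_elim hc hA]
  simp only [orbitPotential, Fin.sum_univ_succ, Fin.cons_zero, Fin.cons_succ, sub_self,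
    Real.log_zero, sum_add_distrib, ← mul_sum]
  rw [← h1]
  ring

/-- Midpoint concavity of the interaction of two orbits of the second family. -/
theorem log_add_log_le_midpoint {ω : ℕ} (hω : ω = 1 ∨ ω = 2) {x₁ x₂ y₁ y₂ : ℝ} (hx₂ : 0 < x₂)
    (hx : x₂ < x₁) (hy₂ : 0 < y₂) (hy : y₂ < y₁) :
    Real.log (x₁ ^ ω - x₂ ^ ω) + Real.log (y₁ ^ ω - y₂ ^ ω) ≤
      2 * Real.log (((x₁ + y₁) / 2) ^ ω - ((x₂ + y₂) / 2) ^ ω) := by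
  have hω0 : ω ≠ 0 := by omega
  have h1 : 0 < x₁ ^ ω - x₂ ^ ω := sub_pos.2 (pow_lt_pow_left₀ hx hx₂.le hω0)
  have h2 : 0 < y₁ ^ ω - y₂ ^ ω := sub_pos.2 (pow_lt_pow_left₀ hy hy₂.le hω0)
  have h3 : 0 < ((x₁ + y₁) / 2) ^ ω - ((x₂ + y₂) / 2) ^ ω :=
    sub_pos.2 (pow_lt_pow_left₀ (by linarith) (by linarith) hω0)
  have hlog : ∀ z : ℝ, 2 * Real.log z = Real.log (z ^ 2) := fun z => by
    rw [Real.log_pow, Nat.cast_ofNat]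
  rw [← Real.log_mul h1.ne' h2.ne', hlog]
  refine Real.log_le_log (mul_pos h1 h2) ?_
  obtain ⟨p, rfl⟩ : ∃ p, x₁ = x₂ + p := ⟨x₁ - x₂, by ring⟩
  obtain ⟨q, rfl⟩ : ∃ q, y₁ = y₂ + q := ⟨y₁ - y₂, by ring⟩
  have hp : 0 < p := by linarith
  have hq : 0 < q := by linarith
  rcases hω with rfl | rfl
  · nlinarith [sq_nonneg (p - q)]
  · have e1 : ((x₂ + p) ^ 2 - x₂ ^ 2) * ((y₂ + q) ^ 2 - y₂ ^ 2) =
        (p * q) * ((2 * x₂ + p) * (2 * y₂ + q)) := by ring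
    have e2 : (((x₂ + p + (y₂ + q)) / 2) ^ 2 - ((x₂ + y₂) / 2) ^ 2) ^ 2 =
        ((p + q) / 2) ^ 2 * ((2 * x₂ + p + (2 * y₂ + q)) / 2) ^ 2 := by ring
    rw [e1, e2]
    gcongr
    · nlinarith [sq_nonneg (p - q)]
    · nlinarith [sq_nonneg (2 * x₂ + p - (2 * y₂ + q))]

end LogGas

namespace LogGas
open Finset

theorem cons_zero_lt_of_strictMono {m : ℕ} {τ₀ : ℝ} {y : Fin m → ℝ}
    (hy : StrictMono (Fin.cons τ₀ y : Fin (m + 1) → ℝ)) (l : Fin m) : τ₀ < y l := by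
  simpa using hy (Fin.succ_pos l)

theorem strictMono_of_cons {m : ℕ} {τ₀ : ℝ} {y : Fin m → ℝ}
    (hy : StrictMono (Fin.cons τ₀ y : Fin (m + 1) → ℝ)) : StrictMono y := fun i j hij => by
  simpa using hy (Fin.succ_lt_succ_iff.2 hij)

theorem eq_of_isMax_energy {N m ω : ℕ} {e c : ℝ} (hc : c = ω - 1 / 2 - e)
    (hcω : (ω = 1 ∧ 0 < c) ∨ (ω = 2 ∧ c = 1 / 2)) {α : Fin (2 * N + 1) → ℝ} (hα0 : 0 < α 0)
    (hα : StrictMono α) {τ₀ : ℝ} (hτ₀ : 0 < τ₀) {y y' : Fin m → ℝ}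
    (hy : StrictMono (Fin.cons τ₀ y : Fin (m + 1) → ℝ))
    (hy' : StrictMono (Fin.cons τ₀ y' : Fin (m + 1) → ℝ))
    (hmax : ∀ z : Fin m → ℝ, StrictMono (Fin.cons τ₀ z : Fin (m + 1) → ℝ) →
      energy (chargeSign (2 * N + 1) (m + 1)) (powSign (2 * N + 1) (m + 1)) ω e
        (Sum.elim α (Fin.cons τ₀ z : Fin (m + 1) → ℝ)) ≤
      energy (chargeSign (2 * N + 1) (m + 1)) (powSign (2 * N + 1) (m + 1)) ω e
        (Sum.elim α (Fin.cons τ₀ y : Fin (m + 1) → ℝ)))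
    (hmax' : ∀ z : Fin m → ℝ, StrictMono (Fin.cons τ₀ z : Fin (m + 1) → ℝ) →
      energy (chargeSign (2 * N + 1) (m + 1)) (powSign (2 * N + 1) (m + 1)) ω e
        (Sum.elim α (Fin.cons τ₀ z : Fin (m + 1) → ℝ)) ≤
      energy (chargeSign (2 * N + 1) (m + 1)) (powSign (2 * N + 1) (m + 1)) ω e
        (Sum.elim α (Fin.cons τ₀ y' : Fin (m + 1) → ℝ))) : y = y' := by
  by_contra hne
  have hω : ω = 1 ∨ ω = 2 := by omega
  have hω0 : ω ≠ 0 := by omega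
  have haω : StrictMono fun j => α j ^ ω := fun i j hij =>
    pow_lt_pow_left₀ (hα hij) (hα0.le.trans (hα.monotone (Fin.zero_le i))) hω0
  obtain ⟨A, hA, hAα⟩ := haω.exists_extend_nat
  have hA0 : 0 < A 0 := by
    have := hAα 0
    simp only [Fin.val_zero] at this
    rw [this]
    positivity
  have hcons : ∀ i, (Fin.cons τ₀ (fun l => (y l + y' l) / 2) : Fin (m + 1) → ℝ) i =
      ((Fin.cons τ₀ y : Fin (m + 1) → ℝ) i + (Fin.cons τ₀ y' : Fin (m + 1) → ℝ) i) / 2 := by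
    refine Fin.cases ?_ fun l => ?_
    · simp
    · simp
  have hz : StrictMono (Fin.cons τ₀ (fun l => (y l + y' l) / 2) : Fin (m + 1) → ℝ) :=
    fun i j hij => by rw [hcons, hcons]; linarith [hy hij, hy' hij]
  have h1 := hmax _ hz
  have h2 := hmax' _ hz
  rw [energy_cons hc hAα, energy_cons hc hAα] at h1 h2
  have hτy := cons_zero_lt_of_strictMono hy
  have hτy' := cons_zero_lt_of_strictMono hy'
  have hconc := strictConcaveOn_orbitPotential hA hA0 N hcω hτ₀
  have h3 : ∑ l, orbitPotential A (2 * N + 1) ω c τ₀ (y l) +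
      ∑ l, orbitPotential A (2 * N + 1) ω c τ₀ (y' l) <
      2 * ∑ l, orbitPotential A (2 * N + 1) ω c τ₀ ((y l + y' l) / 2) := by
    rw [← sum_add_distrib, mul_sum]
    obtain ⟨l₀, hl₀⟩ := Function.ne_iff.1 hne
    have hmid : ∀ l, (1 / 2 : ℝ) • y l + (1 / 2 : ℝ) • y' l = (y l + y' l) / 2 := fun l => by
      simp only [smul_eq_mul]; ring
    refine sum_lt_sum (fun l _ => ?_) ⟨l₀, mem_univ _, ?_⟩
    · have := hconc.concaveOn.2 (hτy l) (hτy' l) (by norm_num : (0 : ℝ) ≤ 1 / 2)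
        (by norm_num : (0 : ℝ) ≤ 1 / 2) (by norm_num)
      rw [hmid] at this
      simp only [smul_eq_mul] at this
      linarith
    · have := hconc.2 (hτy l₀) (hτy' l₀) hl₀ (by norm_num : (0 : ℝ) < 1 / 2)
        (by norm_num : (0 : ℝ) < 1 / 2) (by norm_num)
      rw [hmid] at this
      simp only [smul_eq_mul] at this
      linarith
  have h4 : ∑ l, ∑ l', Real.log (y l ^ ω - y l' ^ ω) +
      ∑ l, ∑ l', Real.log (y' l ^ ω - y' l' ^ ω) ≤
      2 * ∑ l, ∑ l', Real.log (((y l + y' l) / 2) ^ ω - ((y l' + y' l') / 2) ^ ω) := by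
    simp only [← sum_add_distrib, mul_sum]
    refine sum_le_sum fun l _ => sum_le_sum fun l' _ => ?_
    have hlt : ∀ l l', l' < l → Real.log (y l ^ ω - y l' ^ ω) + Real.log (y' l ^ ω - y' l' ^ ω) ≤
        2 * Real.log (((y l + y' l) / 2) ^ ω - ((y l' + y' l') / 2) ^ ω) := fun l l' h =>
      log_add_log_le_midpoint hω (hτ₀.trans (hτy l')) (strictMono_of_cons hy h)
        (hτ₀.trans (hτy' l')) (strictMono_of_cons hy' h)
    rcases lt_trichotomy l l' with h | rfl | h
    · have := hlt _ _ h
      rw [← Real.log_neg_eq_log, ← Real.log_neg_eq_log (y' l' ^ ω - y' l ^ ω),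
        ← Real.log_neg_eq_log (((y l' + y' l') / 2) ^ ω - _)] at this
      simpa only [neg_sub] using this
    · simp
    · exact hlt _ _ h
  linarith

end LogGas

namespace LogGas
open Finset

theorem isOpen_setOf_strictMono (n : ℕ) : IsOpen {a : Fin n → ℝ | StrictMono a} := by
  have : {a : Fin n → ℝ | StrictMono a} = ⋂ i, ⋂ j, ⋂ _ : i < j, {a | a i < a j} := by
    ext a
    simp [StrictMono]
  rw [this]
  exact isOpen_iInter_of_finite fun i => isOpen_iInter_of_finite fun j =>
    isOpen_iInter_of_finite fun _ => isOpen_lt (continuous_apply i) (continuous_apply j)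

theorem powSign_mul_pow_ne {n m ω : ℕ} (hω : ω ≠ 0) {r : Fin n ⊕ Fin m → ℝ} (hpos : ∀ i, 0 < r i)
    (h₁ : StrictMono fun j => r (Sum.inl j)) (h₂ : StrictMono fun l => r (Sum.inr l))
    (i l : Fin n ⊕ Fin m) (hil : i ≠ l) :
    powSign n m i * r i ^ ω ≠ powSign n m l * r l ^ ω := by
  have hne : ∀ i l, r i ≠ r l → r i ^ ω ≠ r l ^ ω := fun i l h h' =>
    h ((pow_left_inj₀ (hpos i).le (hpos l).le hω).1 h')
  have hp : ∀ i, 0 < r i ^ ω := fun i => pow_pos (hpos i) ω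
  rcases i with i | i <;> rcases l with l | l
  · simpa [powSign] using hne _ _ (h₁.injective.ne (fun h => hil (by rw [h])))
  · have := hp (Sum.inl i); have := hp (Sum.inr l)
    simp only [powSign, Sum.elim_inl, Sum.elim_inr]
    intro h; linarith
  · have := hp (Sum.inr i); have := hp (Sum.inl l)
    simp only [powSign, Sum.elim_inl, Sum.elim_inr]
    intro h; linarith
  · simpa [powSign] using hne _ _ (h₂.injective.ne (fun h => hil (by rw [h])))

section Continuity

variable {X ι : Type*} [TopologicalSpace X] [Fintype ι] {q σ : ι → ℝ} {ω : ℕ} {e : ℝ}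
  {R : X → ι → ℝ} {S : Set X}

theorem continuousOn_energy (hR : ContinuousOn R S) (hpos : ∀ x ∈ S, ∀ i, 0 < R x i)
    (hz : ∀ x ∈ S, ∀ i l, i ≠ l → σ i * R x i ^ ω ≠ σ l * R x l ^ ω) :
    ContinuousOn (fun x => energy q σ ω e (R x)) S := by
  have hRi : ∀ i, ContinuousOn (fun x => R x i) S := fun i => (continuousOn_pi.1 hR) i
  unfold energy
  refine ContinuousOn.add (continuousOn_finsetSum _ fun i _ => ?_)
    (continuousOn_finsetSum _ fun i _ => continuousOn_finsetSum _ fun l _ => ?_)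
  · exact (continuousOn_const.mul (hRi i)).add
      (continuousOn_const.mul ((hRi i).log fun x hx => (hpos x hx i).ne'))
  · rcases eq_or_ne i l with rfl | hil
    · simpa using continuousOn_const
    · exact continuousOn_const.mul (((continuousOn_const.mul ((hRi i).pow ω)).sub
        (continuousOn_const.mul ((hRi l).pow ω))).log fun x hx => sub_ne_zero.2 (hz x hx i l hil))

theorem continuousOn_moment (hR : ContinuousOn R S)
    (hz : ∀ x ∈ S, ∀ i l, i ≠ l → σ i * R x i ^ ω ≠ σ l * R x l ^ ω) (i : ι) :
    ContinuousOn (fun x => moment q σ ω e (R x) i) S := by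
  have hRi : ∀ i, ContinuousOn (fun x => R x i) S := fun i => (continuousOn_pi.1 hR) i
  unfold moment
  refine (((hRi i).add continuousOn_const).add continuousOn_const).add
    (continuousOn_const.mul (continuousOn_finsetSum _ fun l _ => ?_))
  rcases eq_or_ne i l with rfl | hil
  · simpa using continuousOn_const
  · exact continuousOn_const.mul ((continuousOn_const.mul ((hRi i).pow ω)).div
      ((continuousOn_const.mul ((hRi i).pow ω)).sub (continuousOn_const.mul ((hRi l).pow ω)))
      fun x hx => sub_ne_zero.2 (hz x hx i l hil))

end Continuity

/-- The squared radii of the orbits, the first orbit of the second family being slaved to the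
first orbit of the first family. -/
noncomputable def radii {n m : ℕ} (h : ℝ → ℝ) (p : ((Fin (n + 1) → ℝ) × ℝ) × (Fin m → ℝ)) :
    Fin (n + 1) ⊕ Fin (m + 1) → ℝ :=
  Sum.elim p.1.1 (Fin.cons (Real.exp p.1.2 * h (p.1.1 0)) p.2 : Fin (m + 1) → ℝ)

/-- The parameters for which the radii are positive and increasing. -/
def admissible (n m : ℕ) (h : ℝ → ℝ) : Set (((Fin (n + 1) → ℝ) × ℝ) × (Fin m → ℝ)) :=
  {p | 0 < p.1.1 0 ∧ StrictMono p.1.1 ∧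
    StrictMono (Fin.cons (Real.exp p.1.2 * h (p.1.1 0)) p.2 : Fin (m + 1) → ℝ)}

variable {n m : ℕ} {h ℓ : ℝ → ℝ}

theorem continuous_radii (hh : Continuous h) : Continuous (radii (n := n) (m := m) h) := by
  refine continuous_pi fun i => ?_
  rcases i with j | l
  · simp only [radii, Sum.elim_inl]; fun_prop
  · refine Fin.cases ?_ (fun l => ?_) l
    · simp only [radii, Sum.elim_inr, Fin.cons_zero]; fun_prop
    · simp only [radii, Sum.elim_inr, Fin.cons_succ]; fun_prop

theorem isOpen_admissible (hh : Continuous h) : IsOpen (admissible n m h) := by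
  have hr := continuous_radii (n := n) (m := m) hh
  have hc : Continuous fun p : ((Fin (n + 1) → ℝ) × ℝ) × (Fin m → ℝ) =>
      (Fin.cons (Real.exp p.1.2 * h (p.1.1 0)) p.2 : Fin (m + 1) → ℝ) :=
    continuous_pi fun l => (continuous_apply (Sum.inr l)).comp hr
  have h₁ : Continuous fun p : ((Fin (n + 1) → ℝ) × ℝ) × (Fin m → ℝ) => p.1.1 := by fun_prop
  exact (isOpen_lt continuous_const ((continuous_apply 0).comp h₁)).inter
    (((isOpen_setOf_strictMono _).preimage h₁).inter ((isOpen_setOf_strictMono _).preimage hc))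

theorem radii_pos (hh0 : ∀ x, 0 < x → 0 < h x) {p : ((Fin (n + 1) → ℝ) × ℝ) × (Fin m → ℝ)}
    (hp : p ∈ admissible n m h) (i : Fin (n + 1) ⊕ Fin (m + 1)) : 0 < radii h p i := by
  rcases i with j | l
  · exact hp.1.trans_le (hp.2.1.monotone (Fin.zero_le j))
  · exact (mul_pos (Real.exp_pos _) (hh0 _ hp.1)).trans_le
      (by simpa [radii] using hp.2.2.monotone (Fin.zero_le l))

theorem radii_ne {ω : ℕ} (hω : ω ≠ 0) (hh0 : ∀ x, 0 < x → 0 < h x)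
    {p : ((Fin (n + 1) → ℝ) × ℝ) × (Fin m → ℝ)} (hp : p ∈ admissible n m h) :
    ∀ i l, i ≠ l → powSign (n + 1) (m + 1) i * radii h p i ^ ω ≠
      powSign (n + 1) (m + 1) l * radii h p l ^ ω :=
  powSign_mul_pow_ne hω (radii_pos hh0 hp) hp.2.1 hp.2.2

theorem chargeSign_inl {n m : ℕ} (j : Fin n) : chargeSign n m (Sum.inl j) = (-1) ^ (j : ℕ) := rfl

theorem chargeSign_inr {n m : ℕ} (l : Fin m) : chargeSign n m (Sum.inr l) = -1 := rfl

theorem chargeSign_mul_self (n m : ℕ) (i : Fin n ⊕ Fin m) :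
    chargeSign n m i * chargeSign n m i = 1 := by
  rcases i with j | l
  · simp [chargeSign, ← mul_pow]
  · simp [chargeSign]

/-- The energy as a function of the parameters. -/
noncomputable def paramEnergy (n m ω : ℕ) (e : ℝ) (h : ℝ → ℝ)
    (p : ((Fin (n + 1) → ℝ) × ℝ) × (Fin m → ℝ)) : ℝ :=
  energy (chargeSign (n + 1) (m + 1)) (powSign (n + 1) (m + 1)) ω e (radii h p)

/-- The moments as functions of the parameters. -/
noncomputable def paramMoment (n m ω : ℕ) (e : ℝ) (h : ℝ → ℝ)
    (p : ((Fin (n + 1) → ℝ) × ℝ) × (Fin m → ℝ)) (i : Fin (n + 1) ⊕ Fin (m + 1)) : ℝ :=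
  moment (chargeSign (n + 1) (m + 1)) (powSign (n + 1) (m + 1)) ω e (radii h p) i

/-- The partial derivative of the energy with respect to the `j`-th radius of the first family. -/
noncomputable def gradEnergy (n m ω : ℕ) (e : ℝ) (h ℓ : ℝ → ℝ)
    (p : ((Fin (n + 1) → ℝ) × ℝ) × (Fin m → ℝ)) (j : Fin (n + 1)) : ℝ :=
  (-1) ^ (j : ℕ) * paramMoment n m ω e h p (Sum.inl j) / p.1.1 j -
    if j = 0 then paramMoment n m ω e h p (Sum.inr 0) * ℓ (p.1.1 0) else 0

theorem continuousOn_paramEnergy {ω : ℕ} (hω : ω ≠ 0) {e : ℝ} (hh : Continuous h)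
    (hh0 : ∀ x, 0 < x → 0 < h x) : ContinuousOn (paramEnergy n m ω e h) (admissible n m h) :=
  continuousOn_energy (continuous_radii hh).continuousOn (fun _ hp => radii_pos hh0 hp)
    (fun _ hp => radii_ne hω hh0 hp)

theorem continuousOn_paramMoment {ω : ℕ} (hω : ω ≠ 0) {e : ℝ} (hh : Continuous h)
    (hh0 : ∀ x, 0 < x → 0 < h x) (i : Fin (n + 1) ⊕ Fin (m + 1)) :
    ContinuousOn (fun p => paramMoment n m ω e h p i) (admissible n m h) :=
  continuousOn_moment (continuous_radii hh).continuousOn (fun _ hp => radii_ne hω hh0 hp) i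

theorem continuousOn_gradEnergy {ω : ℕ} (hω : ω ≠ 0) {e : ℝ} (hh : Continuous h)
    (hh0 : ∀ x, 0 < x → 0 < h x) (hℓ : ContinuousOn ℓ (Set.Ioi 0)) :
    ContinuousOn (gradEnergy n m ω e h ℓ) (admissible n m h) := by
  refine continuousOn_pi.2 fun j => ?_
  have hj : ContinuousOn (fun p : ((Fin (n + 1) → ℝ) × ℝ) × (Fin m → ℝ) => p.1.1 j)
    (admissible n m h) := by fun_prop
  refine ((continuousOn_const.mul (continuousOn_paramMoment hω hh hh0 _)).div hj
    fun p hp => (radii_pos hh0 hp (Sum.inl j)).ne').sub ?_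
  split_ifs
  · exact (continuousOn_paramMoment hω hh hh0 _).mul (hℓ.comp (by fun_prop) fun p hp => hp.1)
  · exact continuousOn_const

theorem hasDerivAt_paramEnergy {ω : ℕ} (hω : ω ≠ 0) {e : ℝ} (hh0 : ∀ x, 0 < x → 0 < h x)
    (hhd : ∀ x, 0 < x → HasDerivAt h (h x * ℓ x) x) {x : (Fin (n + 1) → ℝ) × ℝ} {y : Fin m → ℝ}
    (hp : (x, y) ∈ admissible n m h) (v : (Fin (n + 1) → ℝ) × ℝ) (w : Fin m → ℝ) :
    HasDerivAt (fun t : ℝ => paramEnergy n m ω e h (x + t • v, y + t • w))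
      (∑ j, gradEnergy n m ω e h ℓ (x, y) j * v.1 j +
        -paramMoment n m ω e h (x, y) (Sum.inr 0) * v.2 -
        ∑ l, paramMoment n m ω e h (x, y) (Sum.inr l.succ) * (w l / y l)) 0 := by
  have hpath : ∀ i, HasDerivAt (fun t : ℝ => radii h (x + t • v, y + t • w) i)
      ((Sum.elim v.1 (Fin.cons (Real.exp x.2 * h (x.1 0) * (v.2 + ℓ (x.1 0) * v.1 0)) w :
        Fin (m + 1) → ℝ) : Fin (n + 1) ⊕ Fin (m + 1) → ℝ) i) 0 := by
    have hlin : ∀ a b : ℝ, HasDerivAt (fun t : ℝ => a + t * b) b 0 := fun a b => by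
      simpa using ((hasDerivAt_id (0 : ℝ)).mul_const b).const_add a
    rintro (j | l)
    · simpa [radii] using hlin (x.1 j) (v.1 j)
    · refine Fin.cases ?_ (fun l => ?_) l
      · have h1 := (hlin x.2 v.2).exp
        have h2 : HasDerivAt (fun t : ℝ => h (x.1 0 + t * v.1 0))
            (h (x.1 0) * ℓ (x.1 0) * v.1 0) 0 := by
          refine HasDerivAt.comp (h₂ := h) (0 : ℝ) ?_ (hlin _ _)
          simpa using hhd _ hp.1
        have h3 := h1.fun_mul h2
        simp only [zero_mul, add_zero] at h3
        simp only [radii, Sum.elim_inr, Fin.cons_zero, Prod.snd_add, Prod.smul_snd, smul_eq_mul,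
          Prod.fst_add, Prod.smul_fst, Pi.add_apply, Pi.smul_apply]
        exact h3.congr_deriv (by ring)
      · simpa [radii] using hlin (y l) (w l)
  have hd := hasDerivAt_energy (e := e) (ω := ω) (σ := powSign (n + 1) (m + 1))
    (chargeSign_mul_self (n + 1) (m + 1)) hpath
    (by simpa using radii_pos hh0 hp) (by simpa using radii_ne hω hh0 hp)
  have hτ : Real.exp x.2 * h (x.1 0) ≠ 0 := (mul_pos (Real.exp_pos _) (hh0 _ hp.1)).ne'
  have e1 : ∀ i, radii h (x, y) (Sum.inl i) = x.1 i := fun i => rfl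
  have e2 : radii h (x, y) (Sum.inr 0) = Real.exp x.2 * h (x.1 0) := rfl
  have e3 : ∀ l : Fin m, radii h (x, y) (Sum.inr l.succ) = y l := fun l => rfl
  have e4 : ∀ i, moment (chargeSign (n + 1) (m + 1)) (powSign (n + 1) (m + 1)) ω e
    (radii h (x, y)) i = paramMoment n m ω e h (x, y) i := fun i => rfl
  have e5 : ∑ i : Fin (n + 1), (-1 : ℝ) ^ (i : ℕ) *
      paramMoment n m ω e h (x, y) (Sum.inl i) * (v.1 i / x.1 i) =
      ∑ i : Fin (n + 1), (-1 : ℝ) ^ (i : ℕ) *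
      paramMoment n m ω e h (x, y) (Sum.inl i) / x.1 i * v.1 i :=
    sum_congr rfl fun i _ => by ring
  refine hd.congr_deriv ?_
  simp only [zero_smul, add_zero, e4, Fintype.sum_sum_type, chargeSign_inl, chargeSign_inr,
    Sum.elim_inl, Sum.elim_inr, Fin.sum_univ_succ (n := m), gradEnergy, sub_mul, sum_sub_distrib,
    ite_mul, zero_mul, sum_ite_eq', mem_univ, if_true, Fin.cons_zero, Fin.cons_succ, e1, e2, e3, e5,
    neg_mul, one_mul, sum_neg_distrib, mul_div_cancel_left₀ _ hτ]
  ring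

end LogGas

namespace LogGas
open Finset

theorem exists_mul_log_one_add_le (A : ℝ) {ε : ℝ} (hε : 0 < ε) :
    ∃ B, 0 ≤ B ∧ ∀ y : ℝ, 0 ≤ y → A * Real.log (1 + y) ≤ ε * y + B := by
  set D := |A| / ε + 1 with hD
  have hDp : 0 < D := by positivity
  have hD1 : 1 ≤ D := by
    have : 0 ≤ |A| / ε := by positivity
    linarith
  have hDl := Real.log_nonneg hD1
  refine ⟨|A| * Real.log D + ε, by positivity, fun y hy => ?_⟩
  have h1 := Real.log_le_sub_one_of_pos (show 0 < (1 + y) / D by positivity)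
  rw [Real.log_div (by positivity) hDp.ne'] at h1
  have h0 : 0 ≤ Real.log (1 + y) := Real.log_nonneg (by linarith)
  have h2 : A * Real.log (1 + y) ≤ |A| * Real.log (1 + y) :=
    mul_le_mul_of_nonneg_right (le_abs_self A) h0
  have h3 : |A| * ((1 + y) / D) ≤ ε * (1 + y) := by
    rw [mul_div_assoc', div_le_iff₀ hDp, hD]
    have : ε * (|A| / ε) = |A| := by field_simp
    nlinarith
  nlinarith [mul_le_mul_of_nonneg_left h1 (abs_nonneg A), abs_nonneg A]

theorem log_pow_sub_pow_le (ω : ℕ) {x y : ℝ} (hx : 0 ≤ x) (hy : 0 ≤ y) :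
    Real.log (x ^ ω - y ^ ω) ≤ ω * Real.log (1 + x) + ω * Real.log (1 + y) := by
  have h0 : 0 ≤ ω * Real.log (1 + x) + ω * Real.log (1 + y) := by
    have := Real.log_nonneg (show 1 ≤ 1 + x by linarith)
    have := Real.log_nonneg (show 1 ≤ 1 + y by linarith)
    positivity
  rw [← Real.log_abs]
  rcases (abs_nonneg (x ^ ω - y ^ ω)).eq_or_lt with h | h
  · rwa [← h, Real.log_zero]
  rw [← Real.log_pow, ← Real.log_pow, ← Real.log_mul (by positivity) (by positivity)]
  refine Real.log_le_log h ?_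
  have h1 : x ^ ω ≤ (1 + x) ^ ω := by gcongr; linarith
  have h2 : y ^ ω ≤ (1 + y) ^ ω := by gcongr; linarith
  have h3 : 1 ≤ (1 + x) ^ ω := one_le_pow₀ (by linarith)
  have h4 : 1 ≤ (1 + y) ^ ω := one_le_pow₀ (by linarith)
  have h5 : 0 ≤ x ^ ω := by positivity
  have h6 : 0 ≤ y ^ ω := by positivity
  exact abs_le.2 ⟨by nlinarith, by nlinarith⟩

theorem neg_sum_log_add_le {A : ℕ → ℝ} (hA : StrictMono A) (hA0 : 0 < A 0) (N : ℕ) {b : ℝ}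
    (hb : 0 ≤ b) :
    -∑ j ∈ range (2 * N + 1), (-1) ^ j * Real.log (A j + b) ≤ -Real.log (A 0) := by
  have h := AltSum.first_le_of_monotone (f := fun j => Real.log (A j + b)) (fun i j hij =>
    Real.log_le_log (by linarith [hA.monotone (Nat.zero_le i)])
      (by linarith [hA.monotone hij])) N
  have := Real.log_le_log hA0 (show A 0 ≤ A 0 + b by linarith)
  beta_reduce at h
  linarith

theorem energy_elim_le {N m ω : ℕ} (hω : ω ≠ 0) {e c : ℝ} (hc : c = ω - 1 / 2 - e) (hc0 : 0 ≤ c)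
    {α : Fin (2 * N + 1) → ℝ} (hα0 : 0 < α 0) (hα : StrictMono α) {t : Fin m → ℝ}
    (ht : ∀ l, 0 ≤ t l) :
    energy (chargeSign (2 * N + 1) m) (powSign (2 * N + 1) m) ω e (Sum.elim α t) ≤
      energy (chargeSign (2 * N + 1) 0) (powSign (2 * N + 1) 0) ω e (Sum.elim α Fin.elim0) +
      ∑ l, (-t l + c * Real.log (1 + t l) - 2 * Real.log (α 0 ^ ω)) +
      ∑ l, ∑ l', Real.log (t l ^ ω - t l' ^ ω) := by
  have haω : StrictMono fun j => α j ^ ω := fun i j hij =>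
    pow_lt_pow_left₀ (hα hij) (hα0.le.trans (hα.monotone (Fin.zero_le i))) hω
  obtain ⟨A, hA, hAα⟩ := haω.exists_extend_nat
  have hA0 : A 0 = α 0 ^ ω := by simpa using hAα 0
  rw [energy_elim hc hAα, energy_elim hc hAα]
  simp only [univ_eq_empty, sum_empty, add_zero]
  refine add_le_add_left (add_le_add_right (sum_le_sum fun l _ => ?_) _) _
  · have h1 := neg_sum_log_add_le hA (hA0 ▸ pow_pos hα0 ω) N (pow_nonneg (ht l) ω)
    have h2 : Real.log (t l) ≤ Real.log (1 + t l) := by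
      rcases (ht l).eq_or_lt with h | h
      · simp [← h]
      · exact Real.log_le_log h (by linarith)
    rw [hA0] at h1
    nlinarith

theorem isCompact_superlevel {N m ω : ℕ} (hω : ω ≠ 0) {e c : ℝ} (hc : c = ω - 1 / 2 - e)
    (hc0 : 0 ≤ c) {h : ℝ → ℝ} (hh : Continuous h) (hh0 : ∀ x, 0 < x → 0 < h x)
    {K : Set ((Fin (2 * N + 1) → ℝ) × ℝ)} (hK : IsCompact K)
    (hKU : K ⊆ {a | 0 < a 0 ∧ StrictMono a} ×ˢ Set.univ) (C : ℝ) :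
    IsCompact {p | p ∈ admissible (2 * N) m h ∧ p.1 ∈ K ∧ C ≤ paramEnergy (2 * N) m ω e h p} := by
  have hpos : ∀ x ∈ K, ∀ j, 0 < x.1 j := fun x hx j =>
    (hKU hx).1.1.trans_le ((hKU hx).1.2.monotone (Fin.zero_le j))
  obtain ⟨C₀, hC₀⟩ : ∃ C₀, ∀ x ∈ K, energy (chargeSign (2 * N + 1) 0) (powSign (2 * N + 1) 0) ω e
      (Sum.elim x.1 Fin.elim0) ≤ C₀ := by
    have hcont : ContinuousOn (fun x : (Fin (2 * N + 1) → ℝ) × ℝ =>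
        energy (chargeSign (2 * N + 1) 0) (powSign (2 * N + 1) 0) ω e (Sum.elim x.1 Fin.elim0)) K := by
      have hp : ∀ x ∈ K, ∀ i : Fin (2 * N + 1) ⊕ Fin 0, 0 < (Sum.elim x.1 Fin.elim0 : _ → ℝ) i := by
        rintro x hx (j | l)
        · exact hpos x hx j
        · exact l.elim0
      refine continuousOn_energy (continuous_pi ?_).continuousOn hp fun x hx =>
        powSign_mul_pow_ne hω (hp x hx) (hKU hx).1.2 fun l => l.elim0
      rintro (j | l)
      · simp only [Sum.elim_inl]; fun_prop
      · exact l.elim0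
    obtain ⟨C₀, h⟩ := hK.bddAbove_image hcont
    exact ⟨C₀, fun x hx => h ⟨x, hx, rfl⟩⟩
  obtain ⟨C₁, hC₁⟩ : ∃ C₁, ∀ x ∈ K, -Real.log (x.1 0 ^ ω) ≤ C₁ := by
    have hcont : ContinuousOn (fun x : (Fin (2 * N + 1) → ℝ) × ℝ => -Real.log (x.1 0 ^ ω)) K :=
      (ContinuousOn.log (by fun_prop) fun x hx => (pow_pos (hpos x hx 0) ω).ne').neg
    obtain ⟨C₁, h⟩ := hK.bddAbove_image hcont
    exact ⟨C₁, fun x hx => h ⟨x, hx, rfl⟩⟩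
  obtain ⟨B, hB0, hB⟩ := exists_mul_log_one_add_le (c + 2 * ω * (m + 1)) one_half_pos
  set R := 2 * (C₀ + (m + 1) * (2 * C₁) + (m + 1) * B - C) with hR
  set v := 2 * ω * Real.log (1 + |R|) with hv
  set D := C₀ + (m + 1) * (c * Real.log (1 + |R|) + 2 * C₁) + (m + 1) * ((m + 1) * v) - C with hD
  set t : ((Fin (2 * N + 1) → ℝ) × ℝ) × (Fin m → ℝ) → Fin (m + 1) → ℝ :=
    fun p l => radii h p (Sum.inr l) with ht
  have htc : ∀ l, Continuous fun p => t p l := fun l =>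
    (continuous_apply (Sum.inr l)).comp (continuous_radii hh)
  set T : Set (((Fin (2 * N + 1) → ℝ) × ℝ) × (Fin m → ℝ)) := {p | p.1 ∈ K ∧ (∀ l, 0 ≤ t p l) ∧
    (∀ l, t p l ≤ |R|) ∧ ∀ i l, l < i → Real.exp (-D) ≤ t p i ^ ω - t p l ^ ω} with hT
  have hTc : IsCompact T := by
    refine (hK.prod (isCompact_univ_pi fun _ : Fin m =>
      isCompact_Icc (a := (0 : ℝ)) (b := |R|))).of_isClosed_subset ?_ ?_
    · have h₁ : IsClosed {p | ∀ l, 0 ≤ t p l} := by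
        simp only [Set.ofPred_forall]
        exact isClosed_iInter fun l => isClosed_le continuous_const (htc l)
      have h₂ : IsClosed {p | ∀ l, t p l ≤ |R|} := by
        simp only [Set.ofPred_forall]
        exact isClosed_iInter fun l => isClosed_le (htc l) continuous_const
      have h₃ : IsClosed {p | ∀ i l, l < i → Real.exp (-D) ≤ t p i ^ ω - t p l ^ ω} := by
        simp only [Set.ofPred_forall]
        exact isClosed_iInter fun i => isClosed_iInter fun l => isClosed_iInter fun _ =>
          isClosed_le continuous_const (((htc i).pow ω).sub ((htc l).pow ω))
      exact (hK.isClosed.preimage continuous_fst).inter (h₁.inter (h₂.inter h₃))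
    · rintro p ⟨h1, h2, h3, -⟩
      exact ⟨h1, fun l _ => ⟨h2 l.succ, h3 l.succ⟩⟩
  have hTO : T ⊆ admissible (2 * N) m h := by
    rintro p ⟨h1, h2, -, h4⟩
    refine ⟨(hKU h1).1.1, (hKU h1).1.2, fun l i hli => ?_⟩
    have h5 : t p l ^ ω < t p i ^ ω := by linarith [h4 i l hli, Real.exp_pos (-D)]
    exact lt_of_pow_lt_pow_left₀ ω (h2 i) h5
  have hcl := ((continuousOn_paramEnergy (e := e) hω hh hh0).mono hTO).preimage_isClosed_of_isClosed
    hTc.isClosed (isClosed_Ici (a := C))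
  have hbound : ∀ p ∈ admissible (2 * N) m h, p.1 ∈ K → C ≤ paramEnergy (2 * N) m ω e h p →
      p ∈ T := by
    intro p hp hpK hpC
    have ht0 : ∀ l, 0 ≤ t p l := fun l => (radii_pos hh0 hp _).le
    have hE : C ≤ C₀ + ∑ l, (-t p l + c * Real.log (1 + t p l) + 2 * C₁) +
        ∑ l, ∑ l', Real.log (t p l ^ ω - t p l' ^ ω) := by
      have h1 := energy_elim_le (N := N) hω hc hc0 hp.1 hp.2.1 ht0
      have h2 : paramEnergy (2 * N) m ω e h p = energy (chargeSign (2 * N + 1) (m + 1))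
          (powSign (2 * N + 1) (m + 1)) ω e (Sum.elim p.1.1 (t p)) := rfl
      have h3 : ∑ l, (-t p l + c * Real.log (1 + t p l) - 2 * Real.log (p.1.1 0 ^ ω)) ≤
          ∑ l, (-t p l + c * Real.log (1 + t p l) + 2 * C₁) :=
        sum_le_sum fun l _ => by linarith [hC₁ _ hpK]
      linarith [hC₀ _ hpK]
    have hpair : ∀ l l', Real.log (t p l ^ ω - t p l' ^ ω) ≤
        ω * Real.log (1 + t p l) + ω * Real.log (1 + t p l') := fun l l' =>
      log_pow_sub_pow_le ω (ht0 l) (ht0 l')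
    have hsum : C ≤ C₀ + (m + 1) * (2 * C₁) + (m + 1) * B - ∑ l, t p l / 2 := by
      have h1 : ∑ l, ∑ l', Real.log (t p l ^ ω - t p l' ^ ω) ≤
          ∑ l, 2 * ω * (m + 1) * Real.log (1 + t p l) := by
        refine (sum_le_sum fun l _ => sum_le_sum fun l' _ => hpair l l').trans_eq ?_
        simp only [sum_add_distrib, ← mul_sum, sum_const, card_univ, Fintype.card_fin, nsmul_eq_mul]
        push_cast
        ring
      have h2 : ∑ l, (-t p l + c * Real.log (1 + t p l) + 2 * C₁) +
          ∑ l, 2 * ω * (m + 1) * Real.log (1 + t p l) ≤ ∑ l, (2 * C₁ + B - t p l / 2) := by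
        rw [← sum_add_distrib]
        refine sum_le_sum fun l _ => ?_
        linarith [hB _ (ht0 l)]
      have h3 : ∑ l, (2 * C₁ + B - t p l / 2) =
          (m + 1) * (2 * C₁) + (m + 1) * B - ∑ l, t p l / 2 := by
        rw [sum_sub_distrib]
        simp only [sum_const, card_univ, Fintype.card_fin, nsmul_eq_mul]
        push_cast
        ring
      linarith
    have htR : ∀ l, t p l ≤ |R| := fun l => by
      have := single_le_sum (f := fun l => t p l / 2) (fun l _ => by linarith [ht0 l]) (mem_univ l)
      beta_reduce at this
      refine le_trans ?_ (le_abs_self R)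
      linarith
    have hlogR : ∀ l, Real.log (1 + t p l) ≤ Real.log (1 + |R|) := fun l =>
      Real.log_le_log (by linarith [ht0 l]) (by linarith [htR l])
    have hv0 : 0 ≤ v := by
      have := Real.log_nonneg (show 1 ≤ 1 + |R| by linarith [abs_nonneg R])
      positivity
    have hpv : ∀ l l', Real.log (t p l ^ ω - t p l' ^ ω) ≤ v := fun l l' => by
      have h1 := mul_le_mul_of_nonneg_left (hlogR l) (Nat.cast_nonneg (α := ℝ) ω)
      have h2 := mul_le_mul_of_nonneg_left (hlogR l') (Nat.cast_nonneg (α := ℝ) ω)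
      linarith [hpair l l']
    refine ⟨hpK, ht0, htR, fun i l hli => ?_⟩
    have hlt : t p l < t p i := hp.2.2 hli
    rw [← Real.exp_log (sub_pos.2 (pow_lt_pow_left₀ hlt (ht0 l) hω))]
    refine Real.exp_le_exp.2 ?_
    have h1 : v - Real.log (t p i ^ ω - t p l ^ ω) ≤
        ∑ i, ∑ l, (v - Real.log (t p i ^ ω - t p l ^ ω)) :=
      (single_le_sum (f := fun l => v - Real.log (t p i ^ ω - t p l ^ ω))
        (fun l _ => sub_nonneg.2 (hpv i l)) (mem_univ l)).trans
      (single_le_sum (f := fun i => ∑ l, (v - Real.log (t p i ^ ω - t p l ^ ω)))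
        (fun i _ => sum_nonneg fun l _ => sub_nonneg.2 (hpv i l)) (mem_univ i))
    have h2 : ∑ i, ∑ l, (v - Real.log (t p i ^ ω - t p l ^ ω)) =
        (m + 1) * ((m + 1) * v) - ∑ i, ∑ l, Real.log (t p i ^ ω - t p l ^ ω) := by
      simp only [sum_sub_distrib, sum_const, card_univ, Fintype.card_fin, nsmul_eq_mul]
      push_cast
      ring
    have h3 : ∑ l, (-t p l + c * Real.log (1 + t p l) + 2 * C₁) ≤
        (m + 1) * (c * Real.log (1 + |R|) + 2 * C₁) := by
      refine (sum_le_sum (g := fun _ => c * Real.log (1 + |R|) + 2 * C₁) fun l _ => ?_).trans_eq ?_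
      · linarith [ht0 l, mul_le_mul_of_nonneg_left (hlogR l) hc0]
      · simp; ring
    linarith
  have heq : {p | p ∈ admissible (2 * N) m h ∧ p.1 ∈ K ∧ C ≤ paramEnergy (2 * N) m ω e h p} =
      T ∩ paramEnergy (2 * N) m ω e h ⁻¹' Set.Ici C :=
    Set.Subset.antisymm (fun p hp => ⟨hbound p hp.1 hp.2.1 hp.2.2, hp.2.2⟩)
      fun p hp => ⟨hTO hp.1, hp.1.1, hp.2⟩
  rw [heq]
  exact hTc.of_isClosed_subset hcl Set.inter_subset_left

end LogGas

namespace LogGas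
open Finset

variable {m : ℕ}

/-- The potential created by the second family of orbits. -/
noncomputable def screening (ω : ℕ) (t : Fin (m + 1) → ℝ) (x : ℝ) : ℝ :=
  2 * ∑ l, Real.log (x ^ ω + t l ^ ω)

/-- The potential seen by the orbits of positive charge of the first family. -/
noncomputable def evenPotential (ω : ℕ) (d : ℝ) (t : Fin (m + 1) → ℝ) (x : ℝ) : ℝ :=
  x + d * Real.log x - screening ω t x

/-- The potential seen by the orbits of negative charge of the first family. -/
noncomputable def oddPotential (ω : ℕ) (c : ℝ) (t : Fin (m + 1) → ℝ) (x : ℝ) : ℝ :=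
  -x + c * Real.log x + screening ω t x

theorem log_pow_sub_pow_nonneg {ω : ℕ} (hω : ω ≠ 0) {x y : ℝ} (hx : 0 ≤ x) (h : x + 1 ≤ y) :
    0 ≤ Real.log (y ^ ω - x ^ ω) := by
  refine Real.log_nonneg ?_
  obtain ⟨k, rfl⟩ := Nat.exists_eq_succ_of_ne_zero hω
  have h1 : x ^ k ≤ y ^ k := pow_le_pow_left₀ hx (by linarith) k
  have h2 : 1 ≤ y ^ k := one_le_pow₀ (by linarith)
  have h3 : 0 ≤ x ^ k := pow_nonneg hx k
  rw [Nat.succ_eq_add_one, pow_succ, pow_succ]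
  nlinarith

theorem pairs_le_energy {M L ω : ℕ} (hω : ω ≠ 0) {e c d : ℝ} (hc : c = ω - 1 / 2 - e)
    (hd : d = ω - 1 / 2 + e) (hc0 : 0 ≤ c) {r : ℕ → ℝ} (hr : StrictMono r) (hr0 : 0 < r 0)
    {t : Fin (m + 1) → ℝ} {T : ℝ} (ht0 : 0 < t 0) (hT : ∀ l, t l ≤ T)
    (hsep : ∀ i l, l < i → t l + 1 ≤ t i) :
    c * Real.log (t 0) - (m + 1) * T +
      ∑ i ∈ range M, (evenPotential ω d t (r (2 * i)) + oddPotential ω c t (r (2 * i + 1)) -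
        2 * Real.log (r (2 * i + 1) ^ ω - r (2 * i) ^ ω)) +
      evenPotential ω d t (r (2 * M)) +
      ∑ i ∈ range L, (oddPotential ω c t (r (2 * (M + i) + 1)) +
        evenPotential ω d t (r (2 * (M + i) + 2)) -
        2 * Real.log (r (2 * (M + i) + 2) ^ ω - r (2 * (M + i) + 1) ^ ω)) ≤
    energy (chargeSign (2 * (M + L) + 1) (m + 1)) (powSign (2 * (M + L) + 1) (m + 1)) ω e
      (Sum.elim (fun j => r j) t) := by
  have hrp : ∀ j, 0 < r j := fun j => hr0.trans_le (hr.monotone (Nat.zero_le j))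
  have hA : StrictMono fun j => r j ^ ω := fun i j hij => pow_lt_pow_left₀ (hr hij) (hrp i).le hω
  have htp : ∀ l, 0 < t l := by
    refine Fin.cases ht0 fun l => ?_
    linarith [hsep _ _ (Fin.succ_pos l)]
  have h1 : ∑ j : Fin (2 * (M + L) + 1), ((-1) ^ (j : ℕ) * r j +
      ((-1) ^ (j : ℕ) * e + (ω - 1 / 2)) * Real.log (r j)) +
      ∑ l, (-t l + c * Real.log (t l) - 2 * ∑ j ∈ range (2 * (M + L) + 1),
        (-1) ^ j * Real.log (r j ^ ω + t l ^ ω)) =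
      ∑ j ∈ range (2 * (M + L) + 1), ((-1) ^ j * r j + ((-1) ^ j * e + (ω - 1 / 2)) *
        Real.log (r j) - (-1) ^ j * screening ω t (r j)) + ∑ l, (-t l + c * Real.log (t l)) := by
    rw [Fin.sum_univ_eq_sum_range (fun j => (-1) ^ j * r j +
      ((-1) ^ j * e + (ω - 1 / 2)) * Real.log (r j))]
    simp only [sum_sub_distrib, screening, mul_sum]
    rw [sum_comm]
    have : ∀ j, ∑ l, 2 * ((-1) ^ j * Real.log (r j ^ ω + t l ^ ω)) =
      ∑ l, (-1) ^ j * (2 * Real.log (r j ^ ω + t l ^ ω)) := fun j =>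
      sum_congr rfl fun l _ => by ring
    simp only [this]
    ring
  have h2 : ∑ j ∈ range (2 * (M + L) + 1), ((-1) ^ j * r j + ((-1) ^ j * e + (ω - 1 / 2)) *
      Real.log (r j) - (-1) ^ j * screening ω t (r j)) =
      ∑ i ∈ range M, (evenPotential ω d t (r (2 * i)) + oddPotential ω c t (r (2 * i + 1))) +
      evenPotential ω d t (r (2 * M)) +
      ∑ i ∈ range L, (oddPotential ω c t (r (2 * (M + i) + 1)) +
        evenPotential ω d t (r (2 * (M + i) + 2))) := by
    have he : ∀ j, Even j → (-1) ^ j * r j + ((-1) ^ j * e + (ω - 1 / 2)) *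
        Real.log (r j) - (-1) ^ j * screening ω t (r j) = evenPotential ω d t (r j) := by
      intro j hj
      rw [hj.neg_one_pow, evenPotential, hd]
      ring
    have ho : ∀ j, Odd j → (-1) ^ j * r j + ((-1) ^ j * e + (ω - 1 / 2)) *
        Real.log (r j) - (-1) ^ j * screening ω t (r j) = oddPotential ω c t (r j) := by
      intro j hj
      rw [hj.neg_one_pow, oddPotential, hc]
      ring
    rw [AltSum.sum_eq_pairs]
    congr 1
    · congr 1
      · refine sum_congr rfl fun i _ => ?_
        rw [he _ (even_two_mul i), ho _ ⟨i, rfl⟩]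
      · exact he _ (even_two_mul M)
    · refine sum_congr rfl fun i _ => ?_
      rw [he _ ⟨M + i + 1, by ring⟩, ho _ ⟨M + i, rfl⟩]
      try ring
  have h3 : c * Real.log (t 0) - (m + 1) * T ≤ ∑ l, (-t l + c * Real.log (t l)) := by
    rw [sum_add_distrib, ← mul_sum, Fin.sum_univ_succ (fun l => Real.log (t l))]
    have h4 : 0 ≤ ∑ l : Fin m, Real.log (t l.succ) := sum_nonneg fun l _ =>
      Real.log_nonneg (by linarith [hsep _ _ (Fin.succ_pos l)])
    have h5 : ∑ l, -T ≤ ∑ l, -t l := sum_le_sum fun l _ => neg_le_neg (hT l)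
    simp only [sum_const, card_univ, Fintype.card_fin, nsmul_eq_mul] at h5
    push_cast at h5
    nlinarith [mul_nonneg hc0 h4]
  have h6 : 0 ≤ ∑ l, ∑ l', Real.log (t l ^ ω - t l' ^ ω) := by
    refine sum_nonneg fun i _ => sum_nonneg fun l _ => ?_
    rcases lt_trichotomy i l with h | rfl | h
    · rw [← Real.log_neg_eq_log, neg_sub]
      exact log_pow_sub_pow_nonneg hω (htp i).le (hsep _ _ h)
    · simp
    · exact log_pow_sub_pow_nonneg hω (htp l).le (hsep _ _ h)
  have h7 := AltSum.matching_le_pairEnergy hA M L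
  rw [energy_elim hc (A := fun j => r j ^ ω) (fun j => rfl)]
  simp only [sum_sub_distrib, ← mul_sum] at h7 h1 h2 ⊢
  linarith

end LogGas

namespace LogGas
open Finset

variable {m : ℕ} {ω : ℕ} {t : Fin (m + 1) → ℝ}

theorem screening_mono (ht : ∀ l, 0 < t l) {p q : ℝ} (hp : 0 < p) (hpq : p ≤ q) :
    screening ω t p ≤ screening ω t q := by
  have := ht
  unfold screening
  gcongr with l
  have := ht l
  positivity

theorem screening_sub_le (ht : ∀ l, 0 < t l) {p q : ℝ} (hp : 0 < p) (hpq : p ≤ q) :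
    screening ω t q - screening ω t p ≤ 2 * (m + 1) * ω * (Real.log q - Real.log p) := by
  have hq : 0 < q := hp.trans_le hpq
  have h : ∀ l, Real.log (q ^ ω + t l ^ ω) - Real.log (p ^ ω + t l ^ ω) ≤
      ω * (Real.log q - Real.log p) := by
    intro l
    have h1 := ht l
    rw [mul_sub, ← Real.log_pow, ← Real.log_pow, sub_le_sub_iff,
      ← Real.log_mul (by positivity) (by positivity),
      ← Real.log_mul (by positivity) (by positivity)]
    refine Real.log_le_log (by positivity) ?_
    have h2 : p ^ ω ≤ q ^ ω := by gcongr
    have h3 : 0 < t l ^ ω := by positivity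
    nlinarith
  have h2 := sum_le_sum fun l (_ : l ∈ univ) => h l
  simp only [sum_sub_distrib, sum_const, card_univ, Fintype.card_fin, nsmul_eq_mul] at h2
  push_cast at h2
  unfold screening
  linarith

theorem log_pow_add_pow_le {x y T : ℝ} (hx : 0 < x) (hy : 0 < y) (hyT : y ≤ T) (hω : ω ≠ 0) :
    Real.log (x ^ ω + y ^ ω) ≤ ω * (Real.log (1 + x) + Real.log (1 + T)) := by
  have hT : 0 < T := hy.trans_le hyT
  rw [mul_add, ← Real.log_pow, ← Real.log_pow, ← Real.log_mul (by positivity) (by positivity)]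
  refine Real.log_le_log (by positivity) ?_
  rw [← mul_pow]
  calc x ^ ω + y ^ ω ≤ (x + y) ^ ω := pow_add_pow_le hx.le hy.le hω
    _ ≤ ((1 + x) * (1 + T)) ^ ω := by
      gcongr
      nlinarith

theorem screening_le (hω : ω ≠ 0) (ht : ∀ l, 0 < t l) {T : ℝ} (hT : ∀ l, t l ≤ T) {x : ℝ}
    (hx : 0 < x) :
    screening ω t x ≤ 2 * (m + 1) * ω * (Real.log (1 + x) + Real.log (1 + T)) := by
  have h2 := sum_le_sum fun l (_ : l ∈ univ) => log_pow_add_pow_le hx (ht l) (hT l) hω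
  simp only [sum_const, card_univ, Fintype.card_fin, nsmul_eq_mul] at h2
  push_cast at h2
  unfold screening
  linarith

theorem log_pow_add_pow_le_of_le {x y : ℝ} (hω : ω = 1 ∨ ω = 2) (hx : 0 < x) (hy : 0 < y)
    (hyx : y ≤ 2 * x) : Real.log (x ^ ω + y ^ ω) ≤ ω * Real.log x + Real.log 5 := by
  rw [← Real.log_pow, ← Real.log_mul (by positivity) (by positivity)]
  refine Real.log_le_log (by positivity) ?_
  rcases hω with rfl | rfl <;> nlinarith

theorem le_screening_sub (hω : ω = 1 ∨ ω = 2) (ht : ∀ l, 0 < t l) {p q : ℝ} (hp : 0 < p)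
    (hpq : p ≤ q) (h0 : t 0 ≤ 2 * p) :
    2 * ω * (Real.log q - Real.log p) - 2 * Real.log 5 ≤ screening ω t q - screening ω t p := by
  have hq : 0 < q := hp.trans_le hpq
  have h1 := log_pow_add_pow_le_of_le hω hp (ht 0) h0
  have h2 : ω * Real.log q ≤ Real.log (q ^ ω + t 0 ^ ω) := by
    rw [← Real.log_pow]
    exact Real.log_le_log (by positivity) (by have := pow_pos (ht 0) ω; linarith)
  have h3 : ∑ l : Fin m, Real.log (p ^ ω + t l.succ ^ ω) ≤
      ∑ l : Fin m, Real.log (q ^ ω + t l.succ ^ ω) := by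
    gcongr with l
    have := ht l.succ
    positivity
  simp only [screening, Fin.sum_univ_succ]
  linarith

theorem screening_le_of_le (hω : ω = 1 ∨ ω = 2) (ht : ∀ l, 0 < t l) {T : ℝ} (hT : ∀ l, t l ≤ T)
    {x : ℝ} (hx : 0 < x) (h0 : t 0 ≤ 2 * x) :
    screening ω t x ≤ 2 * ω * Real.log x + 2 * Real.log 5 +
      2 * m * ω * (Real.log (1 + x) + Real.log (1 + T)) := by
  have h1 := log_pow_add_pow_le_of_le hω hx (ht 0) h0
  have h2 := sum_le_sum fun (l : Fin m) (_ : l ∈ univ) =>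
    log_pow_add_pow_le hx (ht l.succ) (hT l.succ) (show ω ≠ 0 by omega)
  simp only [sum_const, card_univ, Fintype.card_fin, nsmul_eq_mul] at h2
  simp only [screening, Fin.sum_univ_succ]
  linarith

variable {c d k r₀ : ℝ}

theorem le_dipole_of_lt_one
    (H : (ω = 1 ∧ c = 3 / 2 ∧ d = -1 / 2 ∧ k = 0) ∨
      ((ω = 1 ∨ ω = 2) ∧ c = 1 / 2 ∧ d = 2 * ω - 3 / 2 ∧ k = 1 / 2 ∧ t 0 ≤ 2 * r₀))
    (ht : ∀ l, 0 < t l) {p q : ℝ} (hr₀ : 0 < r₀) (hp : r₀ ≤ p) (hpq : p < q) (hq : q < 1) :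
    -((1 / 2 + k) * Real.log p) - (1 + 2 * Real.log 5) ≤
      evenPotential ω d t p + oddPotential ω c t q - 2 * Real.log (q ^ ω - p ^ ω) := by
  have hp0 : 0 < p := hr₀.trans_le hp
  have hq0 : 0 < q := hp0.trans hpq
  have h5 : 0 ≤ Real.log 5 := Real.log_nonneg (by norm_num)
  have hlq : Real.log q < 0 := Real.log_neg hq0 hq
  have hlpq : Real.log p < Real.log q := Real.log_lt_log hp0 hpq
  have hω : ω ≠ 0 := by rcases H with H | H <;> omega
  have h1 : Real.log (q ^ ω - p ^ ω) ≤ ω * Real.log q := by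
    rw [← Real.log_pow]
    exact Real.log_le_log (sub_pos.2 (pow_lt_pow_left₀ hpq hp0.le hω))
      (by have := pow_pos hp0 ω; linarith)
  unfold evenPotential oddPotential
  rcases H with ⟨rfl, rfl, rfl, rfl⟩ | ⟨hω', rfl, rfl, rfl, h0⟩
  · have := screening_mono (ω := 1) ht hp0 hpq.le
    push_cast at h1
    linarith
  · have := le_screening_sub hω' ht hp0 hpq.le (by linarith)
    nlinarith

theorem le_evenPotential
    (H : (ω = 1 ∧ c = 3 / 2 ∧ d = -1 / 2 ∧ k = 0) ∨
      ((ω = 1 ∨ ω = 2) ∧ c = 1 / 2 ∧ d = 2 * ω - 3 / 2 ∧ k = 1 / 2 ∧ t 0 ≤ 2 * r₀))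
    (ht : ∀ l, 0 < t l) {T : ℝ} (hT : ∀ l, t l ≤ T) {x : ℝ} (hr₀ : 0 < r₀) (hx : r₀ ≤ x) :
    x - (1 / 2 + k) * Real.log x - (2 * (m + 1) * ω + 3) * (Real.log (1 + x) + Real.log (1 + T)) -
      2 * Real.log 5 ≤ evenPotential ω d t x := by
  have hx0 : 0 < x := hr₀.trans_le hx
  have h5 : 0 ≤ Real.log 5 := Real.log_nonneg (by norm_num)
  have hω : ω ≠ 0 := by rcases H with H | H <;> omega
  have hlx : Real.log x ≤ Real.log (1 + x) := Real.log_le_log hx0 (by linarith)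
  have hx1 : 0 ≤ Real.log (1 + x) := Real.log_nonneg (by linarith)
  have hT1 : 0 ≤ Real.log (1 + T) := Real.log_nonneg (by linarith [ht 0, hT 0])
  unfold evenPotential
  rcases H with ⟨rfl, rfl, rfl, rfl⟩ | ⟨hω', rfl, rfl, rfl, h0⟩
  · have := screening_le one_ne_zero ht hT hx0
    push_cast at this ⊢
    nlinarith
  · have := screening_le_of_le hω' ht hT hx0 (by linarith)
    have h6 : 0 ≤ ω * (Real.log (1 + x) + Real.log (1 + T)) := by positivity
    nlinarith

theorem le_dipole_of_one_le
    (H : (ω = 1 ∧ c = 3 / 2 ∧ d = -1 / 2 ∧ k = 0) ∨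
      ((ω = 1 ∨ ω = 2) ∧ c = 1 / 2 ∧ d = 2 * ω - 3 / 2 ∧ k = 1 / 2 ∧ t 0 ≤ 2 * r₀))
    (ht : ∀ l, 0 < t l) {p q : ℝ} (hp : 1 ≤ p) (hpq : p < q) :
    Real.log p + (q - p) - (2 * (m + 1) * ω + 3) * Real.log (1 + (q - p)) - 2 * Real.log 2 ≤
      oddPotential ω c t p + evenPotential ω d t q - 2 * Real.log (q ^ ω - p ^ ω) := by
  have hp0 : 0 < p := by linarith
  have hq0 : 0 < q := by linarith
  have h2 : 0 ≤ Real.log 2 := Real.log_nonneg (by norm_num)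
  have hδ : Real.log (q - p) ≤ Real.log (1 + (q - p)) :=
    Real.log_le_log (by linarith) (by linarith)
  have hδ0 : 0 ≤ Real.log (1 + (q - p)) := Real.log_nonneg (by linarith)
  have hlpq : Real.log p ≤ Real.log q := Real.log_le_log hp0 hpq.le
  have hratio : Real.log q ≤ Real.log p + Real.log (1 + (q - p)) := by
    rw [← Real.log_mul hp0.ne' (by linarith)]
    exact Real.log_le_log hq0 (by nlinarith)
  have hW := screening_sub_le (ω := ω) ht hp0 hpq.le
  have hW' : 2 * (m + 1) * ω * (Real.log q - Real.log p) ≤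
      2 * (m + 1) * ω * Real.log (1 + (q - p)) :=
    mul_le_mul_of_nonneg_left (by linarith) (by positivity)
  unfold evenPotential oddPotential
  rcases H with ⟨rfl, rfl, rfl, rfl⟩ | ⟨rfl | rfl, rfl, rfl, rfl, h0⟩
  · rw [pow_one, pow_one]
    push_cast at *
    linarith
  · rw [pow_one, pow_one]
    push_cast at *
    linarith
  · have h3 : Real.log (q ^ 2 - p ^ 2) ≤ Real.log (q - p) + (Real.log 2 + Real.log q) := by
      rw [← Real.log_mul (by norm_num) hq0.ne', ← Real.log_mul (by linarith) (by positivity)]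
      exact Real.log_le_log (by nlinarith) (by nlinarith)
    push_cast at *
    linarith

end LogGas

namespace LogGas
open Finset

theorem exists_threshold {r : ℕ → ℝ} (hr : Monotone r) (N : ℕ) :
    ∃ M L, N = M + L ∧ (∀ i < M, r (2 * i + 1) < 1) ∧ ∀ i < L, 1 ≤ r (2 * (M + i) + 1) := by
  classical
  have h : ∃ i, N ≤ i ∨ 1 ≤ r (2 * i + 1) := ⟨N, Or.inl le_rfl⟩
  refine ⟨Nat.find h, N - Nat.find h,
    (Nat.add_sub_of_le (Nat.find_min' h (Or.inl le_rfl))).symm, fun i hi => ?_, fun i hi => ?_⟩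
  · have := Nat.find_min h hi
    push Not at this
    exact this.2
  · rcases Nat.find_spec h with h1 | h1
    · omega
    · exact h1.trans (hr (by omega))

variable {m ω : ℕ} {c d e k : ℝ}

theorem exists_le_energy (N : ℕ) (hc : c = ω - 1 / 2 - e) (hd : d = ω - 1 / 2 + e) (T D : ℝ) :
    ∃ C, ∀ (r : ℕ → ℝ) (t : Fin (m + 1) → ℝ), StrictMono r → 0 < r 0 → 0 < t 0 →
      (∀ l, t l ≤ T) → (∀ i l, l < i → t l + 1 ≤ t i) →
      ((ω = 1 ∧ c = 3 / 2 ∧ d = -1 / 2 ∧ k = 0) ∨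
        ((ω = 1 ∨ ω = 2) ∧ c = 1 / 2 ∧ d = 2 * ω - 3 / 2 ∧ k = 1 / 2 ∧ t 0 ≤ 2 * r 0)) →
      k * Real.log (r 0) - k * Real.log (1 + r 0) - D ≤ c * Real.log (t 0) →
      ∃ M L, N = M + L ∧ (∀ i < L, 1 ≤ r (2 * (M + i) + 1)) ∧
        -(1 / 2 * Real.log (r 0)) + r (2 * M) / 2 + ∑ i ∈ range L,
          (Real.log (r (2 * (M + i) + 1)) +
            (r (2 * (M + i) + 2) - r (2 * (M + i) + 1)) / 2) - C ≤
        energy (chargeSign (2 * N + 1) (m + 1)) (powSign (2 * N + 1) (m + 1)) ω e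
          (Sum.elim (fun j => r j) t) := by
  obtain ⟨B, hB0, hB⟩ := exists_mul_log_one_add_le ((2 * (m + 1) * ω + 3 : ℝ) + 1)
    (show (0 : ℝ) < 1 / 2 by norm_num)
  refine ⟨D + (m + 1) * T + N * (1 + 2 * Real.log 5) + (B + (2 * (m + 1) * ω + 3) *
    Real.log (1 + T) + 2 * Real.log 5) + 1 + N * (B + 2 * Real.log 2), ?_⟩
  intro r t hr hr0 ht0 hT hsep H hk
  obtain ⟨M, L, rfl, hM, hL⟩ := exists_threshold hr.monotone N
  refine ⟨M, L, rfl, hL, ?_⟩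
  have hω : ω ≠ 0 := by rcases H with H | H <;> omega
  have hc0 : 0 ≤ c := by rcases H with ⟨-, rfl, -⟩ | ⟨-, rfl, -⟩ <;> norm_num
  have hk0 : 0 ≤ k := by rcases H with ⟨-, -, -, rfl⟩ | ⟨-, -, -, rfl, -⟩ <;> norm_num
  have hk1 : k ≤ 1 / 2 := by rcases H with ⟨-, -, -, rfl⟩ | ⟨-, -, -, rfl, -⟩ <;> norm_num
  have hrp : ∀ j, 0 < r j := fun j => hr0.trans_le (hr.monotone (Nat.zero_le j))
  have htp : ∀ l, 0 < t l := by
    refine Fin.cases ht0 fun l => ?_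
    linarith [hsep _ _ (Fin.succ_pos l)]
  have h5 : 0 ≤ Real.log 5 := Real.log_nonneg (by norm_num)
  have h2 : 0 ≤ Real.log 2 := Real.log_nonneg (by norm_num)
  have key := pairs_le_energy (M := M) (L := L) hω hc hd hc0 hr hr0 ht0 hT hsep
  have hneg : ∀ i < M, -((1 / 2 + k) * Real.log (r (2 * i))) - (1 + 2 * Real.log 5) ≤
      evenPotential ω d t (r (2 * i)) + oddPotential ω c t (r (2 * i + 1)) -
        2 * Real.log (r (2 * i + 1) ^ ω - r (2 * i) ^ ω) := fun i hi =>
    le_dipole_of_lt_one H htp hr0 (hr.monotone (Nat.zero_le _)) (hr (Nat.lt_succ_self _)) (hM i hi)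
  have hpos : ∀ i < L, Real.log (r (2 * (M + i) + 1)) +
      (r (2 * (M + i) + 2) - r (2 * (M + i) + 1)) / 2 - (B + 2 * Real.log 2) ≤
      oddPotential ω c t (r (2 * (M + i) + 1)) +
        evenPotential ω d t (r (2 * (M + i) + 2)) -
        2 * Real.log (r (2 * (M + i) + 2) ^ ω - r (2 * (M + i) + 1) ^ ω) := by
    intro i hi
    have hlt : r (2 * (M + i) + 1) < r (2 * (M + i) + 2) := hr (Nat.lt_succ_self _)
    have h1 := le_dipole_of_one_le H htp (hL i hi) hlt
    have h3 := hB _ (sub_nonneg.2 hlt.le)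
    have h4 : 0 ≤ Real.log (1 + (r (2 * (M + i) + 2) - r (2 * (M + i) + 1))) :=
      Real.log_nonneg (by linarith)
    linarith
  have hneg' := sum_le_sum fun i hi => hneg i (mem_range.1 hi)
  have hpos' := sum_le_sum fun i hi => hpos i (mem_range.1 hi)
  rw [sum_sub_distrib, sum_const, card_range, nsmul_eq_mul] at hneg' hpos'
  have heven := le_evenPotential H htp hT hr0 (hr.monotone (Nat.zero_le (2 * M)))
  have hlog : 0 ≤ Real.log (1 + r (2 * M)) := Real.log_nonneg (by linarith [hrp (2 * M)])
  have hlog' : Real.log (r (2 * M)) ≤ Real.log (1 + r (2 * M)) :=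
    Real.log_le_log (hrp _) (by linarith)
  have hBM := hB _ (hrp (2 * M)).le
  have hML : 0 ≤ (L : ℝ) * (1 + 2 * Real.log 5) + M * (B + 2 * Real.log 2) := by positivity
  push_cast
  rcases Nat.eq_zero_or_pos M with rfl | hM0
  · have hk2 : k * Real.log (1 + r 0) ≤ 1 * Real.log (1 + r 0) :=
      mul_le_mul_of_nonneg_right (by linarith) (Real.log_nonneg (by linarith))
    simp only [mul_zero, sum_range_zero, Nat.cast_zero] at key heven hlog hlog' hBM hML ⊢
    linarith
  · have h6 : -((1 / 2 + k) * Real.log (r (2 * 0))) ≤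
        ∑ i ∈ range M, -((1 / 2 + k) * Real.log (r (2 * i))) := by
      refine single_le_sum (f := fun i => -((1 / 2 + k) * Real.log (r (2 * i)))) (fun i hi => ?_)
        (mem_range.2 hM0)
      have h7 : r (2 * i) < 1 := (hr (Nat.lt_succ_self _)).trans (hM i (mem_range.1 hi))
      have := Real.log_neg (hrp _) h7
      nlinarith
    rw [mul_zero] at h6
    have h8 : r 0 < 1 := (hr (by omega)).trans (hM 0 hM0)
    have h9 : Real.log (1 + r 0) ≤ 1 :=
      (Real.log_le_sub_one_of_pos (by linarith)).trans (by linarith)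
    have h10 : k * Real.log (1 + r 0) ≤ 1 := by nlinarith
    have h11 : (1 / 2 + k) * Real.log (r (2 * M)) ≤ 1 * Real.log (1 + r (2 * M)) :=
      (mul_le_mul_of_nonneg_left hlog' (by linarith)).trans
        (mul_le_mul_of_nonneg_right (by linarith) hlog)
    linarith

/-- A bound on the energy confines the radii of the first family. -/
theorem exists_bounds_of_energy_le (N : ℕ) (hc : c = ω - 1 / 2 - e) (hd : d = ω - 1 / 2 + e)
    (T D C : ℝ) :
    ∃ lo > 0, ∃ hi, ∀ (r : ℕ → ℝ) (t : Fin (m + 1) → ℝ), StrictMono r → 0 < r 0 → 0 < t 0 →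
      (∀ l, t l ≤ T) → (∀ i l, l < i → t l + 1 ≤ t i) →
      ((ω = 1 ∧ c = 3 / 2 ∧ d = -1 / 2 ∧ k = 0) ∨
        ((ω = 1 ∨ ω = 2) ∧ c = 1 / 2 ∧ d = 2 * ω - 3 / 2 ∧ k = 1 / 2 ∧ t 0 ≤ 2 * r 0)) →
      k * Real.log (r 0) - k * Real.log (1 + r 0) - D ≤ c * Real.log (t 0) →
      energy (chargeSign (2 * N + 1) (m + 1)) (powSign (2 * N + 1) (m + 1)) ω e
          (Sum.elim (fun j => r j) t) ≤ C → lo ≤ r 0 ∧ r (2 * N) ≤ hi := by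
  obtain ⟨C₁, h⟩ := exists_le_energy (m := m) (k := k) N hc hd T D
  refine ⟨Real.exp (-(2 * (C + C₁))), Real.exp_pos _, Real.exp (C + C₁) + 4 * (C + C₁), ?_⟩
  intro r t hr hr0 ht0 hT hsep H hk hE
  obtain ⟨M, L, rfl, hL, hle⟩ := h r t hr hr0 ht0 hT hsep H hk
  have hrp : ∀ j, 0 < r j := fun j => hr0.trans_le (hr.monotone (Nat.zero_le j))
  have hlog : ∀ x : ℝ, 0 < x → Real.log x ≤ x / 2 := by
    intro x hx
    have h1 := Real.log_le_sub_one_of_pos (show 0 < x / 2 by linarith)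
    have h2 := Real.log_le_sub_one_of_pos (show (0 : ℝ) < 2 by norm_num)
    rw [Real.log_div hx.ne' (by norm_num)] at h1
    linarith
  have h0M : Real.log (r 0) ≤ Real.log (r (2 * M)) :=
    Real.log_le_log hr0 (hr.monotone (Nat.zero_le _))
  have hlM := hlog _ (hrp (2 * M))
  have hterm : ∀ i < L, 0 ≤ Real.log (r (2 * (M + i) + 1)) ∧
      0 ≤ r (2 * (M + i) + 2) - r (2 * (M + i) + 1) := fun i hi =>
    ⟨Real.log_nonneg (hL i hi), sub_nonneg.2 (hr.monotone (Nat.le_succ _))⟩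
  have hnn : ∀ i ∈ range L, 0 ≤ Real.log (r (2 * (M + i) + 1)) +
      (r (2 * (M + i) + 2) - r (2 * (M + i) + 1)) / 2 := fun i hi => by
    have := hterm i (mem_range.1 hi)
    linarith
  have hsum := sum_nonneg hnn
  constructor
  · rw [← Real.le_log_iff_exp_le hr0]
    linarith [hrp (2 * M)]
  · rcases L with _ | L
    · have := Real.exp_pos (C + C₁)
      simp only [add_zero]
      linarith
    · have h1 := single_le_sum hnn (mem_range.2 (Nat.lt_succ_self L))
      have h2 := hterm L (Nat.lt_succ_self L)
      have h3 : r (2 * (M + L) + 1) ≤ Real.exp (C + C₁) := by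
        rw [← Real.log_le_iff_le_exp (hrp _)]
        linarith [hrp (2 * M)]
      have h4 : 2 * (M + (L + 1)) = 2 * (M + L) + 2 := by ring
      rw [h4]
      linarith [hrp (2 * M)]

end LogGas

namespace LogGas
open Finset

variable {m ω : ℕ} {c d e : ℝ}

theorem abs_log_le_log {x R : ℝ} (hR : 1 ≤ R) (hx : R⁻¹ ≤ x) (hxR : x ≤ R) :
    |Real.log x| ≤ Real.log R := by
  have hR0 : 0 < R := by linarith
  have hx0 : 0 < x := (inv_pos.2 hR0).trans_le hx
  refine abs_le.2 ⟨?_, Real.log_le_log hx0 hxR⟩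
  rw [← Real.log_inv]
  exact Real.log_le_log (by positivity) hx

theorem abs_screening_le (hω : ω ≠ 0) {t : Fin (m + 1) → ℝ} (ht : ∀ l, 0 < t l) {x R : ℝ}
    (hR : 1 ≤ R) (hT : ∀ l, t l ≤ R) (hx : R⁻¹ ≤ x) (hxR : x ≤ R) :
    |screening ω t x| ≤ 2 * (m + 1) * (ω * Real.log (2 * R)) := by
  have hR0 : 0 < R := by linarith
  have hx0 : 0 < x := (inv_pos.2 hR0).trans_le hx
  have h : ∀ l, |Real.log (x ^ ω + t l ^ ω)| ≤ ω * Real.log (2 * R) := by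
    intro l
    have h1 := pow_pos (ht l) ω
    rw [← Real.log_pow]
    refine abs_log_le_log (one_le_pow₀ (by linarith)) ?_ ?_
    · rw [← inv_pow]
      have : ((2 * R)⁻¹) ^ ω ≤ x ^ ω := by
        refine pow_le_pow_left₀ (by positivity) (le_trans ?_ hx) ω
        exact inv_anti₀ hR0 (by linarith)
      linarith
    · refine (pow_add_pow_le hx0.le (ht l).le hω).trans ?_
      exact pow_le_pow_left₀ (by linarith [ht l]) (by linarith [hT l]) ω
  have h2 := (abs_sum_le_sum_abs (fun l => Real.log (x ^ ω + t l ^ ω)) univ).trans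
    (sum_le_sum fun l _ => h l)
  simp only [sum_const, card_univ, Fintype.card_fin, nsmul_eq_mul] at h2
  push_cast at h2
  rw [screening, abs_mul, abs_two]
  linarith

theorem neg_le_potentials (hω : ω ≠ 0) {t : Fin (m + 1) → ℝ} (ht : ∀ l, 0 < t l) {x R : ℝ}
    (hR : 1 ≤ R) (hT : ∀ l, t l ≤ R) (hx : R⁻¹ ≤ x) (hxR : x ≤ R) :
    -(R + (|c| + |d|) * Real.log R + 2 * (m + 1) * (ω * Real.log (2 * R))) ≤
        evenPotential ω d t x ∧
      -(R + (|c| + |d|) * Real.log R + 2 * (m + 1) * (ω * Real.log (2 * R))) ≤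
        oddPotential ω c t x := by
  have h1 := abs_le.1 (abs_screening_le hω ht hR hT hx hxR)
  have hlog : ∀ b : ℝ, |b * Real.log x| ≤ |b| * Real.log R := fun b => by
    rw [abs_mul]
    exact mul_le_mul_of_nonneg_left (abs_log_le_log hR hx hxR) (abs_nonneg b)
  have h2 := abs_le.1 (hlog c)
  have h3 := abs_le.1 (hlog d)
  have h4 : 0 ≤ |c| * Real.log R := mul_nonneg (abs_nonneg _) (Real.log_nonneg hR)
  have h5 : 0 ≤ |d| * Real.log R := mul_nonneg (abs_nonneg _) (Real.log_nonneg hR)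
  have h6 : 0 < x := (inv_pos.2 (by linarith)).trans_le hx
  unfold evenPotential oddPotential
  constructor <;> linarith

/-- A bound on the energy separates the radii of the first family. -/
theorem exists_gap_of_energy_le (N : ℕ) (hω : ω ≠ 0) (hc : c = ω - 1 / 2 - e)
    (hd : d = ω - 1 / 2 + e) (hc0 : 0 ≤ c) {R : ℝ} (hR : 1 ≤ R) (D C : ℝ) :
    ∃ γ > 0, ∀ (r : ℕ → ℝ) (t : Fin (m + 1) → ℝ), StrictMono r → R⁻¹ ≤ r 0 → r (2 * N) ≤ R →
      0 < t 0 → (∀ l, t l ≤ R) → (∀ i l, l < i → t l + 1 ≤ t i) → -D ≤ c * Real.log (t 0) →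
      energy (chargeSign (2 * N + 1) (m + 1)) (powSign (2 * N + 1) (m + 1)) ω e
          (Sum.elim (fun j => r j) t) ≤ C → ∀ j < 2 * N, r j ^ ω + γ ≤ r (j + 1) ^ ω := by
  set B : ℝ := R + (|c| + |d|) * Real.log R + 2 * (m + 1) * (ω * Real.log (2 * R)) with hB
  set P : ℝ := 2 * B + 2 * (ω * Real.log R) with hP
  set G : ℝ := C + D + (m + 1) * R + 3 * B + N * P with hG
  refine ⟨Real.exp (-(G / 2)), Real.exp_pos _, ?_⟩
  intro r t hr hr0R hrN ht0 hT hsep hD hE j hj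
  have hr0 : 0 < r 0 := (inv_pos.2 (by linarith)).trans_le hr0R
  have htp : ∀ l, 0 < t l := by
    refine Fin.cases ht0 fun l => ?_
    linarith [hsep _ _ (Fin.succ_pos l)]
  have hrp : ∀ j, 0 < r j := fun j => hr0.trans_le (hr.monotone (Nat.zero_le j))
  have hV : ∀ i ≤ 2 * N, -B ≤ evenPotential ω d t (r i) ∧ -B ≤ oddPotential ω c t (r i) :=
    fun i hi => neg_le_potentials hω htp hR hT (hr0R.trans (hr.monotone (Nat.zero_le i)))
      ((hr.monotone hi).trans hrN)
  have hlogR : 0 ≤ ω * Real.log R := mul_nonneg (by positivity) (Real.log_nonneg hR)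
  have hP0 : 0 ≤ P := by
    have : 0 ≤ Real.log (2 * R) := Real.log_nonneg (by linarith)
    have := Real.log_nonneg hR
    positivity
  have hgap : ∀ i, 0 < r (i + 1) ^ ω - r i ^ ω := fun i =>
    sub_pos.2 (pow_lt_pow_left₀ (hr (Nat.lt_succ_self i)) (hrp i).le hω)
  have hlog : ∀ i < 2 * N, Real.log (r (i + 1) ^ ω - r i ^ ω) ≤ ω * Real.log R := by
    intro i hi
    rw [← Real.log_pow]
    refine Real.log_le_log (hgap i) ?_
    have h1 : r (i + 1) ^ ω ≤ R ^ ω :=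
      pow_le_pow_left₀ (hrp _).le ((hr.monotone (by omega)).trans hrN) ω
    have h2 := pow_pos (hrp i) ω
    linarith
  suffices h : -2 * Real.log (r (j + 1) ^ ω - r j ^ ω) ≤ G by
    have h1 : Real.exp (-(G / 2)) ≤ r (j + 1) ^ ω - r j ^ ω := by
      rw [← Real.le_log_iff_exp_le (hgap j)]
      linarith
    linarith
  have hpick : ∀ f : ℕ → ℝ, (∀ i < N, -P ≤ f i) → ∀ i < N, f i - N * P ≤ ∑ i ∈ range N, f i := by
    intro f hf i hi
    have h1 := single_le_sum (f := fun i => f i + P) (fun i hi => by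
      have := hf i (mem_range.1 hi)
      linarith) (mem_range.2 hi)
    simp only [sum_add_distrib, sum_const, card_range, nsmul_eq_mul] at h1
    linarith
  obtain ⟨i, rfl | rfl⟩ := Nat.even_or_odd' j
  · have key := pairs_le_energy (M := N) (L := 0) hω hc hd hc0 hr hr0 ht0 hT hsep
    have h1 := hpick (fun i => evenPotential ω d t (r (2 * i)) + oddPotential ω c t (r (2 * i + 1)) -
        2 * Real.log (r (2 * i + 1) ^ ω - r (2 * i) ^ ω)) (fun i hi => by
      have h2 := hV (2 * i) (by omega)
      have h3 := hV (2 * i + 1) (by omega)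
      have h4 := hlog (2 * i) (by omega)
      linarith) i (by omega)
    have h2 := hV (2 * i) (by omega)
    have h3 := hV (2 * i + 1) (by omega)
    have h5 := hV (2 * N) le_rfl
    rw [sum_range_zero, add_zero] at key
    have h6 := key.trans hE
    linarith
  · have key := pairs_le_energy (M := 0) (L := N) hω hc hd hc0 hr hr0 ht0 hT hsep
    have h1 := hpick (fun i => oddPotential ω c t (r (2 * (0 + i) + 1)) +
        evenPotential ω d t (r (2 * (0 + i) + 2)) -
        2 * Real.log (r (2 * (0 + i) + 2) ^ ω - r (2 * (0 + i) + 1) ^ ω)) (fun i hi => by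
      have h2 := hV (2 * i + 1) (by omega)
      have h3 := hV (2 * i + 2) (by omega)
      have h4 := hlog (2 * i + 1) (by omega)
      rw [zero_add]
      linarith) i (by omega)
    have h2 := hV (2 * i + 1) (by omega)
    have h3 := hV (2 * i + 2) (by omega)
    have h5 := hV 0 (by omega)
    rw [zero_add N, sum_range_zero, mul_zero] at key
    have h6 := key.trans hE
    simp only [zero_add] at h1 h6
    linarith

end LogGas

namespace LogGas
open Finset

/-- The three regimes in which the min-max argument is run, with the slaving function of the first
orbit of the second family in each of them. -/
def IsRegime (ω : ℕ) (e : ℝ) (h : ℝ → ℝ) : Prop :=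
  (ω = 1 ∧ e = -1 ∧ h = fun _ => 1) ∨
    ((ω = 1 ∧ e = 0 ∨ ω = 2 ∧ e = 1) ∧ h = fun x => x / (1 + |x|))

variable {m ω : ℕ} {e : ℝ} {h : ℝ → ℝ}

theorem IsRegime.exists_le_log (H : IsRegime ω e h) {s₁ s₂ : ℝ} (hs₂ : Real.exp s₂ ≤ 2) :
    ∃ k D : ℝ, 0 ≤ k ∧ ∀ x > 0, ∀ s ∈ Set.Icc s₁ s₂, Real.exp s * h x ≤ 2 ∧
      ((ω = 1 ∧ ω - 1 / 2 - e = 3 / 2 ∧ ω - 1 / 2 + e = -1 / 2 ∧ k = 0) ∨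
        ((ω = 1 ∨ ω = 2) ∧ ω - 1 / 2 - e = 1 / 2 ∧ ω - 1 / 2 + e = 2 * ω - 3 / 2 ∧ k = 1 / 2 ∧
          Real.exp s * h x ≤ 2 * x)) ∧
      k * Real.log x - k * Real.log (1 + x) - D ≤
        (ω - 1 / 2 - e) * Real.log (Real.exp s * h x) := by
  rcases H with ⟨rfl, rfl, rfl⟩ | ⟨H, rfl⟩
  · refine ⟨0, -(3 / 2 * s₁), le_rfl, fun x hx s hs => ⟨?_, Or.inl (by norm_num), ?_⟩⟩
    · rw [mul_one]
      exact (Real.exp_le_exp.2 hs.2).trans hs₂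
    · rw [mul_one, Real.log_exp]
      push_cast
      linarith [hs.1]
  · have hc : (ω : ℝ) - 1 / 2 - e = 1 / 2 := by
      rcases H with ⟨rfl, rfl⟩ | ⟨rfl, rfl⟩ <;> norm_num
    refine ⟨1 / 2, -(1 / 2 * s₁), by norm_num, fun x hx s hs => ?_⟩
    have hexp : Real.exp s ≤ 2 := (Real.exp_le_exp.2 hs.2).trans hs₂
    have h1 : x / (1 + x) ≤ 1 := (div_le_one (by linarith)).2 (by linarith)
    have h2 : x / (1 + x) ≤ x := div_le_self hx.le (by linarith)
    have h3 : 0 < x / (1 + x) := by positivity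
    simp only [abs_of_pos hx]
    refine ⟨by nlinarith, Or.inr ⟨by omega, hc, ?_, trivial, by nlinarith⟩, ?_⟩
    · rcases H with ⟨rfl, rfl⟩ | ⟨rfl, rfl⟩ <;> norm_num
    · rw [hc, Real.log_mul (Real.exp_pos s).ne' h3.ne', Real.log_exp,
        Real.log_div hx.ne' (by linarith)]
      linarith [hs.1]

/-- A test configuration of the second family with unit separation. -/
theorem cons_three_add_separated {τ₀ : ℝ} (hτ : τ₀ ≤ 2) (i l : Fin (m + 1)) (hli : l < i) :
    (Fin.cons τ₀ (fun l : Fin m => 3 + (l : ℝ)) : Fin (m + 1) → ℝ) l + 1 ≤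
      (Fin.cons τ₀ (fun l : Fin m => 3 + (l : ℝ)) : Fin (m + 1) → ℝ) i := by
  cases i using Fin.cases with
  | zero => exact absurd hli (Fin.not_lt_zero l)
  | succ i =>
    cases l using Fin.cases with
    | zero =>
      simp only [Fin.cons_zero, Fin.cons_succ]
      linarith [(Nat.cast_nonneg i : (0 : ℝ) ≤ (i : ℕ))]
    | succ l =>
      have h1 : ((l : ℕ) : ℝ) + 1 ≤ (i : ℕ) := by
        exact_mod_cast Fin.succ_lt_succ_iff.1 hli
      simp only [Fin.cons_succ]
      linarith

theorem cons_three_add_le {τ₀ : ℝ} (hτ : τ₀ ≤ 2) (l : Fin (m + 1)) :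
    (Fin.cons τ₀ (fun l : Fin m => 3 + (l : ℝ)) : Fin (m + 1) → ℝ) l ≤ m + 3 := by
  cases l using Fin.cases with
  | zero =>
    simp only [Fin.cons_zero]
    linarith [(Nat.cast_nonneg m : (0 : ℝ) ≤ m)]
  | succ l =>
    have h1 : ((l : ℕ) : ℝ) ≤ m := by exact_mod_cast l.2.le
    simp only [Fin.cons_succ]
    linarith

theorem isCompact_separated (n ω : ℕ) (lo hi γ s₁ s₂ : ℝ) :
    IsCompact {x : (Fin (n + 1) → ℝ) × ℝ | x ∈ Set.Icc (fun _ => 0) (fun _ => hi) ×ˢ Set.Icc s₁ s₂ ∧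
      lo ≤ x.1 0 ∧ ∀ j : Fin n, x.1 j.castSucc ^ ω + γ ≤ x.1 j.succ ^ ω} := by
  refine (isCompact_Icc.prod isCompact_Icc).inter_right
    (IsClosed.and (isClosed_le (by fun_prop) (by fun_prop)) ?_)
  simp only [Set.ofPred_forall]
  exact isClosed_iInter fun j => isClosed_le (by fun_prop) (by fun_prop)

theorem exists_isCompact_of_paramEnergy_le {N : ℕ} (H : IsRegime ω e h)
    (hh0 : ∀ x, 0 < x → 0 < h x) {s₁ s₂ : ℝ} (hs₂ : Real.exp s₂ ≤ 2) (C : ℝ) :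
    ∃ K ⊆ {a : Fin (2 * N + 1) → ℝ | 0 < a 0 ∧ StrictMono a} ×ˢ (Set.univ : Set ℝ), IsCompact K ∧
      ∀ a ∈ {a : Fin (2 * N + 1) → ℝ | 0 < a 0 ∧ StrictMono a}, ∀ s ∈ Set.Icc s₁ s₂,
        (∀ y, ((a, s), y) ∈ admissible (2 * N) m h →
          paramEnergy (2 * N) m ω e h ((a, s), y) ≤ C) → (a, s) ∈ K := by
  have hω : ω ≠ 0 := by rcases H with H | ⟨H, -⟩ <;> omega
  have hc0 : 0 ≤ (ω : ℝ) - 1 / 2 - e := by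
    rcases H with ⟨rfl, rfl, -⟩ | ⟨⟨rfl, rfl⟩ | ⟨rfl, rfl⟩, -⟩ <;> norm_num
  obtain ⟨k, D, hk0, hk⟩ := H.exists_le_log (s₁ := s₁) hs₂
  obtain ⟨lo, hlo, hi, hb⟩ := exists_bounds_of_energy_le (m := m) (k := k) N
    (rfl : (ω : ℝ) - 1 / 2 - e = _) rfl (m + 3) D C
  set R : ℝ := max (max lo⁻¹ hi) (m + 3) with hR
  have hmR : (m : ℝ) + 3 ≤ R := le_max_right _ _
  have hloR : R⁻¹ ≤ lo := inv_le_of_inv_le₀ hlo ((le_max_left _ _).trans (le_max_left _ _))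
  have hhiR : hi ≤ R := (le_max_right _ _).trans (le_max_left _ _)
  have hR1 : 1 ≤ R := by linarith [(Nat.cast_nonneg m : (0 : ℝ) ≤ m)]
  obtain ⟨γ, hγ, hg⟩ := exists_gap_of_energy_le (m := m) N hω
    (rfl : (ω : ℝ) - 1 / 2 - e = _) rfl hc0 hR1
    (-(k * Real.log lo - k * Real.log (1 + hi) - D)) C
  refine ⟨_, ?_, isCompact_separated (2 * N) ω lo hi γ s₁ s₂, ?_⟩
  · rintro ⟨a, s⟩ ⟨⟨h1, -⟩, h2, h3⟩
    refine ⟨⟨hlo.trans_le h2, ?_⟩, trivial⟩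
    refine Fin.strictMono_iff_lt_succ.2 fun j => ?_
    refine lt_of_pow_lt_pow_left₀ ω (h1.1 _) ?_
    linarith [h3 j]
  · rintro a ⟨ha0, ha⟩ s hs hE
    obtain ⟨hτ, hcase, hle⟩ := hk _ ha0 s hs
    obtain ⟨r, hr, hra⟩ := ha.exists_extend_nat
    have hr0 : r 0 = a 0 := hra 0
    have hrl : r (2 * N) = a (Fin.last _) := hra (Fin.last _)
    have hfun : (fun j : Fin (2 * N + 1) => r j) = a := funext hra
    have hτ0 : 0 < Real.exp s * h (a 0) := mul_pos (Real.exp_pos s) (hh0 _ ha0)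
    have hsep := cons_three_add_separated (m := m) hτ
    have hT := cons_three_add_le (m := m) hτ
    have hadm : ((a, s), fun l : Fin m => 3 + (l : ℝ)) ∈ admissible (2 * N) m h :=
      ⟨ha0, ha, fun i l hil => by linarith [hsep l i hil]⟩
    have hE' := hE _ hadm
    rw [paramEnergy, radii, ← hfun] at hE'
    simp only [Fin.val_zero] at hE'
    rw [← hr0] at hτ0 hcase hle hT hsep
    obtain ⟨h1, h2⟩ := hb r _ hr (hr0 ▸ ha0) (by simpa using hτ0) hT hsep (by simpa using hcase)
      (by simpa using hle) hE'
    have hD : -(-(k * Real.log lo - k * Real.log (1 + hi) - D)) ≤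
        (ω - 1 / 2 - e) * Real.log (Real.exp s * h (r 0)) := by
      have h3 : Real.log lo ≤ Real.log (r 0) := Real.log_le_log hlo h1
      have h4 : Real.log (1 + r 0) ≤ Real.log (1 + hi) :=
        Real.log_le_log (by linarith) (by linarith [hr.monotone (Nat.zero_le (2 * N))])
      nlinarith
    have hgap := hg r _ hr (hloR.trans h1) (h2.trans hhiR) (by simpa using hτ0)
      (fun l => (hT l).trans hmR) hsep (by simpa using hD) hE'
    refine ⟨⟨⟨fun j => (ha0.trans_le (ha.monotone (Fin.zero_le j))).le, fun j => ?_⟩, hs⟩,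
      h1.trans_eq hr0, fun j => ?_⟩
    · exact (ha.monotone (Fin.le_last j)).trans (hrl ▸ h2)
    · have h3 := hgap j j.2
      have h4 := hra j.castSucc
      have h5 := hra j.succ
      simp only [Fin.val_castSucc, Fin.val_succ] at h4 h5
      rwa [h4, h5] at h3

end LogGas

namespace LogGas
open Finset

section Moments

variable {n m ω : ℕ} {e : ℝ} {α : Fin n → ℝ} {t : Fin m → ℝ}

theorem moment_inl (j : Fin n) :
    moment (chargeSign n m) (powSign n m) ω e (Sum.elim α t) (Sum.inl j) =
      α j + e + (-1) ^ (j : ℕ) * (ω - 1 / 2) +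
        2 * ω * ∑ i : Fin n, (-1) ^ (i : ℕ) * (α j ^ ω / (α j ^ ω - α i ^ ω)) -
        2 * ω * ∑ l, α j ^ ω / (α j ^ ω + t l ^ ω) := by
  simp only [moment, chargeSign, powSign, Fintype.sum_sum_type, Sum.elim_inl, Sum.elim_inr, one_mul,
    neg_mul, sub_neg_eq_add, sum_neg_distrib]
  ring

theorem moment_inr (l : Fin m) :
    moment (chargeSign n m) (powSign n m) ω e (Sum.elim α t) (Sum.inr l) =
      t l - (ω - 1 / 2 - e) + 2 * ω * ∑ j : Fin n, (-1) ^ (j : ℕ) * (t l ^ ω / (t l ^ ω + α j ^ ω)) -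
        2 * ω * ∑ i, t l ^ ω / (t l ^ ω - t i ^ ω) := by
  have h1 : ∀ a b : ℝ, -b / (-b - a) = b / (b + a) := fun a b => by
    rw [← neg_div_neg_eq]
    ring
  simp only [moment, chargeSign, powSign, Fintype.sum_sum_type, Sum.elim_inl, Sum.elim_inr, one_mul,
    neg_mul, sum_neg_distrib, h1, ← sub_eq_add_neg]
  ring

theorem sum_moment_elim_div (hα : ∀ j, 0 < α j) (ht : ∀ l, 0 < t l) :
    ∑ j : Fin n, (-1) ^ (j : ℕ) * moment (chargeSign n m) (powSign n m) ω e (Sum.elim α t) (Sum.inl j) /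
        α j ^ ω +
      ∑ l, moment (chargeSign n m) (powSign n m) ω e (Sum.elim α t) (Sum.inr l) / t l ^ ω =
    ∑ j : Fin n, (-1) ^ (j : ℕ) * (α j / α j ^ ω) +
      ∑ j : Fin n, ((-1) ^ (j : ℕ) * e + (ω - 1 / 2)) / α j ^ ω +
      ∑ l, (t l - (ω - 1 / 2 - e)) / t l ^ ω := by
  have h := sum_moment_div (q := chargeSign n m) (σ := powSign n m) (ω := ω) (e := e)
    (r := Sum.elim α t) (by
      rintro (j | l)
      · simpa [powSign] using fun h : α j = 0 => absurd h (hα j).ne'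
      · simpa [powSign] using fun h : t l = 0 => absurd h (ht l).ne')
  have h1 : ∀ a b : ℝ, -1 * a / (-1 * b) = a / b := fun a b => by
    rw [← neg_div_neg_eq]
    ring
  simp only [Fintype.sum_sum_type, chargeSign, powSign, Sum.elim_inl, Sum.elim_inr, one_mul,
    h1] at h ⊢
  rw [h, ← sum_add_distrib]
  congr 1
  · refine sum_congr rfl fun j _ => ?_
    have h2 : ((-1 : ℝ) ^ (j : ℕ)) * (-1) ^ (j : ℕ) = 1 := by rw [← mul_pow]; norm_num
    rw [mul_div_assoc', ← add_div]
    congr 1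
    linear_combination (ω - 1 / 2 : ℝ) * h2
  · refine sum_congr rfl fun l _ => ?_
    ring

end Moments

theorem alternating_sum_bounds {N : ℕ} {α : Fin (2 * N + 1) → ℝ} (hα0 : 0 < α 0)
    (hα : StrictMono α) {g : ℝ → ℝ} (hg : ∀ x y, 0 < x → x ≤ y → g y ≤ g x)
    (hg0 : ∀ x, 0 < x → 0 ≤ g x) :
    0 ≤ ∑ j : Fin (2 * N + 1), (-1) ^ (j : ℕ) * g (α j) ∧
      ∑ j : Fin (2 * N + 1), (-1) ^ (j : ℕ) * g (α j) ≤ g (α 0) := by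
  obtain ⟨r, hr, hrα⟩ := hα.exists_extend_nat
  have hr0 : r 0 = α 0 := hrα 0
  have hrp : ∀ j, 0 < r j := fun j => (hr0 ▸ hα0).trans_le (hr.monotone (Nat.zero_le j))
  have hf : Antitone fun j => g (r j) := fun i j hij => hg _ _ (hrp i) (hr.monotone hij)
  have h1 : ∑ j : Fin (2 * N + 1), (-1) ^ (j : ℕ) * g (α j) =
      ∑ j ∈ range (2 * N + 1), (-1) ^ j * g (r j) := by
    rw [← Fin.sum_univ_eq_sum_range (fun j => (-1) ^ j * g (r j))]
    exact sum_congr rfl fun j _ => by rw [hrα]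
  rw [h1, ← hr0]
  exact ⟨(hg0 _ (hrp _)).trans (AltSum.last_le_of_antitone hf N), AltSum.le_first_of_antitone hf N⟩

section SecondFamily

variable {N m ω : ℕ} {e : ℝ} {α : Fin (2 * N + 1) → ℝ} {t : Fin (m + 1) → ℝ}

theorem alternating_sum_div_add_bounds (hα0 : 0 < α 0) (hα : StrictMono α) {b : ℝ} (hb : 0 < b) :
    0 ≤ ∑ j : Fin (2 * N + 1), (-1) ^ (j : ℕ) * (b / (b + α j ^ ω)) ∧
      ∑ j : Fin (2 * N + 1), (-1) ^ (j : ℕ) * (b / (b + α j ^ ω)) ≤ b / (b + α 0 ^ ω) :=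
  alternating_sum_bounds hα0 hα (g := fun x => b / (b + x ^ ω))
    (fun x y hx hxy => by gcongr) (fun x hx => by positivity)

/-- The attraction of the first orbit of the second family to the other ones. -/
theorem moment_inr_zero :
    moment (chargeSign (2 * N + 1) (m + 1)) (powSign (2 * N + 1) (m + 1)) ω e (Sum.elim α t)
        (Sum.inr 0) =
      t 0 - (ω - 1 / 2 - e) +
        2 * ω * ∑ j : Fin (2 * N + 1), (-1) ^ (j : ℕ) * (t 0 ^ ω / (t 0 ^ ω + α j ^ ω)) +
        2 * ω * ∑ l : Fin m, t 0 ^ ω / (t l.succ ^ ω - t 0 ^ ω) := by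
  rw [moment_inr, Fin.sum_univ_succ (fun i => t 0 ^ ω / (t 0 ^ ω - t i ^ ω)), sub_self, div_zero,
    zero_add]
  have : ∀ i : Fin m, t 0 ^ ω / (t 0 ^ ω - t i.succ ^ ω) = -(t 0 ^ ω / (t i.succ ^ ω - t 0 ^ ω)) :=
    fun i => by rw [← neg_sub (t i.succ ^ ω), div_neg]
  simp only [this, sum_neg_distrib]
  ring

theorem le_moment_inr_zero (hω : ω ≠ 0) (hα0 : 0 < α 0) (hα : StrictMono α) (ht0 : 0 < t 0)
    (ht : StrictMono t) :
    t 0 - (ω - 1 / 2 - e) ≤ moment (chargeSign (2 * N + 1) (m + 1)) (powSign (2 * N + 1) (m + 1))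
      ω e (Sum.elim α t) (Sum.inr 0) := by
  rw [moment_inr_zero]
  have h1 := (alternating_sum_div_add_bounds (ω := ω) hα0 hα (pow_pos ht0 ω)).1
  have h2 : 0 ≤ ∑ l : Fin m, t 0 ^ ω / (t l.succ ^ ω - t 0 ^ ω) := by
    refine sum_nonneg fun l _ => ?_
    have := pow_lt_pow_left₀ (ht (Fin.succ_pos l)) ht0.le hω
    exact div_nonneg (pow_nonneg ht0.le ω) (by linarith)
  have h3 : 0 ≤ 2 * (ω : ℝ) * ∑ j : Fin (2 * N + 1), (-1) ^ (j : ℕ) * (t 0 ^ ω / (t 0 ^ ω + α j ^ ω)) :=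
    by positivity
  have h4 : 0 ≤ 2 * (ω : ℝ) * ∑ l : Fin m, t 0 ^ ω / (t l.succ ^ ω - t 0 ^ ω) := by positivity
  linarith

theorem sum_div_nonneg_of_moment_eq_zero (hω : ω ≠ 0) (hα0 : 0 < α 0) (hα : StrictMono α)
    (ht0 : 0 < t 0) (ht : StrictMono t)
    (hF : ∀ l : Fin m, moment (chargeSign (2 * N + 1) (m + 1)) (powSign (2 * N + 1) (m + 1)) ω e
      (Sum.elim α t) (Sum.inr l.succ) = 0) :
    0 ≤ ∑ l : Fin m, (t l.succ - (ω - 1 / 2 - e)) / t l.succ ^ ω := by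
  have hb0 : 0 < t 0 ^ ω := pow_pos ht0 ω
  have hlt : ∀ l : Fin m, t 0 ^ ω < t l.succ ^ ω := fun l =>
    pow_lt_pow_left₀ (ht (Fin.succ_pos l)) ht0.le hω
  have h : ∀ l : Fin m, 2 * ω * ∑ i : Fin m, 1 / (t l.succ ^ ω - t i.succ ^ ω) ≤
      (t l.succ - (ω - 1 / 2 - e)) / t l.succ ^ ω := by
    intro l
    have hb := hb0.trans (hlt l)
    have h1 := hF l
    rw [moment_inr, Fin.sum_univ_succ (fun i => t l.succ ^ ω / (t l.succ ^ ω - t i ^ ω))] at h1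
    have h2 := (alternating_sum_div_add_bounds (ω := ω) hα0 hα hb).2
    have h3 : t l.succ ^ ω / (t l.succ ^ ω + α 0 ^ ω) ≤ 1 :=
      (div_le_one (by positivity)).2 (by have := pow_pos hα0 ω; linarith)
    have h4 : 1 ≤ t l.succ ^ ω / (t l.succ ^ ω - t 0 ^ ω) :=
      (one_le_div (by linarith [hlt l])).2 (by linarith)
    rw [le_div_iff₀ hb, mul_assoc, sum_mul]
    simp only [div_mul_eq_mul_div, one_mul]
    have h5 : (0 : ℝ) ≤ 2 * ω := by positivity
    nlinarith
  have h1 : ∑ l : Fin m, ∑ i : Fin m, 1 / (t l.succ ^ ω - t i.succ ^ ω) = 0 := by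
    have h2 : ∑ l : Fin m, ∑ i : Fin m, 1 / (t l.succ ^ ω - t i.succ ^ ω) =
        -∑ l : Fin m, ∑ i : Fin m, 1 / (t l.succ ^ ω - t i.succ ^ ω) := by
      conv_lhs => rw [sum_comm]
      simp only [← sum_neg_distrib]
      refine sum_congr rfl fun l _ => sum_congr rfl fun i _ => ?_
      rw [← neg_sub, div_neg]
    linarith
  have h2 := sum_le_sum fun l (_ : l ∈ univ) => h l
  rwa [← mul_sum, h1, mul_zero] at h2

theorem le_mul_of_moment_eq_zero (hω : ω ≠ 0) (hα0 : 0 < α 0) (hα : StrictMono α)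
    (ht0 : 0 < t 0) (ht : StrictMono t) (hc : 0 ≤ ω - 1 / 2 - e)
    (hF : ∀ l : Fin m, moment (chargeSign (2 * N + 1) (m + 1)) (powSign (2 * N + 1) (m + 1)) ω e
      (Sum.elim α t) (Sum.inr l.succ) = 0) (l : Fin m) :
    ω - 1 / 2 - e ≤ m * t l.succ := by
  have h := sum_div_nonneg_of_moment_eq_zero hω hα0 hα ht0 ht hF
  obtain ⟨m, rfl⟩ : ∃ k, m = k + 1 := ⟨m - 1, by have := l.2; omega⟩
  have htp : ∀ l, 0 < t l := fun l => ht0.trans_le (ht.monotone (Fin.zero_le l))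
  set x := t (Fin.succ 0) with hx
  set c := (ω : ℝ) - 1 / 2 - e
  have hxp : 0 < x := htp _
  have hxl : ∀ l : Fin (m + 1), x ≤ t l.succ := fun l => ht.monotone (Fin.succ_le_succ_iff.2 (Fin.zero_le l))
  have h1 : ∀ l : Fin (m + 1), t l.succ / t l.succ ^ ω ≤ x / x ^ ω := by
    intro l
    obtain ⟨w, rfl⟩ := Nat.exists_eq_succ_of_ne_zero hω
    rw [Nat.succ_eq_add_one, pow_succ', pow_succ', div_mul_cancel_left₀ (htp _).ne',
      div_mul_cancel_left₀ hxp.ne']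
    exact inv_anti₀ (by positivity) (pow_le_pow_left₀ hxp.le (hxl l) w)
  have h2 : c / x ^ ω ≤ ∑ l : Fin (m + 1), c / t l.succ ^ ω :=
    single_le_sum (f := fun l : Fin (m + 1) => c / t l.succ ^ ω)
      (fun l _ => div_nonneg hc (pow_pos (htp _) ω).le) (mem_univ 0)
  have h3 := sum_le_sum fun l (_ : l ∈ univ) => h1 l
  simp only [sum_const, card_univ, Fintype.card_fin, nsmul_eq_mul] at h3
  simp only [sub_div, sum_sub_distrib] at h
  have h4 : c / x ^ ω ≤ (m + 1 : ℕ) * x / x ^ ω := by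
    rw [mul_div_assoc]
    linarith
  have h5 := (div_le_div_iff_of_pos_right (pow_pos hxp ω)).1 h4
  exact h5.trans (mul_le_mul_of_nonneg_left (hxl l) (by positivity))

end SecondFamily

end LogGas

namespace LogGas
open Finset

variable {N m ω : ℕ} {e : ℝ} {α : Fin (2 * N + 1) → ℝ} {t : Fin (m + 1) → ℝ}

theorem moment_inr_zero_pos_of_upper (H : (ω = 1 ∧ e = 0) ∨ (ω = 2 ∧ e = 1)) (hα0 : 0 < α 0)
    (hα : StrictMono α) (ht : StrictMono t) (ht0 : t 0 = 2 * (α 0 / (1 + α 0)))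
    (hF0 : moment (chargeSign (2 * N + 1) (m + 1)) (powSign (2 * N + 1) (m + 1)) ω e
      (Sum.elim α t) (Sum.inl 0) * (1 + α 0) = moment (chargeSign (2 * N + 1) (m + 1))
        (powSign (2 * N + 1) (m + 1)) ω e (Sum.elim α t) (Sum.inr 0))
    (hFα : ∀ j ≠ 0, moment (chargeSign (2 * N + 1) (m + 1)) (powSign (2 * N + 1) (m + 1)) ω e
      (Sum.elim α t) (Sum.inl j) = 0)
    (hFt : ∀ l : Fin m, moment (chargeSign (2 * N + 1) (m + 1)) (powSign (2 * N + 1) (m + 1)) ω e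
      (Sum.elim α t) (Sum.inr l.succ) = 0) :
    0 < moment (chargeSign (2 * N + 1) (m + 1)) (powSign (2 * N + 1) (m + 1)) ω e
      (Sum.elim α t) (Sum.inr 0) := by
  by_contra! hneg
  have hω : ω ≠ 0 := by omega
  have hc : (ω : ℝ) - 1 / 2 - e = 1 / 2 := by rcases H with ⟨rfl, rfl⟩ | ⟨rfl, rfl⟩ <;> norm_num
  have hd : 1 / 2 ≤ e + ((ω : ℝ) - 1 / 2) := by
    rcases H with ⟨rfl, rfl⟩ | ⟨rfl, rfl⟩ <;> norm_num
  have he : 0 ≤ e := by rcases H with ⟨rfl, rfl⟩ | ⟨rfl, rfl⟩ <;> norm_num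
  have ht0p : 0 < t 0 := by rw [ht0]; positivity
  have htp : ∀ l, 0 < t l := fun l => ht0p.trans_le (ht.monotone (Fin.zero_le l))
  have hαp : ∀ j, 0 < α j := fun j => hα0.trans_le (hα.monotone (Fin.zero_le j))
  have h1 := le_moment_inr_zero (e := e) hω hα0 hα ht0p ht
  have h2 : t 0 ≤ 1 / 2 := by linarith
  have h3 : α 0 ≤ 1 / 3 := by
    rw [ht0, ← mul_div_assoc, div_le_iff₀ (by linarith)] at h2
    linarith
  have h4 : α 0 ≤ t 0 := by
    rw [ht0, ← mul_div_assoc, le_div_iff₀ (by linarith)]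
    nlinarith
  have h5 := sum_moment_elim_div (ω := ω) (e := e) hαp htp
  have h6 := sum_div_nonneg_of_moment_eq_zero hω hα0 hα ht0p ht hFt
  have hF0' : moment (chargeSign (2 * N + 1) (m + 1)) (powSign (2 * N + 1) (m + 1)) ω e
      (Sum.elim α t) (Sum.inl 0) ≤ 0 := by
    by_contra! hpos
    nlinarith
  have ha0 := pow_pos hα0 ω
  have hb0 := pow_pos ht0p ω
  have hsum1 : ∑ j : Fin (2 * N + 1), (-1) ^ (j : ℕ) * moment (chargeSign (2 * N + 1) (m + 1))
      (powSign (2 * N + 1) (m + 1)) ω e (Sum.elim α t) (Sum.inl j) / α j ^ ω ≤ 0 := by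
    rw [Fin.sum_univ_succ, sum_eq_zero fun j _ => by simp [hFα _ (Fin.succ_ne_zero j)], add_zero,
      Fin.val_zero, pow_zero, one_mul]
    exact div_nonpos_of_nonpos_of_nonneg hF0' ha0.le
  have hsum2 : ∑ l : Fin (m + 1), moment (chargeSign (2 * N + 1) (m + 1))
      (powSign (2 * N + 1) (m + 1)) ω e (Sum.elim α t) (Sum.inr l) / t l ^ ω ≤ 0 := by
    rw [Fin.sum_univ_succ, sum_eq_zero fun j _ => by rw [hFt, zero_div], add_zero]
    exact div_nonpos_of_nonpos_of_nonneg hneg hb0.le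
  have hsum3 : 0 ≤ ∑ j : Fin (2 * N + 1), (-1) ^ (j : ℕ) * (α j / α j ^ ω) := by
    refine (alternating_sum_bounds hα0 hα (g := fun x => x / x ^ ω) (fun x y hx hxy => ?_)
      fun x hx => by positivity).1
    have hy : 0 < y := hx.trans_le hxy
    rcases H with ⟨rfl, -⟩ | ⟨rfl, -⟩
    · simp [hx.ne', hy.ne']
    · rw [div_le_div_iff₀ (by positivity) (by positivity)]
      nlinarith [mul_pos hx hy]
  have hsum4 : 1 / 2 / t 0 ^ ω ≤
      ∑ j : Fin (2 * N + 1), ((-1) ^ (j : ℕ) * e + (ω - 1 / 2)) / α j ^ ω := by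
    have h7 := single_le_sum
      (f := fun j : Fin (2 * N + 1) => ((-1) ^ (j : ℕ) * e + ((ω : ℝ) - 1 / 2)) / α j ^ ω)
      (fun j _ => div_nonneg (by
        rcases neg_one_pow_eq_or ℝ (j : ℕ) with h | h <;> rw [h] <;> linarith)
        (pow_pos (hαp j) ω).le) (mem_univ 0)
    refine le_trans ?_ h7
    simp only [Fin.val_zero, pow_zero, one_mul]
    have h8 : α 0 ^ ω ≤ t 0 ^ ω := pow_le_pow_left₀ hα0.le h4 ω
    exact div_le_div₀ (by linarith) hd ha0 h8
  rw [Fin.sum_univ_succ (fun l => (t l - (ω - 1 / 2 - e)) / t l ^ ω), hc, sub_div] at h5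
  rw [hc] at h6
  have h7 : 0 < t 0 / t 0 ^ ω := by positivity
  linarith

theorem moment_inr_zero_neg_of_lower (H : (ω = 1 ∧ e = 0) ∨ (ω = 2 ∧ e = 1)) (hα0 : 0 < α 0)
    (hα : StrictMono α) (ht0p : 0 < t 0) (ht : StrictMono t) {ρ : ℝ}
    (hρ : ρ = 1 / (64 * (m + 1) ^ 2)) (ht0 : t 0 ≤ ρ) (ht0' : t 0 ≤ ρ * α 0)
    (hFt : ∀ l : Fin m, moment (chargeSign (2 * N + 1) (m + 1)) (powSign (2 * N + 1) (m + 1)) ω e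
      (Sum.elim α t) (Sum.inr l.succ) = 0) :
    moment (chargeSign (2 * N + 1) (m + 1)) (powSign (2 * N + 1) (m + 1)) ω e
      (Sum.elim α t) (Sum.inr 0) < 0 := by
  have hω : ω ≠ 0 := by omega
  have hω2 : (ω : ℝ) ≤ 2 := by rcases H with ⟨rfl, -⟩ | ⟨rfl, -⟩ <;> norm_num
  have hω0 : (0 : ℝ) ≤ ω := by positivity
  have hc : (ω : ℝ) - 1 / 2 - e = 1 / 2 := by rcases H with ⟨rfl, rfl⟩ | ⟨rfl, rfl⟩ <;> norm_num
  have hm : (0 : ℝ) ≤ m := by positivity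
  have hρ64 : ρ ≤ 1 / 64 := by
    rw [hρ]
    exact one_div_le_one_div_of_le (by norm_num) (by nlinarith)
  have hpow : ∀ x y q : ℝ, 0 < x → 0 < y → 0 ≤ q → q ≤ 1 → x ≤ q * y → x ^ ω ≤ q * y ^ ω := by
    intro x y q hx hy hq hq1 hxy
    refine (pow_le_pow_left₀ hx.le hxy ω).trans ?_
    rw [mul_pow]
    exact mul_le_mul_of_nonneg_right (pow_le_of_le_one hq hq1 hω) (by positivity)
  have ha0 := pow_pos hα0 ω
  have hb0 := pow_pos ht0p ω
  have hρ0 : 0 < ρ := ht0p.trans_le ht0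
  have h1 := (alternating_sum_div_add_bounds (ω := ω) hα0 hα hb0).2
  have h2 : t 0 ^ ω / (t 0 ^ ω + α 0 ^ ω) ≤ ρ := by
    rw [div_le_iff₀ (by positivity)]
    have := hpow _ _ _ ht0p hα0 hρ0.le (by linarith) ht0'
    nlinarith
  set q : ℝ := 1 / (32 * (m + 1)) with hq
  have hq0 : 0 < q := by positivity
  have hq1 : q ≤ 1 / 32 := by
    rw [hq]
    exact one_div_le_one_div_of_le (by norm_num) (by nlinarith)
  have hqm : q * (m + 1) = 1 / 32 := by
    rw [hq]
    field_simp
  have hρq : 2 * (m + 1) * ρ = q := by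
    rw [hρ, hq]
    field_simp
    norm_num
  have h3 : ∀ l : Fin m, t 0 ^ ω / (t l.succ ^ ω - t 0 ^ ω) ≤ 2 * q := by
    intro l
    have htl : 0 < t l.succ := ht0p.trans (ht (Fin.succ_pos l))
    have h4 := le_mul_of_moment_eq_zero hω hα0 hα ht0p ht (by rw [hc]; norm_num) hFt l
    rw [hc] at h4
    have h5 : t 0 ≤ q * t l.succ := by
      rw [← hρq]
      nlinarith
    have h6 := hpow _ _ _ ht0p htl hq0.le (by linarith) h5
    have h7 := pow_pos htl ω
    rw [div_le_iff₀ (by nlinarith)]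
    nlinarith
  have h4 := sum_le_sum fun l (_ : l ∈ univ) => h3 l
  simp only [sum_const, card_univ, Fintype.card_fin, nsmul_eq_mul] at h4
  rw [moment_inr_zero, hc]
  have h5 : 2 * (ω : ℝ) * ∑ j : Fin (2 * N + 1), (-1) ^ (j : ℕ) * (t 0 ^ ω / (t 0 ^ ω + α j ^ ω)) ≤
      4 * ρ := (mul_le_mul_of_nonneg_left (h1.trans h2) (by positivity)).trans
        (mul_le_mul_of_nonneg_right (by linarith) hρ0.le)
  have h6 : 2 * (ω : ℝ) * ∑ l : Fin m, t 0 ^ ω / (t l.succ ^ ω - t 0 ^ ω) ≤ 4 * (m * (2 * q)) :=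
    (mul_le_mul_of_nonneg_left h4 (by positivity)).trans
        (mul_le_mul_of_nonneg_right (by linarith) (by positivity))
  nlinarith

end LogGas

namespace LogGas
open Finset Filter Topology

theorem mem_iff_lt_card_of_isLowerSet {n : ℕ} {J : Finset (Fin n)}
    (hJ : IsLowerSet (J : Set (Fin n))) (j : Fin n) : j ∈ J ↔ (j : ℕ) < #J := by
  refine ⟨fun h => ?_, fun h => ?_⟩
  · have : Iic j ⊆ J := fun i hi => hJ (mem_Iic.1 hi) h
    have := card_le_card this
    rw [Fin.card_Iic] at this
    omega
  · by_contra hj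
    have : J ⊆ Iio j := fun i hi => mem_Iio.2 (lt_of_not_ge fun hji => hj (hJ hji hi))
    have := card_le_card this
    rw [Fin.card_Iio] at this
    omega

theorem sum_neg_one_pow_of_isLowerSet {n : ℕ} {J : Finset (Fin n)}
    (hJ : IsLowerSet (J : Set (Fin n))) :
    ∑ j ∈ J, (-1 : ℝ) ^ (j : ℕ) = if Even #J then 0 else 1 := by
  have h : J.map Fin.valEmbedding = range #J := by
    ext i
    simp only [Finset.mem_map, Fin.valEmbedding_apply, mem_range]
    refine ⟨?_, fun hi => ?_⟩
    · rintro ⟨j, hj, rfl⟩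
      exact (mem_iff_lt_card_of_isLowerSet hJ j).1 hj
    · have hn : #J ≤ n := by simpa using card_le_univ J
      exact ⟨⟨i, hi.trans_le hn⟩, (mem_iff_lt_card_of_isLowerSet hJ _).2 hi, rfl⟩
  rw [← neg_one_geom_sum, ← h, sum_map]
  rfl

theorem sum_sum_div_sub {n : ℕ} {α : Fin n → ℝ} (hα : Function.Injective α) (J : Finset (Fin n)) :
    2 * ∑ j ∈ J, ∑ i ∈ J, (-1) ^ (j : ℕ) * ((-1) ^ (i : ℕ) * (α j / (α j - α i))) =
      (∑ j ∈ J, (-1) ^ (j : ℕ)) ^ 2 - #J := by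
  have h : ∀ j i : Fin n, (-1) ^ (j : ℕ) * ((-1) ^ (i : ℕ) * (α j / (α j - α i))) +
      (-1) ^ (i : ℕ) * ((-1) ^ (j : ℕ) * (α i / (α i - α j))) =
      (-1) ^ (j : ℕ) * (-1) ^ (i : ℕ) - if j = i then 1 else 0 := by
    intro j i
    rcases eq_or_ne j i with rfl | hij
    · simp [← mul_pow]
    · have h1 := sub_ne_zero.2 (hα.ne hij)
      have h2 := sub_ne_zero.2 (hα.ne hij.symm)
      rw [if_neg hij]
      field_simp
      ring
  have h1 := sum_congr rfl fun j (_ : j ∈ J) => sum_congr rfl fun i (_ : i ∈ J) => h j i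
  have h2 : ∑ j ∈ J, ∑ i ∈ J, (if j = i then (1 : ℝ) else 0) = #J := by simp
  simp only [sum_add_distrib, sum_sub_distrib, h2] at h1
  rw [sum_comm (f := fun j i : Fin n => (-1) ^ (i : ℕ) * ((-1) ^ (j : ℕ) * (α i / (α i - α j)))),
    ← two_mul, ← sum_mul_sum, ← sq] at h1
  exact h1

theorem sum_moment_inl {n m : ℕ} {α : Fin n → ℝ} {t : Fin m → ℝ} (hα : Function.Injective α)
    (J : Finset (Fin n)) :
    ∑ j ∈ J, (-1) ^ (j : ℕ) * moment (chargeSign n m) (powSign n m) 1 (-1) (Sum.elim α t)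
        (Sum.inl j) =
      ∑ j ∈ J, (-1) ^ (j : ℕ) * α j - ∑ j ∈ J, (-1) ^ (j : ℕ) +
        (∑ j ∈ J, (-1) ^ (j : ℕ)) ^ 2 - #J / 2 +
        2 * ∑ j ∈ J, ∑ i ∈ Jᶜ, (-1) ^ (j : ℕ) * ((-1) ^ (i : ℕ) * (α j / (α j - α i))) -
        2 * ∑ j ∈ J, (-1) ^ (j : ℕ) * ∑ l, α j / (α j + t l) := by
  have h := sum_sum_div_sub hα J
  have h1 : ∀ j : Fin n, (-1 : ℝ) ^ (j : ℕ) * (-1) ^ (j : ℕ) = 1 := fun j => by simp [← mul_pow]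
  have h2 : ∀ j : Fin n, (-1) ^ (j : ℕ) * moment (chargeSign n m) (powSign n m) 1 (-1)
      (Sum.elim α t) (Sum.inl j) = (-1) ^ (j : ℕ) * α j - (-1) ^ (j : ℕ) + 1 / 2 +
      2 * ∑ i ∈ J, (-1) ^ (j : ℕ) * ((-1) ^ (i : ℕ) * (α j / (α j - α i))) +
      2 * ∑ i ∈ Jᶜ, (-1) ^ (j : ℕ) * ((-1) ^ (i : ℕ) * (α j / (α j - α i))) -
      2 * ((-1) ^ (j : ℕ) * ∑ l, α j / (α j + t l)) := by
    intro j
    rw [moment_inl, ← mul_sum, ← mul_sum, ← sum_add_sum_compl J]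
    simp only [pow_one, Nat.cast_one]
    linear_combination 1 / 2 * h1 j
  rw [sum_congr rfl fun j _ => h2 j]
  simp only [sum_add_distrib, sum_sub_distrib, sum_const, nsmul_eq_mul]
  rw [← mul_sum, ← mul_sum, ← mul_sum]
  linarith

/-- Summing the balance equations of the innermost orbits in the limit where the radius of the
first orbit of the second family tends to zero. -/
theorem sum_eq_of_tendsto {n m : ℕ} {α : ℕ → Fin n → ℝ} {t : ℕ → Fin (m + 1) → ℝ} {p : Fin n → ℝ}
    {δ : ℝ} (hα0 : ∀ k j, 0 < α k j) (hα : ∀ k, Function.Injective (α k)) (ht0 : ∀ k, 0 < t k 0)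
    (hδ : 0 < δ) (ht : ∀ k l, δ ≤ t k (Fin.succ l)) (hlim : Tendsto (fun k => t k 0) atTop (𝓝 0))
    (hp : ∀ j, Tendsto (fun k => t k 0 / (t k 0 + α k j)) atTop (𝓝 (p j)))
    {J : Finset (Fin n)} (hJ : ∀ j ∈ J, 0 < p j) (hJ' : ∀ i ∉ J, p i < 1)
    (hJJ : ∀ j ∈ J, ∀ i ∉ J, (1 - p j) * p i = 0)
    (hF : ∀ k j, moment (chargeSign n (m + 1)) (powSign n (m + 1)) 1 (-1) (Sum.elim (α k) (t k))
      (Sum.inl j) = 0) :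
    (∑ j ∈ J, (-1 : ℝ) ^ (j : ℕ)) ^ 2 - ∑ j ∈ J, (-1 : ℝ) ^ (j : ℕ) - #J / 2 =
      2 * ∑ j ∈ J, (-1) ^ (j : ℕ) * (1 - p j) := by
  have h1 : ∀ j ∈ J, Tendsto (fun k => α k j) atTop (𝓝 0) := by
    intro j hj
    have h := (hlim.div (hp j) (hJ j hj).ne').sub hlim
    rw [zero_div, sub_zero] at h
    refine h.congr fun k => ?_
    have := ht0 k
    have := hα0 k j
    simp only [Pi.div_apply]
    field_simp
    ring
  have h2 : ∀ j ∈ J, ∀ i ∉ J, Tendsto (fun k => α k j / α k i) atTop (𝓝 0) := by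
    intro j hj i hi
    have h := (((tendsto_const_nhds (x := (1 : ℝ))).sub (hp j)).mul (hp i)).div
      ((hp j).mul ((tendsto_const_nhds (x := (1 : ℝ))).sub (hp i)))
      (mul_ne_zero (hJ j hj).ne' (sub_pos.2 (hJ' i hi)).ne')
    rw [hJJ j hj i hi, zero_div] at h
    refine h.congr fun k => ?_
    have := ht0 k
    have := hα0 k j
    have := hα0 k i
    simp only [Pi.div_apply]
    have e1 : 1 - t k 0 / (t k 0 + α k j) = α k j / (t k 0 + α k j) := by field_simp; ring
    have e2 : 1 - t k 0 / (t k 0 + α k i) = α k i / (t k 0 + α k i) := by field_simp; ring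
    rw [e1, e2]
    field_simp
  have h3 : ∀ j ∈ J, ∀ i ∈ Jᶜ, Tendsto (fun k => α k j / (α k j - α k i)) atTop (𝓝 0) := by
    intro j hj i hi
    have h := (h2 j hj i (mem_compl.1 hi)).div
      ((h2 j hj i (mem_compl.1 hi)).sub (tendsto_const_nhds (x := (1 : ℝ)))) (by norm_num)
    rw [zero_div] at h
    refine h.congr fun k => ?_
    have h0 := (hα0 k i).ne'
    have e1 : α k j / α k i - 1 = (α k j - α k i) / α k i := by field_simp
    simp only [Pi.div_apply]
    rw [e1, div_div_div_cancel_right₀ h0]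
  have h4 : ∀ j ∈ J, Tendsto (fun k => ∑ l, α k j / (α k j + t k l)) atTop (𝓝 (1 - p j)) := by
    intro j hj
    have h5 : Tendsto (fun k => α k j / (α k j + t k 0)) atTop (𝓝 (1 - p j)) := by
      refine (tendsto_const_nhds.sub (hp j)).congr fun k => ?_
      have := ht0 k
      have := hα0 k j
      field_simp
      ring
    have h6 : ∀ l : Fin m, Tendsto (fun k => α k j / (α k j + t k l.succ)) atTop (𝓝 0) := by
      intro l
      refine squeeze_zero (fun k => ?_) (fun k => ?_) (by simpa using (h1 j hj).div_const δ)
      · exact div_nonneg (hα0 k j).le (add_nonneg (hα0 k j).le (hδ.le.trans (ht k l)))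
      · exact div_le_div_of_nonneg_left (hα0 k j).le hδ (by linarith [hα0 k j, ht k l])
    simp only [Fin.sum_univ_succ]
    simpa using h5.add (tendsto_finsetSum univ fun l _ => h6 l)
  have h5 := (((tendsto_finsetSum J fun j hj => (h1 j hj).const_mul ((-1) ^ (j : ℕ))).add
    ((tendsto_finsetSum J fun j hj => tendsto_finsetSum Jᶜ fun i hi =>
      ((h3 j hj i hi).const_mul ((-1) ^ (i : ℕ))).const_mul ((-1) ^ (j : ℕ))).const_mul 2)).sub
    ((tendsto_finsetSum J fun j hj => (h4 j hj).const_mul ((-1) ^ (j : ℕ))).const_mul 2))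
  simp only [mul_zero, sum_const_zero, add_zero, zero_sub] at h5
  have h6 := tendsto_nhds_unique h5 ((tendsto_const_nhds (x := ∑ j ∈ J, (-1 : ℝ) ^ (j : ℕ) -
    (∑ j ∈ J, (-1 : ℝ) ^ (j : ℕ)) ^ 2 + #J / 2)).congr fun k => by
      have h := sum_moment_inl (t := t k) (hα k) J
      simp only [hF, mul_zero, sum_const_zero] at h
      linarith)
  linarith

theorem exists_moment_inr_zero_neg (N m : ℕ) : ∃ β : ℝ, 0 < β ∧ β ≤ 1 ∧
    ∀ (α : Fin (2 * N + 1) → ℝ) (t : Fin (m + 1) → ℝ), 0 < α 0 → StrictMono α → StrictMono t →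
      t 0 = β →
      (∀ j, moment (chargeSign (2 * N + 1) (m + 1)) (powSign (2 * N + 1) (m + 1)) 1 (-1)
        (Sum.elim α t) (Sum.inl j) = 0) →
      (∀ l : Fin m, moment (chargeSign (2 * N + 1) (m + 1)) (powSign (2 * N + 1) (m + 1)) 1 (-1)
        (Sum.elim α t) (Sum.inr l.succ) = 0) →
      moment (chargeSign (2 * N + 1) (m + 1)) (powSign (2 * N + 1) (m + 1)) 1 (-1)
        (Sum.elim α t) (Sum.inr 0) < 0 := by
  by_contra! H
  have hβ : ∀ k : ℕ, (0 : ℝ) < 1 / (k + 1) ∧ (1 : ℝ) / (k + 1) ≤ 1 := fun k =>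
    ⟨Nat.one_div_pos_of_nat, (div_le_one (by positivity)).2 (by linarith [k.cast_nonneg (α := ℝ)])⟩
  choose α t hα0 hα ht ht0 hFα hFt hF0 using fun k : ℕ => H _ (hβ k).1 (hβ k).2
  have hαp : ∀ k j, 0 < α k j := fun k j => (hα0 k).trans_le ((hα k).monotone (Fin.zero_le j))
  have ht0p : ∀ k, 0 < t k 0 := fun k => ht0 k ▸ (hβ k).1
  have hlim : Tendsto (fun k => t k 0) atTop (𝓝 0) := by
    simpa only [ht0] using tendsto_one_div_add_atTop_nhds_zero_nat (𝕜 := ℝ)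
  have htδ : ∀ k l, 3 / (2 * (m + 1) : ℝ) ≤ t k (Fin.succ l) := by
    intro k l
    have h := le_mul_of_moment_eq_zero one_ne_zero (hα0 k) (hα k) (ht0p k) (ht k) (by norm_num)
      (hFt k) l
    have := (ht0p k).trans (ht k (Fin.succ_pos l))
    rw [div_le_iff₀ (by positivity)]
    push_cast at h
    linarith
  obtain ⟨p, -, φ, hφ, hp⟩ := (isCompact_Icc (a := (0 : Fin (2 * N + 1) → ℝ)) (b := 1)).tendsto_subseq
    (x := fun k j => t k 0 / (t k 0 + α k j)) (fun k => ⟨fun j => by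
      have := ht0p k
      have := hαp k j
      simp only [Pi.zero_apply]
      positivity, fun j => by
      have := ht0p k
      have := hαp k j
      exact (div_le_one (by positivity)).2 (by linarith)⟩)
  rw [tendsto_pi_nhds] at hp
  simp only [Function.comp_apply] at hp
  replace hlim := hlim.comp hφ.tendsto_atTop
  have hp0 : ∀ j, 0 ≤ p j := fun j => ge_of_tendsto' (hp j) fun k => by
    have := ht0p (φ k)
    have := hαp (φ k) j
    positivity
  have hp1 : ∀ j, p j ≤ 1 := fun j => le_of_tendsto' (hp j) fun k => by
    have := ht0p (φ k)
    have := hαp (φ k) j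
    exact (div_le_one (by positivity)).2 (by linarith)
  have hpa : Antitone p := fun i j hij => le_of_tendsto_of_tendsto' (hp j) (hp i) fun k => by
    have := ht0p (φ k)
    have := hαp (φ k) i
    have := (hα (φ k)).monotone hij
    gcongr
  have key : ∀ J : Finset (Fin (2 * N + 1)), IsLowerSet (J : Set (Fin (2 * N + 1))) →
      (∀ j ∈ J, 0 < p j) → (∀ i ∉ J, p i < 1) → (∀ j ∈ J, ∀ i ∉ J, (1 - p j) * p i = 0) →
      -(#J / 2 : ℝ) = 2 * ∑ j ∈ J, (-1) ^ (j : ℕ) * (1 - p j) := by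
    intro J hJl hJ hJ' hJJ
    rw [← sum_eq_of_tendsto (fun k => hαp (φ k)) (fun k => (hα (φ k)).injective)
      (fun k => ht0p (φ k)) (by positivity) (fun k => htδ (φ k)) hlim hp hJ hJ' hJJ
      (fun k => hFα (φ k)), sum_neg_one_pow_of_isLowerSet hJl]
    split_ifs <;> ring
  have hlt : p 0 < 1 := by
    by_contra h0
    have h := key {j | p j = 1} (fun j i hij hj => by
      simp only [coe_filter, mem_univ, true_and, Set.mem_ofPred_eq] at hj ⊢
      exact le_antisymm (hp1 i) (hj ▸ hpa hij)) (by simp +contextual) (fun i hi => by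
      simp only [mem_filter, mem_univ, true_and] at hi
      exact lt_of_le_of_ne (hp1 i) hi) (by simp +contextual)
    rw [sum_eq_zero (by simp +contextual), mul_zero, neg_eq_zero, div_eq_zero_iff] at h
    simp only [OfNat.ofNat_ne_zero, or_false, Nat.cast_eq_zero, card_eq_zero] at h
    have h1 : (0 : Fin (2 * N + 1)) ∈ ({j | p j = 1} : Finset (Fin (2 * N + 1))) := by
      simpa using le_antisymm (hp1 0) (not_lt.1 h0)
    rw [h] at h1
    simp at h1
  have hS := tendsto_finsetSum univ fun j _ => (hp j).const_mul ((-1) ^ (j : ℕ))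
  have hS1 : ∑ j : Fin (2 * N + 1), (-1) ^ (j : ℕ) * p j ≤ p 0 :=
    le_of_tendsto_of_tendsto' hS (hp 0) fun k => by
      simpa using (alternating_sum_div_add_bounds (ω := 1) (hα0 (φ k)) (hα (φ k)) (ht0p (φ k))).2
  have hS2 : 3 / 2 ≤ 2 * ∑ j : Fin (2 * N + 1), (-1) ^ (j : ℕ) * p j := by
    have h1 : ∀ l : Fin m, Tendsto (fun k => t (φ k) 0 / (t (φ k) l.succ - t (φ k) 0)) atTop
        (𝓝 0) := by
      intro l
      have hδ : (0 : ℝ) < 3 / (2 * (m + 1)) := by positivity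
      have h2 := hlim.div ((tendsto_const_nhds (x := (3 / (2 * (m + 1)) : ℝ))).sub hlim)
        (by simpa using hδ.ne')
      rw [zero_div] at h2
      refine squeeze_zero' (Eventually.of_forall fun k => ?_) ?_ h2
      · exact div_nonneg (ht0p _).le (sub_nonneg.2 ((ht _).monotone (Fin.zero_le _)))
      · filter_upwards [hlim.eventually_lt_const hδ] with k hk
        simp only [Function.comp_apply, Pi.div_apply] at hk ⊢
        exact div_le_div_of_nonneg_left (ht0p _).le (sub_pos.2 hk)
          (sub_le_sub_right (htδ _ l) _)
    have h2 := (hlim.add (hS.const_mul 2)).add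
      ((tendsto_finsetSum univ fun l (_ : l ∈ univ) => h1 l).const_mul 2)
    simp only [sum_const_zero, mul_zero, add_zero, zero_add] at h2
    refine ge_of_tendsto' h2 fun k => ?_
    have h3 := hF0 (φ k)
    rw [moment_inr_zero] at h3
    simp only [pow_one, Nat.cast_one, mul_one] at h3
    simp only [Function.comp_apply]
    linarith
  have hl : IsLowerSet (({j | 0 < p j} : Finset (Fin (2 * N + 1))) : Set (Fin (2 * N + 1))) :=
    fun j i hij hj => by
      simp only [coe_filter, mem_univ, true_and, Set.mem_ofPred_eq] at hj ⊢
      exact hj.trans_le (hpa hij)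
  have h := key {j | 0 < p j} hl (by simp) (fun i hi => by
    simp only [mem_filter, mem_univ, true_and, not_lt] at hi
    linarith) (fun j _ i hi => by
    simp only [mem_filter, mem_univ, true_and, not_lt] at hi
    rw [le_antisymm hi (hp0 i), mul_zero])
  have hS3 : ∑ j ∈ {j | 0 < p j}, (-1) ^ (j : ℕ) * p j =
      ∑ j : Fin (2 * N + 1), (-1) ^ (j : ℕ) * p j := by
    refine sum_subset (subset_univ _) fun j _ hj => ?_
    simp only [mem_filter, mem_univ, true_and, not_lt] at hj
    rw [le_antisymm hj (hp0 j), mul_zero]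
  simp only [mul_sub, mul_one, sum_sub_distrib] at h
  rw [hS3, sum_neg_one_pow_of_isLowerSet hl] at h
  split_ifs at h with hev
  · obtain ⟨a, ha⟩ := hev
    rw [ha] at h
    push_cast at h
    have h1 : (a : ℝ) < 2 := by linarith
    have h2 : (1 : ℝ) < a := by linarith
    norm_cast at h1 h2
    omega
  · have := (#{j | 0 < p j}).cast_nonneg (α := ℝ)
    linarith

end LogGas

namespace LogGas
open Finset Filter Topology

theorem paramMoment_eq_zero_of_isMax {n m ω : ℕ} {e : ℝ} {h ℓ : ℝ → ℝ} (hω : ω ≠ 0)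
    (hh : Continuous h) (hh0 : ∀ x, 0 < x → 0 < h x)
    (hhd : ∀ x, 0 < x → HasDerivAt h (h x * ℓ x) x) {x : (Fin (n + 1) → ℝ) × ℝ} {y : Fin m → ℝ}
    (hp : (x, y) ∈ admissible n m h)
    (hmax : ∀ w, (x, w) ∈ admissible n m h →
      paramEnergy n m ω e h (x, w) ≤ paramEnergy n m ω e h (x, y)) (l : Fin m) :
    paramMoment n m ω e h (x, y) (Sum.inr l.succ) = 0 := by
  have hd := hasDerivAt_paramEnergy hω (e := e) hh0 hhd hp 0 (Pi.single l 1)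
  have hloc : IsLocalMax (fun t : ℝ => paramEnergy n m ω e h
      (x + t • (0 : (Fin (n + 1) → ℝ) × ℝ), y + t • Pi.single l (1 : ℝ))) 0 := by
    have hc : ContinuousAt (fun t : ℝ => (x + t • (0 : (Fin (n + 1) → ℝ) × ℝ),
        y + t • Pi.single l (1 : ℝ))) 0 := by fun_prop
    have h0 := hc.eventually_mem ((isOpen_admissible hh).mem_nhds (by simpa using hp))
    filter_upwards [h0] with t ht
    simp only [smul_zero, add_zero, zero_smul] at ht ⊢
    exact hmax _ ht
  have h0 := hloc.hasDerivAt_eq_zero hd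
  have hy : y l ≠ 0 := (radii_pos hh0 hp (Sum.inr l.succ)).ne'
  simpa [Pi.single_apply, ite_div, hy] using h0

theorem paramMoment_inl_eq_zero {n m ω : ℕ} {e : ℝ} {h ℓ : ℝ → ℝ}
    {p : ((Fin (n + 1) → ℝ) × ℝ) × (Fin m → ℝ)} (hp : p ∈ admissible n m h)
    (hG : gradEnergy n m ω e h ℓ p = 0) {j : Fin (n + 1)}
    (hj : j = 0 → paramMoment n m ω e h p (Sum.inr 0) * ℓ (p.1.1 0) = 0) :
    paramMoment n m ω e h p (Sum.inl j) = 0 := by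
  have h1 := congrFun hG j
  have ha : p.1.1 j ≠ 0 := (hp.1.trans_le (hp.2.1.monotone (Fin.zero_le j))).ne'
  rw [gradEnergy, ite_eq_right_iff.2 hj, sub_zero] at h1
  simpa [ha] using h1

section Existence

variable {N m ω : ℕ} {e : ℝ}

theorem exists_moment_eq_zero_of_boundary {h ℓ : ℝ → ℝ} (H : IsRegime ω e h) (hh : Continuous h)
    (hh0 : ∀ x, 0 < x → 0 < h x) (hℓ : ContinuousOn ℓ (Set.Ioi 0))
    (hhd : ∀ x, 0 < x → HasDerivAt h (h x * ℓ x) x) {s₁ s₂ : ℝ} (hs : s₁ < s₂)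
    (hs₂ : Real.exp s₂ ≤ 2)
    (hlow : ∀ a y, ((a, s₁), y) ∈ admissible (2 * N) m h →
      gradEnergy (2 * N) m ω e h ℓ ((a, s₁), y) = 0 →
      (∀ l : Fin m, paramMoment (2 * N) m ω e h ((a, s₁), y) (Sum.inr l.succ) = 0) →
      paramMoment (2 * N) m ω e h ((a, s₁), y) (Sum.inr 0) < 0)
    (hhigh : ∀ a y, ((a, s₂), y) ∈ admissible (2 * N) m h →
      gradEnergy (2 * N) m ω e h ℓ ((a, s₂), y) = 0 →
      (∀ l : Fin m, paramMoment (2 * N) m ω e h ((a, s₂), y) (Sum.inr l.succ) = 0) →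
      0 < paramMoment (2 * N) m ω e h ((a, s₂), y) (Sum.inr 0)) :
    ∃ (α : Fin (2 * N + 1) → ℝ) (t : Fin (m + 1) → ℝ), 0 < α 0 ∧ StrictMono α ∧ 0 < t 0 ∧
      StrictMono t ∧ ∀ i, moment (chargeSign (2 * N + 1) (m + 1)) (powSign (2 * N + 1) (m + 1)) ω e
        (Sum.elim α t) i = 0 := by
  have hω : ω ≠ 0 := by rcases H with H | ⟨H, -⟩ <;> omega
  have hc : (ω = 1 ∧ 0 < (ω : ℝ) - 1 / 2 - e) ∨ (ω = 2 ∧ (ω : ℝ) - 1 / 2 - e = 1 / 2) := by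
    rcases H with ⟨rfl, rfl, -⟩ | ⟨⟨rfl, rfl⟩ | ⟨rfl, rfl⟩, -⟩ <;> norm_num
  have hc0 : 0 ≤ (ω : ℝ) - 1 / 2 - e := by
    rcases hc with ⟨-, h⟩ | ⟨-, h⟩ <;> linarith
  have hFermat {x : (Fin (2 * N + 1) → ℝ) × ℝ} {y : Fin m → ℝ} :=
    paramMoment_eq_zero_of_isMax (e := e) hω hh hh0 hhd (x := x) (y := y)
  obtain ⟨a, -, s, y, hO, hmax, hGA, hGS⟩ := exists_critical_of_argmax
    (U := {a : Fin (2 * N + 1) → ℝ | 0 < a 0 ∧ StrictMono a}) (O := admissible (2 * N) m h)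
    (f := paramEnergy (2 * N) m ω e h) (GA := gradEnergy (2 * N) m ω e h ℓ)
    (GS := fun p => -paramMoment (2 * N) m ω e h p (Sum.inr 0))
    ((isOpen_lt continuous_const (continuous_apply 0)).inter (isOpen_setOf_strictMono _))
    ⟨0, fun h0 => lt_irrefl _ h0.1⟩
    ⟨fun j => j + 1, by simp, fun i j hij => by simpa using hij⟩
    (isOpen_admissible hh) (continuousOn_paramEnergy hω hh hh0)
    (continuousOn_gradEnergy hω hh hh0 hℓ) (continuousOn_paramMoment hω hh hh0 _).neg
    (fun a ha s => ⟨fun l => Real.exp s * h (a 0) + (l + 1), ha.1, ha.2, by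
      have he : (Fin.cons (Real.exp s * h (a 0)) (fun l => Real.exp s * h (a 0) + ((l : ℕ) + 1)) :
          Fin (m + 1) → ℝ) = fun l : Fin (m + 1) => Real.exp s * h (a 0) + (l : ℕ) := by
        funext l
        cases l using Fin.cases <;> simp
      exact he ▸ fun i j hij => by simpa using hij⟩)
    (fun K hKU hK C => isCompact_superlevel hω rfl hc0 hh hh0 hK hKU C)
    (fun x hx y y' hy hy' hmax hmax' => eq_of_isMax_energy rfl hc hx.1.1 hx.1.2
      (mul_pos (Real.exp_pos _) (hh0 _ hx.1.1)) hy.2.2 hy'.2.2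
      (fun z hz => hmax z ⟨hx.1.1, hx.1.2, hz⟩) (fun z hz => hmax' z ⟨hx.1.1, hx.1.2, hz⟩))
    (fun x y hp v => by simpa using hasDerivAt_paramEnergy hω (e := e) hh0 hhd hp v 0)
    hs (fun C => exists_isCompact_of_paramEnergy_le H hh0 hs₂ C)
    (fun a _ y hO hmax hGA => neg_pos.2 (hlow a y hO hGA (hFermat hO hmax)))
    (fun a _ y hO hmax hGA => neg_neg_iff_pos.2 (hhigh a y hO hGA (hFermat hO hmax)))
  have hF0 : paramMoment (2 * N) m ω e h ((a, s), y) (Sum.inr 0) = 0 := neg_eq_zero.1 hGS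
  refine ⟨a, Fin.cons (Real.exp s * h (a 0)) y, hO.1, hO.2.1,
    mul_pos (Real.exp_pos _) (hh0 _ hO.1), hO.2.2, ?_⟩
  rintro (j | l)
  · exact paramMoment_inl_eq_zero hO hGA fun _ => by rw [hF0, zero_mul]
  · cases l using Fin.cases with
    | zero => exact hF0
    | succ l => exact hFermat hO hmax l

theorem exists_moment_eq_zero_of_neg (N m : ℕ) :
    ∃ (α : Fin (2 * N + 1) → ℝ) (t : Fin (m + 1) → ℝ), 0 < α 0 ∧ StrictMono α ∧ 0 < t 0 ∧
      StrictMono t ∧ ∀ i, moment (chargeSign (2 * N + 1) (m + 1)) (powSign (2 * N + 1) (m + 1)) 1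
        (-1) (Sum.elim α t) i = 0 := by
  obtain ⟨β, hβ0, hβ1, hβ⟩ := exists_moment_inr_zero_neg N m
  have hlog : Real.log β < Real.log 2 := Real.log_lt_log hβ0 (by linarith)
  refine exists_moment_eq_zero_of_boundary (h := fun _ => 1) (ℓ := 0) (Or.inl ⟨rfl, rfl, rfl⟩)
    continuous_const (fun _ _ => one_pos) continuousOn_const
    (fun x _ => by simpa using hasDerivAt_const x (1 : ℝ)) hlog (Real.exp_log two_pos).le
    (fun a y hO hG hF => ?_) (fun a y hO hG hF => ?_)
  · exact hβ a _ hO.1 hO.2.1 hO.2.2 (by simp [Real.exp_log hβ0])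
      (fun j => paramMoment_inl_eq_zero hO hG fun _ => mul_zero _) hF
  · have h1 := le_moment_inr_zero (e := -1) one_ne_zero hO.1 hO.2.1
      (by simp [Real.exp_pos]) hO.2.2
    refine lt_of_lt_of_le ?_ h1
    simp only [Fin.cons_zero, Real.exp_log two_pos]
    norm_num

theorem exists_moment_eq_zero (N m : ℕ) (H : (ω = 1 ∧ e = 0) ∨ (ω = 2 ∧ e = 1)) :
    ∃ (α : Fin (2 * N + 1) → ℝ) (t : Fin (m + 1) → ℝ), 0 < α 0 ∧ StrictMono α ∧ 0 < t 0 ∧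
      StrictMono t ∧ ∀ i, moment (chargeSign (2 * N + 1) (m + 1)) (powSign (2 * N + 1) (m + 1)) ω e
        (Sum.elim α t) i = 0 := by
  have hden : ∀ x : ℝ, 0 < 1 + |x| := fun x => by positivity
  set ρ : ℝ := 1 / (64 * (m + 1) ^ 2) with hρ
  have hρ0 : 0 < ρ := by positivity
  have hρ2 : ρ < 2 := by
    rw [hρ, div_lt_iff₀ (by positivity)]
    nlinarith [m.cast_nonneg (α := ℝ)]
  refine exists_moment_eq_zero_of_boundary (h := fun x => x / (1 + |x|))
    (ℓ := fun x => 1 / (x * (1 + x))) (Or.inr ⟨H, rfl⟩)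
    (continuous_id.div (by fun_prop) fun x => (hden x).ne') (fun x hx => div_pos hx (hden x))
    (continuousOn_const.div (by fun_prop) fun x (hx : 0 < x) => by positivity)
    (fun x hx => ?_) (Real.log_lt_log hρ0 hρ2) (Real.exp_log two_pos).le
    (fun a y hO hG hF => ?_) (fun a y hO hG hF => ?_)
  · have h1 : HasDerivAt (fun x : ℝ => x / (1 + x)) ((1 * (1 + x) - x * 1) / (1 + x) ^ 2) x :=
      (hasDerivAt_id x).div ((hasDerivAt_id x).const_add 1) (by simp; linarith)
    have h2 : (fun x : ℝ => x / (1 + |x|)) =ᶠ[𝓝 x] fun x => x / (1 + x) := by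
      filter_upwards [lt_mem_nhds hx] with z hz
      rw [abs_of_pos hz]
    refine (h1.congr_of_eventuallyEq h2).congr_deriv ?_
    rw [abs_of_pos hx]
    field_simp
    ring
  · have ha := hO.1
    have h1 : 0 < a 0 / (1 + |a 0|) := div_pos ha (hden _)
    refine moment_inr_zero_neg_of_lower H ha hO.2.1 ?_ hO.2.2 hρ ?_ ?_ hF
    all_goals simp only [Fin.cons_zero, Real.exp_log hρ0]
    · positivity
    · exact mul_le_of_le_one_right hρ0.le ((div_le_one (hden _)).2 (by linarith [le_abs_self (a 0)]))
    · exact mul_le_mul_of_nonneg_left (div_le_self ha.le (by linarith [abs_nonneg (a 0)])) hρ0.le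
  · have ha := hO.1
    refine moment_inr_zero_pos_of_upper H ha hO.2.1 hO.2.2
      (by simp [Real.exp_log two_pos, abs_of_pos ha]) ?_
      (fun j hj => paramMoment_inl_eq_zero hO hG fun h => absurd h hj) hF
    have h1 := congrFun hG 0
    simp only [gradEnergy, Fin.val_zero, pow_zero, one_mul, if_true, Pi.zero_apply] at h1
    have h2 : 1 + a 0 ≠ 0 := by positivity
    have h3 := ha.ne'
    field_simp at h1
    exact sub_eq_zero.1 (h1.trans (mul_zero _))

end Existence

end LogGas

/-- (Exotic CHM configurations, several alternating orbits) Let `n₁ ≥ 3` be odd and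
`n₂ ≥ 1`, and suppose either `k = 2` and `ε₀ ∈ {-1, 0}`, or `k = 4` and `ε₀ = 1`.
Then there exist reals `0 < p₁ 1 < ⋯ < p₁ n₁` and `0 < p₂ 1 < ⋯ < p₂ n₂` such that
the configuration of points `p₁ j · φ^m` with charge `(+1)` for odd `j` and `(-1)` for
even `j` (here `j` is 1-based, so the charge of the 0-based index `l` is `(-1)^l`),
`p₂ j · e^{iπ/k} · φ^m` with charge `-1` (`φ = e^{2πi/k}`), together with the origin
with charge `ε₀` when `ε₀ ≠ 0`, is balanced: the force vanishes at every orbit point,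
and at the origin whenever the origin belongs to the configuration (when `ε₀ = 0` the
origin carries charge `0` and does not affect the other forces). -/
theorem exotic_CHM_alternating_balanced (n₁ n₂ k : ℕ)
    (hn₁ : 3 ≤ n₁) (hodd : Odd n₁) (hn₂ : 1 ≤ n₂) (ε₀ : ℂ)
    (hcase : (k = 2 ∧ (ε₀ = -1 ∨ ε₀ = 0)) ∨ (k = 4 ∧ ε₀ = 1)) :
    ∃ (p₁ : Fin n₁ → ℝ) (p₂ : Fin n₂ → ℝ),
      (∀ l, 0 < p₁ l) ∧ StrictMono p₁ ∧ (∀ l, 0 < p₂ l) ∧ StrictMono p₂ ∧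
      ((∀ j : (Fin n₁ × Fin k) ⊕ (Fin n₂ × Fin k),
          force
            (fun i : ((Fin n₁ × Fin k) ⊕ (Fin n₂ × Fin k)) ⊕ Unit =>
              match i with
              | Sum.inl (Sum.inl (l, m)) =>
                  (p₁ l : ℂ) * Complex.exp (2 * Real.pi * Complex.I / k) ^ (m : ℕ)
              | Sum.inl (Sum.inr (l, m)) =>
                  (p₂ l : ℂ) * Complex.exp (Real.pi * Complex.I / k) *
                    Complex.exp (2 * Real.pi * Complex.I / k) ^ (m : ℕ)
              | Sum.inr _ => 0)
            (fun i =>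
              match i with
              | Sum.inl (Sum.inl (l, _)) => (-1 : ℂ) ^ (l : ℕ)
              | Sum.inl (Sum.inr _) => -1
              | Sum.inr _ => ε₀)
            (Sum.inl j) = 0) ∧
        (ε₀ ≠ 0 →
          force
            (fun i : ((Fin n₁ × Fin k) ⊕ (Fin n₂ × Fin k)) ⊕ Unit =>
              match i with
              | Sum.inl (Sum.inl (l, m)) =>
                  (p₁ l : ℂ) * Complex.exp (2 * Real.pi * Complex.I / k) ^ (m : ℕ)
              | Sum.inl (Sum.inr (l, m)) =>
                  (p₂ l : ℂ) * Complex.exp (Real.pi * Complex.I / k) *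
                    Complex.exp (2 * Real.pi * Complex.I / k) ^ (m : ℕ)
              | Sum.inr _ => 0)
            (fun i =>
              match i with
              | Sum.inl (Sum.inl (l, _)) => (-1 : ℂ) ^ (l : ℕ)
              | Sum.inl (Sum.inr _) => -1
              | Sum.inr _ => ε₀)
            (Sum.inr ()) = 0)) := by
  obtain ⟨N, rfl⟩ := hodd
  obtain ⟨m, rfl⟩ : ∃ m, n₂ = m + 1 := ⟨n₂ - 1, by omega⟩
  have hk0 : (k : ℂ) ≠ 0 := by rcases hcase with ⟨rfl, -⟩ | ⟨rfl, -⟩ <;> norm_num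
  obtain ⟨ω, e, hω, hε, hφ, hζ, α, τ, hα0, hα, hτ0, hτ, hF⟩ : ∃ (ω : ℕ) (e : ℝ), k = 2 * ω ∧
      ε₀ = e ∧
      ((k = 2 ∧ Complex.exp (2 * Real.pi * Complex.I / k) = -1) ∨
        (k = 4 ∧ Complex.exp (2 * Real.pi * Complex.I / k) = Complex.I)) ∧
      Complex.exp (Real.pi * Complex.I / k) ^ k = -1 ∧
      ∃ (α : Fin (2 * N + 1) → ℝ) (τ : Fin (m + 1) → ℝ), 0 < α 0 ∧ StrictMono α ∧ 0 < τ 0 ∧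
        StrictMono τ ∧ ∀ i, LogGas.moment (LogGas.chargeSign (2 * N + 1) (m + 1))
          (LogGas.powSign (2 * N + 1) (m + 1)) ω e (Sum.elim α τ) i = 0 := by
    have hζ : Complex.exp (Real.pi * Complex.I / k) ^ k = -1 := by
      rw [← Complex.exp_nat_mul, mul_div_cancel₀ _ hk0, Complex.exp_pi_mul_I]
    have h2 : Complex.exp (2 * Real.pi * Complex.I / (2 : ℕ)) = -1 := by
      rw [← Complex.exp_pi_mul_I]
      congr 1
      push_cast
      ring
    have h4 : Complex.exp (2 * Real.pi * Complex.I / (4 : ℕ)) = Complex.I := by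
      refine Eq.trans ?_ Complex.exp_pi_div_two_mul_I
      congr 1
      push_cast
      ring
    rcases hcase with ⟨rfl, rfl | rfl⟩ | ⟨rfl, rfl⟩
    · exact ⟨1, -1, rfl, by simp, Or.inl ⟨rfl, h2⟩, hζ, LogGas.exists_moment_eq_zero_of_neg N m⟩
    · exact ⟨1, 0, rfl, by simp, Or.inl ⟨rfl, h2⟩, hζ,
        LogGas.exists_moment_eq_zero N m (Or.inl ⟨rfl, rfl⟩)⟩
    · exact ⟨2, 1, rfl, by simp, Or.inr ⟨rfl, h4⟩, hζ,
        LogGas.exists_moment_eq_zero N m (Or.inr ⟨rfl, rfl⟩)⟩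
  have hαp : ∀ j, 0 < α j := fun j => hα0.trans_le (hα.monotone (Fin.zero_le j))
  have hτp : ∀ l, 0 < τ l := fun l => hτ0.trans_le (hτ.monotone (Fin.zero_le l))
  have hφk : Complex.exp (2 * Real.pi * Complex.I / k) ^ k = 1 := by
    rw [← Complex.exp_nat_mul, mul_div_cancel₀ _ hk0, Complex.exp_two_pi_mul_I]
  refine ⟨fun j => √(α j), fun l => √(τ l), fun j => Real.sqrt_pos.2 (hαp j),
    fun i j hij => Real.sqrt_lt_sqrt (hαp i).le (hα hij), fun l => Real.sqrt_pos.2 (hτp l),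
    fun i j hij => Real.sqrt_lt_sqrt (hτp i).le (hτ hij), fun j => ?_, fun _ => ?_⟩
  all_goals
    exact LogGas.balanced_of_moment_eq_zero hφ hω hφk hζ hαp hτp hα hτ hF (fun _ _ => rfl)
      (fun _ _ => rfl) rfl (fun _ _ => rfl) (fun _ _ => rfl) hε _
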